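/- There is an absolute constant C > 0 such that for all integers q and k with 3 ≤ k ≤ (log q)/(400·log log q), and all reals y, z with k·log k ≤ y ≤ z ≤ q^{11/21}, one has (1/φ(q))·∑_{χ mod q} S_{y,z}(χ)^{2k} ≤ exp(C·k·(log log y)/(log y))·(e^{2γ−1}·k·(log y)/y)^k + e^{C·k}/(log y)^{19k}. -/

import Mathlib

open Real Complex MeasureTheory
open scoped BigOperators

attribute [local instance] Classical.propDecidable

/-- `e(x) = exp(2πix)` -/
noncomputable def e2pi (x : ℝ) : ℂ := Complex.exp (2 * Real.pi * Complex.I * x)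

/-- `∑_{n ≤ x} χ(n)` -/
noncomputable def charSum {q : ℕ} (χ : DirichletCharacter ℂ q) (x : ℝ) : ℂ :=
  ∑ n ∈ Finset.Icc 1 ⌊x⌋₊, χ (n : ZMod q)

/-- `M(χ) = max_{1 ≤ N ≤ q} |∑_{n ≤ N} χ(n)|` -/
noncomputable def Mchi {q : ℕ} (χ : DirichletCharacter ℂ q) : ℝ :=
  ⨆ N ∈ Finset.Icc 1 q, ‖charSum χ (N : ℝ)‖

/-- `m(χ) = π M(χ)/(e^γ √q)` -/
noncomputable def mchi {q : ℕ} (χ : DirichletCharacter ℂ q) : ℝ :=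
  Real.pi * Mchi χ / (Real.exp Real.eulerMascheroniConstant * Real.sqrt q)

/-- the modified Bessel function `I₀` -/
noncomputable def I0 (t : ℝ) : ℝ := ∑' n : ℕ, (t ^ 2 / 4) ^ n / ((n.factorial : ℝ)) ^ 2

/-- the constant `A` -/
noncomputable def Aconst : ℝ :=
  Real.log 2 - 1 - (∫ t in (0:ℝ)..2, Real.log (I0 t) / t ^ 2)
    - ∫ t in Set.Ioi (2:ℝ), (Real.log (I0 t) - t) / t ^ 2

/-- `Φ_q(τ)` -/
noncomputable def Phi (q : ℕ) (τ : ℝ) : ℝ :=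
  (Nat.card {χ : DirichletCharacter ℂ q // χ ≠ 1 ∧ τ < mchi χ} : ℝ) / q.totient

/-- `S_𝒜(χ) = max_{α ∈ [0,1]} |∑_{n ∈ 𝒜} χ(n) e(nα)/n|` -/
noncomputable def SA {q : ℕ} (χ : DirichletCharacter ℂ q) (A : Finset ℕ) : ℝ :=
  ⨆ α : Set.Icc (0:ℝ) 1, ‖∑ n ∈ A, χ (n : ZMod q) * e2pi (n * (α : ℝ)) / n‖

/-- `S_{y,z}(χ)` -/
noncomputable def Syz {q : ℕ} (χ : DirichletCharacter ℂ q) (y z : ℝ) : ℝ :=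
  SA χ ((Finset.Icc 1 ⌊z⌋₊).filter fun n => ∃ p : ℕ, p.Prime ∧ p ∣ n ∧ y < (p : ℝ))

/-- `L(1,χ)` -/
noncomputable def Lone {q : ℕ} (χ : DirichletCharacter ℂ q) : ℂ :=
  ∑' n : ℕ, χ (n : ZMod q) / n

/-- the Gauss sum `G(χ) = ∑_{a=1}^{q} χ(a) e(a/q)` -/
noncomputable def gaussS {q : ℕ} (χ : DirichletCharacter ℂ q) : ℂ :=
  ∑ a ∈ Finset.Icc 1 q, χ (a : ZMod q) * e2pi ((a : ℝ) / q)

/-- the pretentious distance `𝔻(χ, ξ; y)` -/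
noncomputable def Ddist {q D : ℕ} (χ : DirichletCharacter ℂ q) (ξ : DirichletCharacter ℂ D)
    (y : ℝ) : ℝ :=
  Real.sqrt (∑ p ∈ (Finset.Icc 1 ⌊y⌋₊).filter Nat.Prime,
    (1 - (χ (p : ZMod q) * (starRingEnd ℂ) (ξ (p : ZMod D))).re) / p)

noncomputable def zetaIncrement (n : ℕ) (s : ℂ) : ℂ :=
  (s - 1) * ((n : ℂ) + 1) ^ (-s) + ((n : ℂ) + 2) ^ (1 - s) - ((n : ℂ) + 1) ^ (1 - s)

/-- The function `(s - 1) ζ(s)`, as a series converging on `0 < re s`. -/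
noncomputable def zetaRegular (s : ℂ) : ℂ := 1 + ∑' n, zetaIncrement n s

lemma norm_cpow_neg_sub_le {a x : ℝ} (ha : 0 < a) (hax : a ≤ x) (hx : x ≤ a + 1) {s : ℂ}
    (hs : 0 < s.re) :
    ‖(x : ℂ) ^ (-s) - (a : ℂ) ^ (-s)‖ ≤ ‖s‖ * a ^ (-s.re - 1) := by
  have hd : ∀ t ∈ Set.Icc a x, HasDerivWithinAt (fun t : ℝ => (t : ℂ) ^ (-s))
      (-s * (t : ℂ) ^ (-s - 1)) (Set.Icc a x) t := fun t ht => by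
    have ht0 : (0:ℝ) < t := ha.trans_le ht.1
    have hsl : (t : ℂ) ∈ Complex.slitPlane := by simp [Complex.mem_slitPlane_iff, ht0]
    have h1 := (hasDerivAt_id (t : ℂ)).cpow_const (c := -s) hsl
    simpa using h1.comp_ofReal.hasDerivWithinAt
  have hb : ∀ t ∈ Set.Ico a x, ‖-s * (t : ℂ) ^ (-s - 1)‖ ≤ ‖s‖ * a ^ (-s.re - 1) := fun t ht => by
    have ht0 : (0:ℝ) < t := ha.trans_le ht.1
    rw [norm_mul, norm_neg, Complex.norm_cpow_eq_rpow_re_of_pos ht0]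
    simp only [Complex.sub_re, Complex.neg_re, Complex.one_re]
    gcongr ?_ * ?_
    exact Real.rpow_le_rpow_of_nonpos ha ht.1 (by linarith)
  have := norm_image_sub_le_of_norm_deriv_le_segment' hd hb x ⟨hax, le_rfl⟩
  refine this.trans ?_
  have h0 : 0 ≤ ‖s‖ * a ^ (-s.re - 1) := by positivity
  nlinarith

lemma norm_zetaIncrement_le (n : ℕ) {s : ℂ} (hs : 0 < s.re) :
    ‖zetaIncrement n s‖ ≤ ‖s - 1‖ * ‖s‖ * ((n : ℝ) + 1) ^ (-s.re - 1) := by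
  set a : ℝ := (n : ℝ) + 1 with ha
  have ha0 : 0 < a := by positivity
  have hd : ∀ t ∈ Set.Icc a (a + 1), HasDerivWithinAt
      (fun t : ℝ => (s - 1) * (a : ℂ) ^ (-s) * (t : ℂ) + (t : ℂ) ^ (1 - s))
      ((s - 1) * (a : ℂ) ^ (-s) + (1 - s) * (t : ℂ) ^ (-s)) (Set.Icc a (a + 1)) t := fun t ht => by
    have ht0 : (0:ℝ) < t := ha0.trans_le ht.1
    have hsl : (t : ℂ) ∈ Complex.slitPlane := by simp [Complex.mem_slitPlane_iff, ht0]
    have h1 := (((hasDerivAt_id (t : ℂ)).const_mul ((s - 1) * (a : ℂ) ^ (-s))).add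
      ((hasDerivAt_id (t : ℂ)).cpow_const (c := 1 - s) hsl)).comp_ofReal.hasDerivWithinAt
        (s := Set.Icc a (a + 1))
    convert! h1 using 1
    simp
  have hb : ∀ t ∈ Set.Ico a (a + 1), ‖(s - 1) * (a : ℂ) ^ (-s) + (1 - s) * (t : ℂ) ^ (-s)‖ ≤
      ‖s - 1‖ * ‖s‖ * a ^ (-s.re - 1) := fun t ht => by
    have : (s - 1) * (a : ℂ) ^ (-s) + (1 - s) * (t : ℂ) ^ (-s) =
      -(s - 1) * ((t : ℂ) ^ (-s) - (a : ℂ) ^ (-s)) := by ring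
    rw [this, norm_mul, norm_neg, mul_assoc]
    gcongr
    exact norm_cpow_neg_sub_le ha0 ht.1 ht.2.le hs
  have := norm_image_sub_le_of_norm_deriv_le_segment' hd hb (a + 1) ⟨by linarith, le_rfl⟩
  have e : zetaIncrement n s = ((s - 1) * (a : ℂ) ^ (-s) * ((a + 1 : ℝ) : ℂ) + ((a + 1 : ℝ) : ℂ) ^ (1 - s))
     - ((s - 1) * (a : ℂ) ^ (-s) * (a : ℂ) + (a : ℂ) ^ (1 - s)) := by
    simp only [zetaIncrement, ha]
    push_cast
    rw [show (n : ℂ) + 1 + 1 = n + 2 by ring]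
    ring
  rw [e]
  refine this.trans (le_of_eq ?_)
  ring

lemma differentiable_zetaIncrement (n : ℕ) : Differentiable ℂ (zetaIncrement n) := by
  have h1 : (n : ℂ) + 1 ≠ 0 := by exact_mod_cast Nat.succ_ne_zero n
  have h2 : (n : ℂ) + 2 ≠ 0 := by exact_mod_cast Nat.succ_ne_zero (n + 1)
  intro s
  unfold zetaIncrement
  refine ((DifferentiableAt.mul (by fun_prop) ?_).add ?_).sub ?_
  · exact DifferentiableAt.const_cpow (by fun_prop) (Or.inl h1)
  · exact DifferentiableAt.const_cpow (by fun_prop) (Or.inl h2)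
  · exact DifferentiableAt.const_cpow (by fun_prop) (Or.inl h1)

lemma summable_nat_add_one_rpow {a : ℝ} (ha : a < -1) :
    Summable fun n : ℕ => ((n : ℝ) + 1) ^ a := by
  have := (summable_nat_add_iff 1).2 (Real.summable_nat_rpow.2 ha)
  simpa using this

lemma summable_zetaIncrement {s : ℂ} (hs : 0 < s.re) : Summable fun n => zetaIncrement n s :=
  Summable.of_norm_bounded ((summable_nat_add_one_rpow (a := -s.re - 1) (by linarith)).mul_left _)
    fun n => norm_zetaIncrement_le n hs

lemma differentiableAt_zetaRegular {s : ℂ} (hs : 0 < s.re) :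
    DifferentiableAt ℂ zetaRegular s := by
  set U : Set ℂ := {w | s.re / 2 < w.re} ∩ Metric.ball 0 (‖s‖ + 1) with hU
  have hUo : IsOpen U :=
    (isOpen_lt continuous_const Complex.continuous_re).inter Metric.isOpen_ball
  have hsU : s ∈ U := ⟨by simp; linarith, by simp⟩
  have key : DifferentiableOn ℂ (fun w => ∑' n, zetaIncrement n w) U := by
    refine Complex.differentiableOn_tsum_of_summable_norm
      (u := fun n : ℕ => (‖s‖ + 2) * (‖s‖ + 1) * ((n : ℝ) + 1) ^ (-(s.re / 2) - 1))
      ((summable_nat_add_one_rpow (by linarith)).mul_left _)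
      (fun n => (differentiable_zetaIncrement n).differentiableOn) hUo ?_
    intro n w hw
    have h1 : s.re / 2 < w.re := hw.1
    have h2 : ‖w‖ < ‖s‖ + 1 := by simpa using hw.2
    refine (norm_zetaIncrement_le n (by linarith)).trans ?_
    gcongr
    · exact (norm_sub_le _ _).trans (by simp; linarith)
    · linarith [(Nat.cast_nonneg n : (0:ℝ) ≤ n)]
  exact ((key.differentiableAt (hUo.mem_nhds hsU)).const_add 1)

lemma sum_zetaIncrement (N : ℕ) (s : ℂ) :
    ∑ n ∈ Finset.range N, zetaIncrement n s =
      (s - 1) * ∑ n ∈ Finset.range N, ((n : ℂ) + 1) ^ (-s) + ((N : ℂ) + 1) ^ (1 - s) - 1 := by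
  induction N with
  | zero => simp
  | succ N ih =>
    rw [Finset.sum_range_succ, ih, Finset.sum_range_succ, zetaIncrement]
    push_cast
    rw [show (N : ℂ) + 1 + 1 = N + 2 by ring]
    ring

lemma zetaRegular_eq (N : ℕ) {s : ℂ} (hs : 0 < s.re) :
    zetaRegular s = (s - 1) * ∑ n ∈ Finset.range N, ((n : ℂ) + 1) ^ (-s) + ((N : ℂ) + 1) ^ (1 - s)
      + ∑' n, zetaIncrement (n + N) s := by
  rw [zetaRegular, ← (summable_zetaIncrement hs).sum_add_tsum_nat_add N, sum_zetaIncrement]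
  ring

lemma zetaRegular_one : zetaRegular 1 = 1 := by
  have : ∀ n, zetaIncrement n 1 = 0 := fun n => by simp [zetaIncrement]
  simp [zetaRegular, this]

lemma zetaRegular_eq_of_one_lt_re {s : ℂ} (hs : 1 < s.re) :
    zetaRegular s = (s - 1) * riemannZeta s := by
  have hs0 : 0 < s.re := by linarith
  have h1 : Filter.Tendsto (fun N : ℕ => 1 + ∑ n ∈ Finset.range N, zetaIncrement n s) Filter.atTop
      (nhds (zetaRegular s)) :=
    ((summable_zetaIncrement hs0).hasSum.tendsto_sum_nat).const_add 1
  have h2 : Filter.Tendsto (fun N : ℕ => (s - 1) * ∑ n ∈ Finset.range N, ((n : ℂ) + 1) ^ (-s) +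
      ((N : ℂ) + 1) ^ (1 - s)) Filter.atTop (nhds ((s - 1) * riemannZeta s + 0)) := by
    refine (Filter.Tendsto.const_mul _ ?_).add ?_
    · rw [zeta_eq_tsum_one_div_nat_add_one_cpow hs]
      have hsum : Summable fun n : ℕ => 1 / ((n : ℂ) + 1) ^ s := by
        have := (summable_nat_add_iff 1).2 (Complex.summable_one_div_nat_cpow.2 hs)
        simpa using this
      simpa [Complex.cpow_neg] using hsum.hasSum.tendsto_sum_nat
    · rw [tendsto_zero_iff_norm_tendsto_zero]
      have h3 : Filter.Tendsto (fun N : ℕ => ((N : ℝ) + 1) ^ (-(s.re - 1))) Filter.atTop (nhds 0) :=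
        (tendsto_rpow_neg_atTop (by linarith)).comp
          (Filter.tendsto_atTop_add_const_right _ 1 tendsto_natCast_atTop_atTop)
      refine h3.congr fun N => ?_
      have := Complex.norm_cpow_eq_rpow_re_of_pos (x := (N : ℝ) + 1) (by positivity) (1 - s)
      push_cast at this
      rw [this]
      simp
  rw [add_zero] at h2
  refine tendsto_nhds_unique h1 (h2.congr fun N => ?_)
  rw [sum_zetaIncrement]
  ring

lemma continuousOn_zetaRegular : ContinuousOn zetaRegular {s | 0 < s.re} := fun _ hs =>
  (differentiableAt_zetaRegular hs).continuousAt.continuousWithinAt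

lemma zetaRegular_eq_of_one_le_re {s : ℂ} (hs : 1 ≤ s.re) (hs1 : s ≠ 1) :
    zetaRegular s = (s - 1) * riemannZeta s := by
  have hc : ContinuousAt (fun w => zetaRegular w - (w - 1) * riemannZeta w) s :=
    (differentiableAt_zetaRegular (by linarith)).continuousAt.sub
      (((continuous_id.sub continuous_const).continuousAt).mul
        (differentiableAt_riemannZeta hs1).continuousAt)
  have hl : Filter.Tendsto (fun x : ℝ => s + x) (nhdsWithin 0 (Set.Ioi 0)) (nhds s) := by
    have : Continuous fun x : ℝ => s + x := by fun_prop
    simpa using (this.tendsto 0).mono_left nhdsWithin_le_nhds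
  have h0 := hc.tendsto.comp hl
  have h1 : Filter.Tendsto ((fun w => zetaRegular w - (w - 1) * riemannZeta w) ∘ fun x : ℝ => s + x)
      (nhdsWithin 0 (Set.Ioi 0)) (nhds 0) := by
    refine tendsto_const_nhds.congr' ?_
    filter_upwards [self_mem_nhdsWithin] with x hx
    have hx' : 0 < x := hx
    simp [zetaRegular_eq_of_one_lt_re (s := s + x) (by simp; linarith)]
  exact sub_eq_zero.1 (tendsto_nhds_unique h0 h1)

lemma zetaRegular_ne_zero {s : ℂ} (hs : 1 ≤ s.re) : zetaRegular s ≠ 0 := by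
  rcases eq_or_ne s 1 with rfl | h
  · simp [zetaRegular_one]
  · rw [zetaRegular_eq_of_one_le_re hs h]
    exact mul_ne_zero (sub_ne_zero.2 h) (riemannZeta_ne_zero_of_one_le_re hs)

lemma sum_range_rpow_neg_le {N : ℕ} {τ : ℝ} (hN : (N : ℝ) ≤ τ) (hτ : 1 ≤ τ) :
    ∑ n ∈ Finset.range N, ((n : ℝ) + 1) ^ (-(99 / 100 : ℝ)) ≤ 101 * τ ^ (1 / 50 : ℝ) := by
  have h1 : ∀ n ∈ Finset.range N, ((n : ℝ) + 1) ^ (-(99 / 100 : ℝ)) ≤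
      τ ^ (1 / 100 : ℝ) * ((n : ℝ) + 1)⁻¹ := fun n hn => by
    have hn' : (n : ℝ) + 1 ≤ τ := by
      have : (n : ℝ) + 1 ≤ N := by exact_mod_cast Finset.mem_range.1 hn
      linarith
    rw [show (-(99 / 100 : ℝ)) = 1 / 100 + -1 by norm_num, Real.rpow_add (by positivity),
      Real.rpow_neg_one]
    gcongr
  refine (Finset.sum_le_sum h1).trans ?_
  rw [← Finset.mul_sum]
  have h2 : ∑ n ∈ Finset.range N, ((n : ℝ) + 1)⁻¹ ≤ 1 + Real.log τ := by
    have := harmonic_le_one_add_log N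
    have e : ((harmonic N : ℚ) : ℝ) = ∑ n ∈ Finset.range N, ((n : ℝ) + 1)⁻¹ := by
      simp [harmonic]
    rw [← e]
    refine this.trans ?_
    rcases Nat.eq_zero_or_pos N with rfl | h0
    · simpa using Real.log_nonneg hτ
    · gcongr
  have h3 : Real.log τ ≤ 100 * τ ^ (1 / 100 : ℝ) := by
    have := Real.log_le_rpow_div (by linarith : 0 ≤ τ) (by norm_num : (0:ℝ) < 1 / 100)
    linarith
  have h4 : 1 ≤ τ ^ (1 / 100 : ℝ) := Real.one_le_rpow hτ (by norm_num)
  calc τ ^ (1 / 100 : ℝ) * ∑ n ∈ Finset.range N, ((n : ℝ) + 1)⁻¹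
      ≤ τ ^ (1 / 100 : ℝ) * (101 * τ ^ (1 / 100 : ℝ)) := by gcongr; linarith
    _ = 101 * (τ ^ (1 / 100 : ℝ) * τ ^ (1 / 100 : ℝ)) := by ring
    _ = 101 * τ ^ (1 / 50 : ℝ) := by rw [← Real.rpow_add (by linarith)]; norm_num

lemma norm_zetaRegular_le : ∃ C : ℝ, 0 < C ∧ ∀ s : ℂ, 99 / 100 ≤ s.re → s.re ≤ 4 →
    ‖zetaRegular s‖ ≤ C * (|s.im| + 2) ^ (51 / 50 : ℝ) := by
  set K : ℝ := ∑' n : ℕ, ((n : ℝ) + 1) ^ (-(101 / 100) : ℝ) with hK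
  have hKs := summable_nat_add_one_rpow (a := -(101 / 100 : ℝ)) (by norm_num)
  have hK0 : 0 ≤ K := tsum_nonneg fun n => by positivity
  refine ⟨202 + 2 + 4 * K, by positivity, fun s hs1 hs4 => ?_⟩
  set τ : ℝ := |s.im| + 2 with hτ
  have hτ2 : 2 ≤ τ := by simp [hτ]
  have hτ0 : 0 < τ := by linarith
  set N := ⌊τ⌋₊ with hN
  have hNτ : (N : ℝ) ≤ τ := Nat.floor_le hτ0.le
  have hτN : τ < N + 1 := Nat.lt_floor_add_one τ
  have hre : |s.re| ≤ 4 := abs_le.2 ⟨by linarith, hs4⟩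
  have hns : ‖s‖ ≤ 2 * τ := (Complex.norm_le_abs_re_add_abs_im s).trans (by linarith)
  have hns1 : ‖s - 1‖ ≤ 2 * τ := by
    refine (Complex.norm_le_abs_re_add_abs_im _).trans ?_
    have : |(s - 1).re| ≤ 3 := abs_le.2 ⟨by simp; linarith, by simp; linarith⟩
    have h2 : |(s - 1).im| = |s.im| := by simp
    linarith
  have hnorm : ∀ n : ℕ, ∀ w : ℂ, ‖((n : ℂ) + 1) ^ w‖ = ((n : ℝ) + 1) ^ w.re := fun n w => by
    have := Complex.norm_cpow_eq_rpow_re_of_pos (x := (n : ℝ) + 1) (by positivity) w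
    push_cast at this
    exact this
  have hA : ‖(s - 1) * ∑ n ∈ Finset.range N, ((n : ℂ) + 1) ^ (-s)‖ ≤ 202 * τ ^ (51 / 50 : ℝ) := by
    rw [norm_mul]
    have : ‖∑ n ∈ Finset.range N, ((n : ℂ) + 1) ^ (-s)‖ ≤ 101 * τ ^ (1 / 50 : ℝ) := by
      refine (norm_sum_le _ _).trans (le_trans (Finset.sum_le_sum fun n _ => ?_)
        (sum_range_rpow_neg_le hNτ (by linarith)))
      rw [hnorm]
      exact Real.rpow_le_rpow_of_exponent_le (by simp) (by simp; linarith)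
    calc _ ≤ (2 * τ) * (101 * τ ^ (1 / 50 : ℝ)) := by gcongr
      _ = 202 * (τ ^ (1:ℝ) * τ ^ (1 / 50 : ℝ)) := by rw [Real.rpow_one]; ring
      _ = _ := by rw [← Real.rpow_add hτ0]; norm_num
  have hB : ‖((N : ℂ) + 1) ^ (1 - s)‖ ≤ 2 * τ ^ (51 / 50 : ℝ) := by
    rw [hnorm]
    calc ((N : ℝ) + 1) ^ (1 - s).re ≤ ((N : ℝ) + 1) ^ (1:ℝ) :=
          Real.rpow_le_rpow_of_exponent_le (by simp) (by simp; linarith)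
      _ ≤ 2 * τ := by rw [Real.rpow_one]; linarith
      _ ≤ _ := by
        gcongr
        nth_rw 1 [← Real.rpow_one τ]
        exact Real.rpow_le_rpow_of_exponent_le (by linarith) (by norm_num)
  have hC : ‖∑' n, zetaIncrement (n + N) s‖ ≤ 4 * K * τ ^ (51 / 50 : ℝ) := by
    have hb : ∀ n : ℕ, ‖zetaIncrement (n + N) s‖ ≤
        (4 * τ ^ (51 / 50 : ℝ)) * ((n : ℝ) + 1) ^ (-(101 / 100) : ℝ) := fun n => by
      refine (norm_zetaIncrement_le (n + N) (s := s) (by linarith)).trans ?_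
      push_cast
      have hbase : (1:ℝ) ≤ (n : ℝ) + N + 1 := by linarith [(Nat.cast_nonneg n : (0:ℝ) ≤ n), (Nat.cast_nonneg N : (0:ℝ) ≤ N)]
      calc ‖s - 1‖ * ‖s‖ * ((n : ℝ) + N + 1) ^ (-s.re - 1)
          ≤ (2 * τ) * (2 * τ) * ((n : ℝ) + N + 1) ^ (-(101 / 100) + -(98 / 100) : ℝ) := by
            gcongr
            linarith
        _ = (2 * τ) * (2 * τ) * (((n : ℝ) + N + 1) ^ (-(101 / 100) : ℝ) *
            ((n : ℝ) + N + 1) ^ (-(98 / 100) : ℝ)) := by rw [Real.rpow_add (by linarith)]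
        _ ≤ (2 * τ) * (2 * τ) * (((n : ℝ) + 1) ^ (-(101 / 100) : ℝ) * τ ^ (-(98 / 100) : ℝ)) := by
            gcongr ?_ * (?_ * ?_)
            · exact Real.rpow_le_rpow_of_nonpos (by positivity)
                (by linarith [(Nat.cast_nonneg N : (0:ℝ) ≤ N)]) (by norm_num)
            · exact Real.rpow_le_rpow_of_nonpos hτ0
                (by linarith [(Nat.cast_nonneg n : (0:ℝ) ≤ n)]) (by norm_num)
        _ = 4 * (τ ^ (2:ℝ) * τ ^ (-(98 / 100) : ℝ)) * ((n : ℝ) + 1) ^ (-(101 / 100) : ℝ) := by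
            rw [Real.rpow_two]; ring
        _ = _ := by rw [← Real.rpow_add hτ0]; norm_num
    refine (tsum_of_norm_bounded (hKs.hasSum.mul_left _) hb).trans (le_of_eq ?_)
    rw [← hK]; ring
  rw [zetaRegular_eq N (by linarith)]
  calc _ ≤ _ := norm_add₃_le
    _ ≤ 202 * τ ^ (51 / 50 : ℝ) + 2 * τ ^ (51 / 50 : ℝ) + 4 * K * τ ^ (51 / 50 : ℝ) := by gcongr
    _ = _ := by ring

lemma norm_deriv_zetaRegular_le : ∃ C : ℝ, 0 < C ∧ ∀ s : ℂ, 199 / 200 ≤ s.re → s.re ≤ 3 →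
    ‖deriv zetaRegular s‖ ≤ C * (|s.im| + 2) ^ (51 / 50 : ℝ) := by
  obtain ⟨C, hC0, hC⟩ := norm_zetaRegular_le
  refine ⟨C * 2 ^ (51 / 50 : ℝ) / (1 / 200), by positivity, fun s hs1 hs3 => ?_⟩
  have hball : ∀ z ∈ Metric.closedBall s (1 / 200 : ℝ), 99 / 100 ≤ z.re ∧ z.re ≤ 4 ∧
      |z.im| + 2 ≤ 2 * (|s.im| + 2) := fun z hz => by
    have hz' : ‖z - s‖ ≤ 1 / 200 := by simpa [dist_eq_norm] using hz
    have h1 := (Complex.abs_re_le_norm (z - s)).trans hz'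
    have h2 := (Complex.abs_im_le_norm (z - s)).trans hz'
    rw [Complex.sub_re, abs_le] at h1
    rw [Complex.sub_im] at h2
    have h3 := abs_sub_abs_le_abs_sub z.im s.im
    have h4 := abs_nonneg s.im
    exact ⟨by linarith, by linarith, by linarith⟩
  have hd : DiffContOnCl ℂ zetaRegular (Metric.ball s (1 / 200)) := by
    apply DifferentiableOn.diffContOnCl
    intro z hz
    rw [closure_ball _ (by norm_num)] at hz
    exact (differentiableAt_zetaRegular (by linarith [(hball z hz).1])).differentiableWithinAt
  have := Complex.norm_deriv_le_of_forall_mem_sphere_norm_le (by norm_num : (0:ℝ) < 1 / 200) hd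
    (C := C * 2 ^ (51 / 50 : ℝ) * (|s.im| + 2) ^ (51 / 50 : ℝ)) fun z hz => by
      obtain ⟨h1, h2, h3⟩ := hball z (Metric.sphere_subset_closedBall hz)
      refine (hC z h1 h2).trans ?_
      rw [mul_assoc, ← Real.mul_rpow (by norm_num) (by positivity)]
      gcongr
  refine this.trans (le_of_eq ?_)
  ring

lemma zeta_product_ge_one {x : ℝ} (hx : 0 < x) (t : ℝ) :
    1 ≤ ‖riemannZeta (1 + x)‖ ^ 3 * ‖riemannZeta (1 + x + I * t)‖ ^ 4 *
      ‖riemannZeta (1 + x + 2 * I * t)‖ := by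
  have := DirichletCharacter.norm_LFunction_product_ge_one (1 : DirichletCharacter ℂ 1) hx t
  simpa [DirichletCharacter.LFunctionTrivChar, DirichletCharacter.LFunction_modOne_eq] using this

lemma zetaRegular_pow_four_ge : ∃ K : ℝ, 0 < K ∧ ∀ x t : ℝ, 0 < x → x ≤ 1 → 1 ≤ |t| →
    x ^ 3 * (|t| + 2) ^ 5 ≤ K * ‖zetaRegular (1 + x + I * t)‖ ^ 4 * (|t| + 2) ^ (51 / 50 : ℝ) := by
  obtain ⟨C, hC0, hC⟩ := norm_zetaRegular_le
  refine ⟨243 * (4 * C) ^ 4, by positivity, fun x t hx hx1 ht => ?_⟩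
  set τ : ℝ := |t| + 2 with hτ
  have h4 : (2:ℝ) ^ (51 / 50 : ℝ) ≤ 4 := by
    calc (2:ℝ) ^ (51 / 50 : ℝ) ≤ 2 ^ (2:ℝ) :=
          Real.rpow_le_rpow_of_exponent_le (by norm_num) (by norm_num)
      _ = 4 := by norm_num
  have hz : ∀ s : ℂ, 1 < s.re → ‖zetaRegular s‖ = ‖s - 1‖ * ‖riemannZeta s‖ := fun s hs => by
    rw [zetaRegular_eq_of_one_lt_re hs, norm_mul]
  have hr1 : (1 : ℝ) < (1 + x : ℂ).re := by simp [hx]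
  have hr2 : (1 : ℝ) < (1 + x + I * t : ℂ).re := by simp [hx]
  have hr3 : (1 : ℝ) < (1 + x + 2 * I * t : ℂ).re := by simp [hx]
  have b1 : ‖zetaRegular (1 + x)‖ ≤ 4 * C := by
    refine (hC _ (by linarith) (by simp; linarith)).trans ?_
    simp only [Complex.add_im, Complex.one_im, Complex.ofReal_im, add_zero, abs_zero, zero_add]
    nlinarith
  have b3 : ‖zetaRegular (1 + x + 2 * I * t)‖ ≤ 4 * C * τ ^ (51 / 50 : ℝ) := by
    refine (hC _ (by linarith) (by simp; linarith)).trans ?_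
    have : |(1 + x + 2 * I * t : ℂ).im| + 2 ≤ 2 * τ := by
      simp [abs_mul, hτ]; linarith
    calc C * (|(1 + x + 2 * I * t : ℂ).im| + 2) ^ (51 / 50 : ℝ)
        ≤ C * (2 * τ) ^ (51 / 50 : ℝ) := by gcongr
      _ = C * (2 ^ (51 / 50 : ℝ) * τ ^ (51 / 50 : ℝ)) := by
        rw [Real.mul_rpow (by norm_num) (by positivity)]
      _ ≤ C * (4 * τ ^ (51 / 50 : ℝ)) := by gcongr
      _ = _ := by ring
  have d1 : ‖(1 + x : ℂ) - 1‖ = x := by simp [abs_of_pos hx]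
  have d2 : τ / 3 ≤ ‖(1 + x + I * t : ℂ) - 1‖ := by
    refine le_trans ?_ (Complex.abs_im_le_norm _)
    simp; linarith
  have d3 : τ / 3 ≤ ‖(1 + x + 2 * I * t : ℂ) - 1‖ := by
    refine le_trans ?_ (Complex.abs_im_le_norm _)
    simp [abs_mul]; linarith
  have hp := zeta_product_ge_one hx t
  rw [hz _ hr1, d1] at b1
  rw [hz _ hr3] at b3
  rw [hz _ hr2]
  have hτ0 : 0 < τ := by positivity
  set a := ‖riemannZeta (1 + x)‖
  set b := ‖riemannZeta (1 + x + I * t)‖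
  set c := ‖riemannZeta (1 + x + 2 * I * t)‖
  set e := ‖(1 + x + I * t : ℂ) - 1‖
  set f := ‖(1 + x + 2 * I * t : ℂ) - 1‖
  calc x ^ 3 * τ ^ 5 = 243 * (x ^ 3 * ((τ / 3) ^ 4 * (τ / 3))) * 1 := by ring
    _ ≤ 243 * (x ^ 3 * (e ^ 4 * f)) * (a ^ 3 * b ^ 4 * c) := by gcongr
    _ = 243 * ((x * a) ^ 3 * (e * b) ^ 4 * (f * c)) := by ring
    _ ≤ 243 * ((4 * C) ^ 3 * (e * b) ^ 4 * (4 * C * τ ^ (51 / 50 : ℝ))) := by gcongr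
    _ = _ := by ring

lemma norm_zetaRegular_ge : ∃ c : ℝ, 0 < c ∧ ∀ s : ℂ, 1 ≤ s.re → s.re ≤ 2 →
    c * (|s.im| + 2) ^ (23 / 25 : ℝ) ≤ ‖zetaRegular s‖ := by
  obtain ⟨K, hK0, hK⟩ := zetaRegular_pow_four_ge
  obtain ⟨D, hD0, hD⟩ := norm_deriv_zetaRegular_le
  have hcomp : IsCompact (Set.Icc (1:ℝ) 2 ×ℂ Set.Icc (-1:ℝ) 1) :=
    isCompact_Icc.reProdIm isCompact_Icc
  obtain ⟨s₀, hs₀, hmin⟩ := hcomp.exists_isMinOn ⟨1, by simp [Complex.mem_reProdIm]⟩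
    (f := fun s => ‖zetaRegular s‖) (by
      refine (continuousOn_zetaRegular.mono fun s hs => ?_).norm
      have := (Complex.mem_reProdIm.1 hs).1.1
      show 0 < s.re
      linarith)
  have hm0 : 0 < ‖zetaRegular s₀‖ :=
    norm_pos_iff.2 (zetaRegular_ne_zero (Complex.mem_reProdIm.1 hs₀).1.1)
  set m := ‖zetaRegular s₀‖
  set c : ℝ := min 1 (1 / (16 * K * D ^ 4)) with hc
  have hc0 : 0 < c := by positivity
  have hcK : 16 * K * D ^ 4 * c ≤ 1 := by
    have : c ≤ 1 / (16 * K * D ^ 4) := min_le_right _ _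
    rwa [le_div_iff₀ (by positivity), mul_comm] at this
  refine ⟨min (m / 3) (D * c), by positivity, fun s hs1 hs2 => ?_⟩
  set τ : ℝ := |s.im| + 2 with hτ
  have hτ0 : 0 < τ := by positivity
  rcases le_total |s.im| 1 with ht | ht
  · have h1 : m ≤ ‖zetaRegular s‖ := hmin (Complex.mem_reProdIm.2 ⟨⟨hs1, hs2⟩, abs_le.1 ht⟩)
    have h2 : τ ^ (23 / 25 : ℝ) ≤ 3 := by
      calc τ ^ (23 / 25 : ℝ) ≤ 3 ^ (23 / 25 : ℝ) := by gcongr; linarith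
        _ ≤ 3 ^ (1:ℝ) := Real.rpow_le_rpow_of_exponent_le (by norm_num) (by norm_num)
        _ = 3 := by norm_num
    calc min (m / 3) (D * c) * τ ^ (23 / 25 : ℝ) ≤ m / 3 * 3 := by gcongr; exact min_le_left _ _
      _ ≤ _ := by linarith
  · have hbig : ∀ x : ℝ, c * τ ^ (-(1 / 10) : ℝ) ≤ x → x ≤ 1 →
        2 * D * c * τ ^ (23 / 25 : ℝ) ≤ ‖zetaRegular (1 + x + I * s.im)‖ := fun x hx hx1 => by
      have hx0 : 0 < x := lt_of_lt_of_le (by positivity) hx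
      have h := hK x s.im hx0 hx1 ht
      refine le_of_pow_le_pow_left₀ (by norm_num : (4:ℕ) ≠ 0) (norm_nonneg _) ?_
      have h5 : (c * τ ^ (-(1 / 10) : ℝ)) ^ 3 * τ ^ 5 ≤
          K * ‖zetaRegular (1 + x + I * s.im)‖ ^ 4 * τ ^ (51 / 50 : ℝ) :=
        le_trans (by gcongr) h
      have e1 : (c * τ ^ (-(1 / 10) : ℝ)) ^ 3 * τ ^ 5 =
          c ^ 3 * τ ^ (92 / 25 : ℝ) * τ ^ (51 / 50 : ℝ) := by
        rw [mul_pow, ← Real.rpow_natCast (τ ^ (-(1 / 10) : ℝ)) 3, ← Real.rpow_mul hτ0.le,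
          ← Real.rpow_natCast τ 5, mul_assoc, mul_assoc, ← Real.rpow_add hτ0, ← Real.rpow_add hτ0]
        norm_num
      have e2 : (2 * D * c * τ ^ (23 / 25 : ℝ)) ^ 4 = 16 * D ^ 4 * c ^ 4 * τ ^ (92 / 25 : ℝ) := by
        rw [mul_pow, ← Real.rpow_natCast (τ ^ (23 / 25 : ℝ)) 4, ← Real.rpow_mul hτ0.le]
        norm_num
        left; ring
      rw [e1] at h5
      have h6 := le_of_mul_le_mul_right h5 (by positivity)
      rw [e2]
      refine le_of_mul_le_mul_left (le_trans ?_ h6) hK0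
      calc K * (16 * D ^ 4 * c ^ 4 * τ ^ (92 / 25 : ℝ))
          = (16 * K * D ^ 4 * c) * (c ^ 3 * τ ^ (92 / 25 : ℝ)) := by ring
        _ ≤ 1 * (c ^ 3 * τ ^ (92 / 25 : ℝ)) := by gcongr
        _ = _ := one_mul _
    have hs : s = 1 + ((s.re - 1 : ℝ) : ℂ) + I * s.im := by
      apply Complex.ext <;> simp
    have hle : min (m / 3) (D * c) * τ ^ (23 / 25 : ℝ) ≤ D * c * τ ^ (23 / 25 : ℝ) := by
      gcongr; exact min_le_right _ _
    refine hle.trans ?_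
    set x₀ : ℝ := c * τ ^ (-(1 / 10) : ℝ) with hx₀
    have hx₀0 : 0 < x₀ := by positivity
    have hx₀1 : x₀ ≤ 1 := by
      have h1 : τ ^ (-(1 / 10) : ℝ) ≤ 1 :=
        Real.rpow_le_one_of_one_le_of_nonpos (by linarith) (by norm_num)
      have h2 : c ≤ 1 := min_le_left _ _
      have h3 : 0 ≤ τ ^ (-(1 / 10) : ℝ) := by positivity
      exact mul_le_one₀ h2 h3 h1
    rcases le_total x₀ (s.re - 1) with hx | hx
    · have := hbig (s.re - 1) hx (by linarith)
      rw [← hs] at this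
      have h0 : 0 ≤ D * c * τ ^ (23 / 25 : ℝ) := by positivity
      linarith
    · have h0 := hbig x₀ le_rfl hx₀1
      set s' : ℂ := 1 + x₀ + I * s.im with hs'
      have hconv : Convex ℝ (Set.Icc (1:ℝ) 2 ×ℂ {s.im}) :=
        ((convex_Icc (1:ℝ) 2).linear_preimage Complex.reLm).inter
          ((convex_singleton s.im).linear_preimage Complex.imLm)
      have hmv := hconv.norm_image_sub_le_of_norm_deriv_le (𝕜 := ℂ) (f := zetaRegular)
        (C := D * τ ^ (51 / 50 : ℝ)) (x := s) (y := s')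
        (fun w hw => differentiableAt_zetaRegular (by
          have := (Complex.mem_reProdIm.1 hw).1.1; linarith))
        (fun w hw => by
          obtain ⟨⟨h1, h2⟩, h3⟩ := Complex.mem_reProdIm.1 hw
          have := hD w (by linarith) (by linarith)
          rwa [show w.im = s.im from h3] at this)
        (Complex.mem_reProdIm.2 ⟨⟨hs1, hs2⟩, rfl⟩)
        (Complex.mem_reProdIm.2 ⟨⟨by simp [hs']; linarith, by simp [hs']; linarith⟩, by simp [hs']⟩)
      have hdist : ‖s' - s‖ ≤ x₀ := by
        have : s' - s = ((x₀ - (s.re - 1) : ℝ) : ℂ) := by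
          apply Complex.ext <;> simp [hs']; ring
        rw [this, Complex.norm_real, Real.norm_eq_abs, abs_of_nonneg (by linarith)]
        linarith
      have hmv2 : ‖zetaRegular s' - zetaRegular s‖ ≤ D * c * τ ^ (23 / 25 : ℝ) := by
        refine hmv.trans ?_
        calc D * τ ^ (51 / 50 : ℝ) * ‖s' - s‖ ≤ D * τ ^ (51 / 50 : ℝ) * x₀ := by gcongr
          _ = D * c * (τ ^ (51 / 50 : ℝ) * τ ^ (-(1 / 10) : ℝ)) := by rw [hx₀]; ring
          _ = _ := by rw [← Real.rpow_add hτ0]; norm_num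
      have := norm_sub_norm_le (zetaRegular s') (zetaRegular s)
      linarith

/-- Minus the logarithmic derivative of `ζ`, minus `ζ`, extended analytically to `s = 1`. -/
noncomputable def zetaDefect (s : ℂ) : ℂ :=
  -(deriv zetaRegular s / zetaRegular s) - dslope zetaRegular 1 s

noncomputable def mangoldtKernel (s : ℂ) : ℂ := zetaDefect s / (s * (s + 1))

lemma isOpen_re_pos : IsOpen {s : ℂ | 0 < s.re} := isOpen_lt continuous_const Complex.continuous_re

lemma differentiableOn_zetaRegular : DifferentiableOn ℂ zetaRegular {s | 0 < s.re} := fun _ hs =>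
  (differentiableAt_zetaRegular hs).differentiableWithinAt

lemma differentiableAt_zetaDefect {s : ℂ} (hs : 0 < s.re) (h0 : zetaRegular s ≠ 0) :
    DifferentiableAt ℂ zetaDefect s := by
  have hn := isOpen_re_pos.mem_nhds hs
  have h1 := (differentiableOn_zetaRegular.deriv isOpen_re_pos).differentiableAt hn
  have h2 := ((Complex.differentiableOn_dslope (isOpen_re_pos.mem_nhds (by simp : (0:ℝ) < (1:ℂ).re))).2
    differentiableOn_zetaRegular).differentiableAt hn
  exact ((h1.div (differentiableAt_zetaRegular hs) h0).neg).sub h2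

lemma differentiableAt_mangoldtKernel {s : ℂ} (hs : 0 < s.re) (h0 : zetaRegular s ≠ 0) :
    DifferentiableAt ℂ mangoldtKernel s := by
  refine (differentiableAt_zetaDefect hs h0).div (by fun_prop) (mul_ne_zero ?_ ?_)
  · rintro rfl; simp at hs
  · intro h
    have := congrArg Complex.re h
    simp at this
    linarith

lemma analyticAt_mangoldtKernel {s : ℂ} (hs : 1 ≤ s.re) : AnalyticAt ℂ mangoldtKernel s := by
  rw [Complex.analyticAt_iff_eventually_differentiableAt]
  have h1 : ∀ᶠ z in nhds s, 0 < z.re := isOpen_re_pos.mem_nhds (show 0 < s.re by linarith)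
  have h2 : ∀ᶠ z in nhds s, zetaRegular z ≠ 0 :=
    (differentiableAt_zetaRegular (by linarith)).continuousAt.eventually_ne (zetaRegular_ne_zero hs)
  filter_upwards [h1, h2] with z hz1 hz2 using differentiableAt_mangoldtKernel hz1 hz2

lemma norm_dslope_zetaRegular_le : ∃ C : ℝ, 0 < C ∧ ∀ s : ℂ, 199 / 200 ≤ s.re → s.re ≤ 3 →
    ‖dslope zetaRegular 1 s‖ ≤ C * (|s.im| + 2) ^ (1 / 10 : ℝ) := by
  obtain ⟨C, hC0, hC⟩ := norm_zetaRegular_le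
  have hcomp : IsCompact (Set.Icc (199 / 200 : ℝ) 3 ×ℂ Set.Icc (-1:ℝ) 1) :=
    isCompact_Icc.reProdIm isCompact_Icc
  obtain ⟨B, hB⟩ := hcomp.exists_bound_of_continuousOn (f := dslope zetaRegular 1) (by
    refine (((Complex.differentiableOn_dslope
      (isOpen_re_pos.mem_nhds (by simp : (0:ℝ) < (1:ℂ).re))).2
      differentiableOn_zetaRegular).continuousOn).mono fun s hs => ?_
    have := (Complex.mem_reProdIm.1 hs).1.1
    show 0 < s.re
    linarith)
  refine ⟨|B| + 3 * (C + 1), by positivity, fun s hs1 hs3 => ?_⟩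
  set τ : ℝ := |s.im| + 2 with hτ
  have hτ2 : 2 ≤ τ := by simp [hτ]
  have h1 : 1 ≤ τ ^ (1 / 10 : ℝ) := Real.one_le_rpow (by linarith) (by norm_num)
  rcases le_total |s.im| 1 with ht | ht
  · have := hB s (Complex.mem_reProdIm.2 ⟨⟨hs1, hs3⟩, abs_le.1 ht⟩)
    calc _ ≤ B := this
      _ ≤ |B| := le_abs_self B
      _ ≤ (|B| + 3 * (C + 1)) * 1 := by linarith
      _ ≤ _ := by gcongr
  · have hne : s ≠ 1 := by rintro rfl; simp at ht; linarith
    rw [dslope_of_ne _ hne, slope_def_field, zetaRegular_one, norm_div]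
    have hd : τ / 3 ≤ ‖s - 1‖ := by
      refine le_trans ?_ (Complex.abs_im_le_norm _)
      simp; linarith
    rw [div_le_iff₀ (by linarith)]
    have e : τ ^ (51 / 50 : ℝ) ≤ τ ^ (1 / 10 : ℝ) * τ := by
      rw [← Real.rpow_add_one (by linarith)]
      exact Real.rpow_le_rpow_of_exponent_le (by linarith) (by norm_num)
    have h2 : 1 ≤ τ ^ (51 / 50 : ℝ) := Real.one_le_rpow (by linarith) (by norm_num)
    calc ‖zetaRegular s - 1‖ ≤ ‖zetaRegular s‖ + ‖(1:ℂ)‖ := norm_sub_le _ _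
      _ ≤ C * τ ^ (51 / 50 : ℝ) + 1 := by
        rw [norm_one]; gcongr; exact hC s (by linarith) (by linarith)
      _ ≤ (C + 1) * τ ^ (51 / 50 : ℝ) := by linarith
      _ ≤ (C + 1) * (τ ^ (1 / 10 : ℝ) * τ) := by gcongr
      _ = 3 * (C + 1) * τ ^ (1 / 10 : ℝ) * (τ / 3) := by ring
      _ ≤ (|B| + 3 * (C + 1)) * τ ^ (1 / 10 : ℝ) * ‖s - 1‖ := by
        gcongr
        linarith [abs_nonneg B]

lemma two_mul_rpow_le {τ a : ℝ} (hτ : 0 ≤ τ) (ha : a ≤ 2) : (2 * τ) ^ a ≤ 4 * τ ^ a := by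
  rw [Real.mul_rpow (by norm_num) hτ]
  gcongr
  calc (2:ℝ) ^ a ≤ 2 ^ (2:ℝ) := Real.rpow_le_rpow_of_exponent_le (by norm_num) ha
    _ = 4 := by norm_num

/-- Bounds on balls shrinking like a small power of the height. -/
lemma zetaRegular_ball_bounds : ∃ c C : ℝ, 0 < c ∧ c ≤ 1 / 200 ∧ 0 < C ∧ ∀ s : ℂ, 1 ≤ s.re →
    s.re ≤ 2 → ∀ z ∈ Metric.closedBall s (c * (|s.im| + 2) ^ (-(1 / 10) : ℝ)),
      0 < z.re ∧ zetaRegular z ≠ 0 ∧ ‖mangoldtKernel z‖ ≤ C * (|s.im| + 2) ^ (-(19 / 10) : ℝ) := by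
  obtain ⟨a, ha0, ha⟩ := norm_zetaRegular_ge
  obtain ⟨D, hD0, hD⟩ := norm_deriv_zetaRegular_le
  obtain ⟨B, hB0, hB⟩ := norm_dslope_zetaRegular_le
  set c : ℝ := min (1 / 200) (a / (8 * D)) with hc
  have hc0 : 0 < c := by positivity
  have hc1 : c ≤ 1 / 200 := min_le_left _ _
  have hcD : 8 * D * c ≤ a := by
    have : c ≤ a / (8 * D) := min_le_right _ _
    rwa [le_div_iff₀ (by positivity), mul_comm] at this
  refine ⟨c, 64 * (8 * D / a + 4 * B), hc0, hc1, by positivity, fun s hs1 hs2 z hz => ?_⟩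
  set τ : ℝ := |s.im| + 2 with hτ
  have hτ2 : 2 ≤ τ := by simp [hτ]
  have hτ0 : 0 < τ := by linarith
  have hr : c * τ ^ (-(1 / 10) : ℝ) ≤ 1 / 200 := by
    have h1 : τ ^ (-(1 / 10) : ℝ) ≤ 1 :=
      Real.rpow_le_one_of_one_le_of_nonpos (by linarith) (by norm_num)
    nlinarith [Real.rpow_nonneg hτ0.le (-(1 / 10) : ℝ)]
  have hball : ∀ w ∈ Metric.closedBall s (c * τ ^ (-(1 / 10) : ℝ)), 199 / 200 ≤ w.re ∧ w.re ≤ 3 ∧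
      |w.im| + 2 ≤ 2 * τ ∧ τ / 2 ≤ |w.im| + 2 := fun w hw => by
    have hw' : ‖w - s‖ ≤ 1 / 200 := (by simpa [dist_eq_norm] using hw : ‖w - s‖ ≤ _).trans hr
    have h1 := (Complex.abs_re_le_norm (w - s)).trans hw'
    have h2 := (Complex.abs_im_le_norm (w - s)).trans hw'
    rw [Complex.sub_re, abs_le] at h1
    rw [Complex.sub_im] at h2
    have h3 := abs_sub_abs_le_abs_sub w.im s.im
    have h5 := abs_sub_abs_le_abs_sub s.im w.im
    rw [abs_sub_comm] at h5
    have h4 := abs_nonneg s.im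
    exact ⟨by linarith, by linarith, by linarith, by linarith⟩
  obtain ⟨hz1, hz3, hzτ, hzτ'⟩ := hball z hz
  have hDz : ∀ w ∈ Metric.closedBall s (c * τ ^ (-(1 / 10) : ℝ)),
      ‖deriv zetaRegular w‖ ≤ 4 * D * τ ^ (51 / 50 : ℝ) := fun w hw => by
    obtain ⟨h1, h3, h4, -⟩ := hball w hw
    calc _ ≤ D * (|w.im| + 2) ^ (51 / 50 : ℝ) := hD w h1 h3
      _ ≤ D * (2 * τ) ^ (51 / 50 : ℝ) := by gcongr
      _ ≤ D * (4 * τ ^ (51 / 50 : ℝ)) := by gcongr; exact two_mul_rpow_le hτ0.le (by norm_num)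
      _ = _ := by ring
  have hlow : a / 2 * τ ^ (23 / 25 : ℝ) ≤ ‖zetaRegular z‖ := by
    have hmv := (convex_closedBall s (c * τ ^ (-(1 / 10) : ℝ))).norm_image_sub_le_of_norm_deriv_le
      (𝕜 := ℂ) (f := zetaRegular) (x := z) (y := s)
      (fun w hw => differentiableAt_zetaRegular (by linarith [(hball w hw).1])) hDz hz
      (Metric.mem_closedBall_self (by positivity))
    have hd : ‖s - z‖ ≤ c * τ ^ (-(1 / 10) : ℝ) := by
      simpa [dist_eq_norm, norm_sub_rev] using hz
    have h1 : ‖zetaRegular s - zetaRegular z‖ ≤ a / 2 * τ ^ (23 / 25 : ℝ) := by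
      refine hmv.trans ?_
      calc 4 * D * τ ^ (51 / 50 : ℝ) * ‖s - z‖
          ≤ 4 * D * τ ^ (51 / 50 : ℝ) * (c * τ ^ (-(1 / 10) : ℝ)) := by gcongr
        _ = 4 * D * c * (τ ^ (51 / 50 : ℝ) * τ ^ (-(1 / 10) : ℝ)) := by ring
        _ = 4 * D * c * τ ^ (23 / 25 : ℝ) := by rw [← Real.rpow_add hτ0]; norm_num
        _ ≤ _ := by gcongr; linarith
    have h2 := norm_sub_norm_le (zetaRegular s) (zetaRegular z)
    have h3 := ha s hs1 hs2
    have h4 : a * τ ^ (23 / 25 : ℝ) = a / 2 * τ ^ (23 / 25 : ℝ) + a / 2 * τ ^ (23 / 25 : ℝ) := by ring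
    linarith
  have hpos : 0 < ‖zetaRegular z‖ := lt_of_lt_of_le (by positivity) hlow
  refine ⟨by linarith, norm_pos_iff.1 hpos, ?_⟩
  have hG : ‖zetaDefect z‖ ≤ (8 * D / a + 4 * B) * τ ^ (1 / 10 : ℝ) := by
    refine (norm_sub_le _ _).trans ?_
    rw [norm_neg, norm_div, add_mul]
    refine add_le_add ?_ ?_
    · rw [div_le_iff₀ hpos]
      calc _ ≤ 4 * D * τ ^ (51 / 50 : ℝ) := hDz z hz
        _ = 4 * D * (τ ^ (1 / 10 : ℝ) * τ ^ (23 / 25 : ℝ)) := by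
          rw [← Real.rpow_add hτ0]; norm_num
        _ = 8 * D / a * τ ^ (1 / 10 : ℝ) * (a / 2 * τ ^ (23 / 25 : ℝ)) := by
          field_simp; ring
        _ ≤ _ := by gcongr
    · calc _ ≤ B * (|z.im| + 2) ^ (1 / 10 : ℝ) := hB z hz1 hz3
        _ ≤ B * (2 * τ) ^ (1 / 10 : ℝ) := by gcongr
        _ ≤ B * (4 * τ ^ (1 / 10 : ℝ)) := by gcongr; exact two_mul_rpow_le hτ0.le (by norm_num)
        _ = _ := by ring
  have hn1 : τ / 8 ≤ ‖z‖ := by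
    have h1 := Complex.abs_im_le_norm z
    have h2 := (le_abs_self z.re).trans (Complex.abs_re_le_norm z)
    linarith
  have hn2 : τ / 8 ≤ ‖z + 1‖ := by
    have h1 := Complex.abs_im_le_norm (z + 1)
    have h2 := (le_abs_self (z + 1).re).trans (Complex.abs_re_le_norm (z + 1))
    simp at h1 h2
    linarith
  rw [mangoldtKernel, norm_div, norm_mul, div_le_iff₀ (mul_pos (by linarith) (by linarith))]
  calc _ ≤ (8 * D / a + 4 * B) * τ ^ (1 / 10 : ℝ) := hG
    _ = (8 * D / a + 4 * B) * (τ ^ (-(19 / 10) : ℝ) * τ ^ (2:ℝ)) := by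
      rw [← Real.rpow_add hτ0]; norm_num
    _ = 64 * (8 * D / a + 4 * B) * τ ^ (-(19 / 10) : ℝ) * (τ / 8 * (τ / 8)) := by
      rw [Real.rpow_two]; ring
    _ ≤ _ := by gcongr

lemma norm_iteratedDeriv_mangoldtKernel_le : ∃ C : ℝ, 0 < C ∧ ∀ s : ℂ, 1 ≤ s.re → s.re ≤ 2 →
    ∀ n ≤ 2, ‖iteratedDeriv n mangoldtKernel s‖ ≤ C * (|s.im| + 2) ^ (-(3 / 2) : ℝ) := by
  obtain ⟨c, C, hc0, hc1, hC0, h⟩ := zetaRegular_ball_bounds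
  refine ⟨2 * C / c ^ 2, by positivity, fun s hs1 hs2 n hn => ?_⟩
  set τ : ℝ := |s.im| + 2 with hτ
  have hτ2 : 2 ≤ τ := by simp [hτ]
  have hτ0 : 0 < τ := by linarith
  have hr0 : 0 < c * τ ^ (-(1 / 10) : ℝ) := by positivity
  have hr1 : c * τ ^ (-(1 / 10) : ℝ) ≤ 1 := by
    have h1 : τ ^ (-(1 / 10) : ℝ) ≤ 1 :=
      Real.rpow_le_one_of_one_le_of_nonpos (by linarith) (by norm_num)
    nlinarith [Real.rpow_nonneg hτ0.le (-(1 / 10) : ℝ)]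
  have hd : DiffContOnCl ℂ mangoldtKernel (Metric.ball s (c * τ ^ (-(1 / 10) : ℝ))) := by
    apply DifferentiableOn.diffContOnCl
    intro z hz
    rw [closure_ball _ hr0.ne'] at hz
    obtain ⟨h1, h2, -⟩ := h s hs1 hs2 z hz
    exact (differentiableAt_mangoldtKernel h1 h2).differentiableWithinAt
  have hcau := Complex.norm_iteratedDeriv_le_of_forall_mem_sphere_norm_le n hr0 hd fun z hz =>
    (h s hs1 hs2 z (Metric.sphere_subset_closedBall hz)).2.2
  refine hcau.trans ?_
  have hfac : (n.factorial : ℝ) ≤ 2 := by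
    exact_mod_cast (Nat.factorial_le hn)
  have hpow : (c * τ ^ (-(1 / 10) : ℝ)) ^ 2 ≤ (c * τ ^ (-(1 / 10) : ℝ)) ^ n :=
    pow_le_pow_of_le_one hr0.le hr1 hn
  rw [div_le_iff₀ (by positivity)]
  calc (n.factorial : ℝ) * (C * τ ^ (-(19 / 10) : ℝ)) ≤ 2 * (C * τ ^ (-(19 / 10) : ℝ)) := by gcongr
    _ ≤ 2 * (C * τ ^ (-(17 / 10) : ℝ)) := by
      gcongr
      · linarith
      · norm_num
    _ = 2 * C / c ^ 2 * τ ^ (-(3 / 2) : ℝ) * (c * τ ^ (-(1 / 10) : ℝ)) ^ 2 := by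
      have : τ ^ (-(17 / 10) : ℝ) = τ ^ (-(3 / 2) : ℝ) * (τ ^ (-(1 / 10) : ℝ)) ^ 2 := by
        rw [← Real.rpow_natCast, ← Real.rpow_mul hτ0.le, ← Real.rpow_add hτ0]
        norm_num
      rw [this]
      field_simp
    _ ≤ _ := by gcongr

lemma hasMellin_hat {s : ℂ} (hs : 0 < s.re) :
    HasMellin (fun u : ℝ => ((max 0 (1 - u) : ℝ) : ℂ)) s (1 / (s * (s + 1))) := by
  have h1 := hasMellin_one_Ioc hs
  have h2 := hasMellin_cpow_Ioc 1 (s := s) (by simp; linarith)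
  have h3 := hasMellin_sub h1.1 h2.1
  have hs0 : s ≠ 0 := by rintro rfl; simp at hs
  have hs1 : s + 1 ≠ 0 := by
    intro h
    have := congrArg Complex.re h
    simp at this
    linarith
  have hc : Set.EqOn (fun u : ℝ => (Set.Ioc (0:ℝ) 1).indicator (fun _ => (1:ℂ)) u -
      (Set.Ioc (0:ℝ) 1).indicator (fun t : ℝ => (t : ℂ) ^ (1:ℂ)) u)
      (fun u : ℝ => ((max 0 (1 - u) : ℝ) : ℂ)) (Set.Ioi 0) := fun u hu => by
    have hu0 : 0 < u := hu
    rcases le_or_gt u 1 with h | h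
    · simp [Set.indicator, hu0, h]
    · simp [Set.indicator, not_le.2 h, h.le]
  refine ⟨?_, ?_⟩
  · refine IntegrableOn.congr_fun h3.1 (fun u hu => ?_) measurableSet_Ioi
    simp only [smul_eq_mul]
    congr 1
    exact hc hu
  · have : mellin (fun u : ℝ => ((max 0 (1 - u) : ℝ) : ℂ)) s =
        mellin (fun u : ℝ => (Set.Ioc (0:ℝ) 1).indicator (fun _ => (1:ℂ)) u -
          (Set.Ioc (0:ℝ) 1).indicator (fun t : ℝ => (t : ℂ) ^ (1:ℂ)) u) s := by
      refine setIntegral_congr_fun measurableSet_Ioi fun u hu => ?_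
      simp only [smul_eq_mul]
      congr 1
      exact (hc hu).symm
    rw [this, h3.2, h1.2, h2.2]
    field_simp
    ring

lemma integrable_abs_add_two_rpow :
    Integrable fun t : ℝ => (|t| + 2) ^ (-(3 / 2) : ℝ) := by
  have h := integrable_one_add_norm (E := ℝ) (μ := volume) (r := 3 / 2) (by simp; norm_num)
  refine h.mono' ?_ (Filter.Eventually.of_forall fun t => ?_)
  · exact (Measurable.pow_const (by fun_prop) _).aestronglyMeasurable
  · rw [Real.norm_of_nonneg (by positivity), Real.norm_eq_abs]
    exact Real.rpow_le_rpow_of_nonpos (by positivity) (by linarith) (by norm_num)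

lemma verticalIntegrable_hat {σ : ℝ} (hσ : 1 < σ) :
    Integrable fun t : ℝ => 1 / ((σ + t * I : ℂ) * ((σ + t * I : ℂ) + 1)) := by
  have hre : ∀ t : ℝ, (σ + t * I : ℂ).re = σ := fun t => by simp
  have him : ∀ t : ℝ, (σ + t * I : ℂ).im = t := fun t => by simp
  have hne : ∀ t : ℝ, (σ + t * I : ℂ) * ((σ + t * I : ℂ) + 1) ≠ 0 := fun t => by
    refine mul_ne_zero (fun h => ?_) (fun h => ?_)
    · have := congrArg Complex.re h
      simp at this
      linarith
    · have := congrArg Complex.re h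
      simp at this
      linarith
  refine (integrable_abs_add_two_rpow.const_mul 9).mono' ?_ (Filter.Eventually.of_forall fun t => ?_)
  · refine Continuous.aestronglyMeasurable ?_
    exact continuous_const.div (by fun_prop) hne
  · set τ : ℝ := |t| + 2
    have hτ : 2 ≤ τ := by simp [τ]
    have hn1 : τ / 3 ≤ ‖(σ + t * I : ℂ)‖ := by
      have h1 := Complex.abs_im_le_norm (σ + t * I : ℂ)
      have h2 := (le_abs_self _).trans (Complex.abs_re_le_norm (σ + t * I : ℂ))
      rw [hre] at h2
      rw [him] at h1
      simp only [τ]; linarith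
    have hn2 : τ / 3 ≤ ‖(σ + t * I : ℂ) + 1‖ := by
      have h1 := Complex.abs_im_le_norm ((σ + t * I : ℂ) + 1)
      have h2 := (le_abs_self _).trans (Complex.abs_re_le_norm ((σ + t * I : ℂ) + 1))
      rw [Complex.add_re, hre] at h2
      rw [Complex.add_im, him] at h1
      simp at h1 h2
      simp only [τ]; linarith
    rw [norm_div, norm_mul, norm_one, div_le_iff₀ (mul_pos (by linarith) (by linarith))]
    calc (1:ℝ) ≤ 9 * τ ^ (-(3 / 2) : ℝ) * (τ / 3 * (τ / 3)) := by
          have : 9 * τ ^ (-(3 / 2) : ℝ) * (τ / 3 * (τ / 3)) = τ ^ (-(3 / 2) : ℝ) * τ ^ (2:ℝ) := by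
            rw [Real.rpow_two]; ring
          rw [this, ← Real.rpow_add (by linarith)]
          exact Real.one_le_rpow (by linarith) (by norm_num)
      _ ≤ _ := by gcongr

/-- The coefficients `Λ(n) - 1`. -/
noncomputable def mangoldtDefect (n : ℕ) : ℂ := (ArithmeticFunction.vonMangoldt n : ℂ) - 1

lemma LSeriesSummable_mangoldtDefect {s : ℂ} (hs : 1 < s.re) :
    LSeriesSummable mangoldtDefect s :=
  (ArithmeticFunction.LSeriesSummable_vonMangoldt hs).sub (LSeriesSummable_one_iff.2 hs)

lemma LSeries_mangoldtDefect {s : ℂ} (hs : 1 < s.re) :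
    LSeries mangoldtDefect s = zetaDefect s := by
  have h1 := LSeries_sub (ArithmeticFunction.LSeriesSummable_vonMangoldt hs)
    (LSeriesSummable_one_iff.2 hs)
  have h2 : LSeries mangoldtDefect s = -deriv riemannZeta s / riemannZeta s - riemannZeta s := by
    rw [← ArithmeticFunction.LSeries_vonMangoldt_eq_deriv_riemannZeta_div hs,
      ← LSeries_one_eq_riemannZeta hs, ← h1]
    rfl
  have hs1 : s ≠ 1 := by rintro rfl; simp at hs
  have hne : s - 1 ≠ 0 := sub_ne_zero.2 hs1
  have hz : riemannZeta s ≠ 0 := riemannZeta_ne_zero_of_one_le_re hs.le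
  have hev : zetaRegular =ᶠ[nhds s] fun w => (w - 1) * riemannZeta w := by
    filter_upwards [(isOpen_lt continuous_const Complex.continuous_re).mem_nhds hs] with w hw
    exact zetaRegular_eq_of_one_lt_re hw
  have hd : deriv zetaRegular s = riemannZeta s + (s - 1) * deriv riemannZeta s := by
    rw [hev.deriv_eq]
    have h : HasDerivAt (fun w => (w - 1) * riemannZeta w)
        (1 * riemannZeta s + (s - 1) * deriv riemannZeta s) s :=
      ((hasDerivAt_id s).sub_const 1).mul (differentiableAt_riemannZeta hs1).hasDerivAt
    rw [h.deriv, one_mul]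
  rw [h2, zetaDefect, hd, dslope_of_ne _ hs1, slope_def_field, zetaRegular_one,
    zetaRegular_eq_of_one_lt_re hs]
  field_simp
  ring

lemma hasSum_mangoldtDefect_hat {σ x : ℝ} (hσ : 1 < σ) (hx : 0 < x) :
    HasSum (fun n : ℕ => if n = 0 then 0 else mangoldtDefect n * ((max 0 (1 - n / x) : ℝ) : ℂ))
      ((1 / (2 * π) : ℝ) • ∫ t : ℝ, (x : ℂ) ^ (σ + t * I : ℂ) * mangoldtKernel (σ + t * I)) := by
  have hre : ∀ t : ℝ, 1 < (σ + t * I : ℂ).re := fun t => by simpa using hσ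
  set k : ℝ → ℂ := fun t => 1 / ((σ + t * I : ℂ) * ((σ + t * I : ℂ) + 1)) with hk
  have hkint : Integrable k := verticalIntegrable_hat hσ
  have hx0 : (x : ℂ) ≠ 0 := by exact_mod_cast hx.ne'
  set Fn : ℕ → ℝ → ℂ := fun n t => (x : ℂ) ^ (σ + t * I : ℂ) *
    LSeries.term mangoldtDefect (σ + t * I) n * k t with hFn
  have hterm : ∀ n : ℕ, n ≠ 0 → ∀ t : ℝ, Fn n t =
      mangoldtDefect n * (((n / x : ℝ) : ℂ) ^ (-(σ + t * I : ℂ)) * k t) := fun n hn t => by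
    have hn0 : (0:ℝ) < n := by positivity
    simp only [hFn]
    rw [LSeries.term_of_ne_zero hn, Complex.cpow_neg, Complex.ofReal_div,
      Complex.div_cpow_ofReal_nonneg hn0.le hx.le]
    rw [Complex.ofReal_natCast, inv_div]
    ring
  have hmeas : ∀ n : ℕ, n ≠ 0 → Continuous fun t : ℝ =>
      ((n / x : ℝ) : ℂ) ^ (-(σ + t * I : ℂ)) := fun n hn => by
    have : ((n / x : ℝ) : ℂ) ≠ 0 := by
      have : (n / x : ℝ) ≠ 0 := by positivity
      exact_mod_cast this
    exact Continuous.const_cpow (by fun_prop) (Or.inl this)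
  have hnorm : ∀ n : ℕ, n ≠ 0 → ∀ t : ℝ, ‖((n / x : ℝ) : ℂ) ^ (-(σ + t * I : ℂ))‖ =
      (n / x : ℝ) ^ (-σ) := fun n hn t => by
    have hn0 : (0:ℝ) < n := by positivity
    rw [Complex.norm_cpow_eq_rpow_re_of_pos (by positivity)]
    simp
  have hintegrable : ∀ n, Integrable (Fn n) := fun n => by
    rcases eq_or_ne n 0 with rfl | hn
    · simp [hFn]
    · have : Fn n = fun t : ℝ => mangoldtDefect n * (((n / x : ℝ) : ℂ) ^ (-(σ + t * I : ℂ)) * k t) :=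
        funext (hterm n hn)
      rw [this]
      refine Integrable.const_mul ?_ _
      exact hkint.bdd_mul (c := (n / x : ℝ) ^ (-σ)) (hmeas n hn).aestronglyMeasurable
        (Filter.Eventually.of_forall fun t => (hnorm n hn t).le)
  have hnF : ∀ n t, ‖Fn n t‖ = x ^ σ * ‖LSeries.term mangoldtDefect σ n‖ * ‖k t‖ := fun n t => by
    simp only [hFn]
    rw [norm_mul, norm_mul, Complex.norm_cpow_eq_rpow_re_of_pos hx, LSeries.norm_term_eq,
      LSeries.norm_term_eq]
    simp
  have hsum : Summable fun n => ∫ t, ‖Fn n t‖ := by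
    have : (fun n => ∫ t, ‖Fn n t‖) =
        fun n => ‖LSeries.term mangoldtDefect σ n‖ * (x ^ σ * ∫ t, ‖k t‖) := by
      funext n
      simp_rw [hnF, integral_const_mul]
      ring
    rw [this]
    exact (LSeriesSummable_mangoldtDefect (s := σ) (by simpa using hσ)).norm.mul_right _
  have hmain := (hasSum_integral_of_summable_integral_norm hintegrable hsum).const_smul (1 / (2 * π) : ℝ)
  have hR : ∀ t : ℝ, ∑' n, Fn n t = (x : ℂ) ^ (σ + t * I : ℂ) * mangoldtKernel (σ + t * I) :=
    fun t => by
      simp only [hFn]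
      rw [tsum_mul_right, tsum_mul_left]
      change (x : ℂ) ^ (σ + t * I : ℂ) * LSeries mangoldtDefect (σ + t * I) * k t = _
      rw [LSeries_mangoldtDefect (hre t), mangoldtKernel, hk]
      ring
  simp_rw [hR] at hmain
  suffices hL : (fun n : ℕ => if n = 0 then 0 else
      mangoldtDefect n * ((max 0 (1 - n / x) : ℝ) : ℂ)) =
      fun n => (1 / (2 * π) : ℝ) • ∫ t, Fn n t by
    rw [hL]
    exact hmain
  funext n
  rcases eq_or_ne n 0 with rfl | hn
  · simp [hFn]
  · have hinv := mellinInv_mellin_eq σ (fun u : ℝ => ((max 0 (1 - u) : ℝ) : ℂ)) (x := n / x)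
      (by positivity) (hasMellin_hat (by simp; linarith)).1 (by
        refine hkint.congr (Filter.Eventually.of_forall fun t => ?_)
        exact (hasMellin_hat (by linarith [hre t])).2.symm) (by
        refine Continuous.continuousAt ?_
        fun_prop)
    rw [if_neg hn, ← hinv, mellinInv]
    simp_rw [hterm n hn, integral_const_mul]
    rw [mul_smul_comm]
    congr 2
    refine integral_congr_ae (Filter.Eventually.of_forall fun t => ?_)
    simp only [smul_eq_mul]
    congr 1
    exact (hasMellin_hat (by linarith [hre t])).2

lemma norm_integral_exp_mul_le {g g' : ℝ → ℂ} {L : ℝ} (hL : 0 < L)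
    (hd : ∀ t, HasDerivAt g (g' t) t) (hg : Integrable g) (hg' : Integrable g') :
    ‖∫ t : ℝ, Complex.exp (I * L * t) * g t‖ ≤
      ‖∫ t : ℝ, Complex.exp (I * L * t) * g' t‖ / L := by
  have hIL : I * (L : ℂ) ≠ 0 := mul_ne_zero I_ne_zero (by exact_mod_cast hL.ne')
  set v : ℝ → ℂ := fun t => Complex.exp (I * L * t) / (I * L) with hv
  have hvd : ∀ t : ℝ, HasDerivAt v (Complex.exp (I * L * t)) t := fun t => by
    have h1 : HasDerivAt (fun w : ℂ => Complex.exp (I * L * w)) (Complex.exp (I * L * t) * (I * L)) t := by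
      have := ((hasDerivAt_id (t : ℂ)).const_mul (I * L)).cexp
      simpa using this
    have := (h1.comp_ofReal).div_const (I * L)
    rwa [mul_div_assoc, div_self hIL, mul_one] at this
  have hexp : ∀ t : ℝ, ‖Complex.exp (I * L * t)‖ = 1 := fun t => by
    rw [show I * L * t = ((L * t : ℝ) : ℂ) * I by push_cast; ring]
    exact Complex.norm_exp_ofReal_mul_I _
  have hce : Continuous fun t : ℝ => Complex.exp (I * L * t) := by fun_prop
  have hvn : ∀ t, ‖v t‖ ≤ 1 / L := fun t => by
    simp only [hv]
    rw [norm_div, hexp, norm_mul, Complex.norm_I, one_mul, Complex.norm_real, Real.norm_of_nonneg hL.le]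
  have hcv : Continuous v := hce.div_const _
  have key := integral_mul_deriv_eq_deriv_mul_of_integrable (u := g) (v := v) (u' := g')
    (v' := fun t => Complex.exp (I * L * t)) (fun t _ => hd t) (fun t _ => hvd t)
    (hg.mul_bdd (c := 1) hce.aestronglyMeasurable (Filter.Eventually.of_forall fun t => (hexp t).le))
    (hg'.mul_bdd (c := 1 / L) hcv.aestronglyMeasurable (Filter.Eventually.of_forall hvn))
    (hg.mul_bdd (c := 1 / L) hcv.aestronglyMeasurable (Filter.Eventually.of_forall hvn))
  have e1 : ∫ t : ℝ, Complex.exp (I * L * t) * g t = ∫ t, g t * Complex.exp (I * L * t) := by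
    simp_rw [mul_comm]
  have e2 : ∫ t, g' t * v t = (∫ t : ℝ, Complex.exp (I * L * t) * g' t) / (I * L) := by
    rw [← integral_div]
    refine integral_congr_ae (Filter.Eventually.of_forall fun t => ?_)
    simp only [hv]
    ring
  rw [e1, key, norm_neg, e2, norm_div, norm_mul, Complex.norm_I, one_mul, Complex.norm_real,
    Real.norm_of_nonneg hL.le]

lemma norm_integral_mangoldtKernel_le : ∃ C : ℝ, 0 < C ∧ ∀ x : ℝ, Real.exp 1 ≤ x →
    ‖∫ t : ℝ, (x : ℂ) ^ (((1 + 1 / Real.log x : ℝ) : ℂ) + t * I : ℂ) *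
      mangoldtKernel (((1 + 1 / Real.log x : ℝ) : ℂ) + t * I)‖ ≤ C * x / Real.log x ^ 2 := by
  obtain ⟨C, hC0, hC⟩ := norm_iteratedDeriv_mangoldtKernel_le
  set J : ℝ := ∫ t : ℝ, (|t| + 2) ^ (-(3 / 2) : ℝ) with hJ
  have hJ0 : 0 ≤ J := integral_nonneg fun t => by positivity
  refine ⟨Real.exp 1 * (C * (J + 1)), by positivity, fun x hx => ?_⟩
  have hx0 : 0 < x := (Real.exp_pos 1).trans_le hx
  set L := Real.log x with hL
  have hL1 : 1 ≤ L := by rwa [hL, Real.le_log_iff_exp_le hx0]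
  have hL0 : 0 < L := by linarith
  set σ : ℝ := 1 + 1 / L with hσ
  have hσ1 : 1 ≤ σ := by rw [hσ]; linarith [one_div_pos.2 hL0]
  have hσ2 : σ ≤ 2 := by
    have : 1 / L ≤ 1 := by rw [div_le_one hL0]; exact hL1
    linarith
  have hre : ∀ t : ℝ, ((σ : ℂ) + t * I).re = σ := fun t => by simp
  have him : ∀ t : ℝ, ((σ : ℂ) + t * I).im = t := fun t => by simp
  have han : ∀ t : ℝ, AnalyticAt ℂ mangoldtKernel (σ + t * I) := fun t =>
    analyticAt_mangoldtKernel (by rw [hre]; exact hσ1)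
  have hline : ∀ t : ℝ, HasDerivAt (fun w : ℂ => (σ : ℂ) + w * I) I t := fun t => by
    simpa using ((hasDerivAt_id (t : ℂ)).mul_const I).const_add (σ : ℂ)
  have hderiv : ∀ n, ∀ t : ℝ, HasDerivAt (fun t : ℝ => I ^ n * iteratedDeriv n mangoldtKernel (σ + t * I))
      (I ^ (n + 1) * iteratedDeriv (n + 1) mangoldtKernel (σ + t * I)) t := fun n t => by
    have h1 : DifferentiableAt ℂ (iteratedDeriv n mangoldtKernel) (σ + t * I) :=
      by
        rw [iteratedDeriv_eq_iterate]
        exact ((han t).iterated_deriv n).differentiableAt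
    have h2 := ((h1.hasDerivAt.comp (t : ℂ) (hline t)).const_mul (I ^ n)).comp_ofReal
    rw [iteratedDeriv_succ]
    convert! h2 using 1
    ring
  have hbound : ∀ n ≤ 2, ∀ t : ℝ, ‖I ^ n * iteratedDeriv n mangoldtKernel (σ + t * I)‖ ≤
      C * (|t| + 2) ^ (-(3 / 2) : ℝ) := fun n hn t => by
    have := hC (σ + t * I) (by rw [hre]; exact hσ1) (by rw [hre]; exact hσ2) n hn
    rw [him] at this
    simpa [norm_mul] using this
  have hintegrable : ∀ n ≤ 2, Integrable fun t : ℝ => I ^ n * iteratedDeriv n mangoldtKernel (σ + t * I) :=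
    fun n hn => by
      refine (integrable_abs_add_two_rpow.const_mul C).mono' ?_
        (Filter.Eventually.of_forall (hbound n hn))
      exact (continuous_iff_continuousAt.2 fun t => (hderiv n t).continuousAt).aestronglyMeasurable
  have h0 := norm_integral_exp_mul_le hL0 (hderiv 0) (hintegrable 0 (by norm_num)) (hintegrable 1 (by norm_num))
  have h1 := norm_integral_exp_mul_le hL0 (hderiv 1) (hintegrable 1 (by norm_num)) (hintegrable 2 (by norm_num))
  have h2 : ‖∫ t : ℝ, Complex.exp (I * L * t) *
      (I ^ 2 * iteratedDeriv 2 mangoldtKernel (σ + t * I))‖ ≤ C * J := by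
    rw [hJ, ← integral_const_mul]
    refine norm_integral_le_of_norm_le (integrable_abs_add_two_rpow.const_mul C)
      (Filter.Eventually.of_forall fun t => ?_)
    have := hbound 2 le_rfl t
    rw [norm_mul, show I * L * t = ((L * t : ℝ) : ℂ) * I by push_cast; ring,
      Complex.norm_exp_ofReal_mul_I, one_mul]
    exact this
  have hxs : ∀ t : ℝ, (x : ℂ) ^ ((σ : ℂ) + t * I) * mangoldtKernel (σ + t * I) =
      ((Real.exp 1 * x : ℝ) : ℂ) * (Complex.exp (I * L * t) *
        (I ^ 0 * iteratedDeriv 0 mangoldtKernel (σ + t * I))) := fun t => by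
    rw [Complex.cpow_def_of_ne_zero (by exact_mod_cast hx0.ne'), ← Complex.ofReal_log hx0.le, ← hL]
    have e : (L : ℂ) * ((σ : ℂ) + t * I) = ((1 + L : ℝ) : ℂ) + I * L * t := by
      have : (L : ℂ) * σ = ((1 + L : ℝ) : ℂ) := by
        rw [← Complex.ofReal_mul]
        congr 1
        rw [hσ]; field_simp
        ring
      rw [mul_add, this]; ring
    rw [e, Complex.exp_add, ← Complex.ofReal_exp, Real.exp_add, hL, Real.exp_log hx0]
    simp only [pow_zero, one_mul, iteratedDeriv_zero]
    ring
  simp_rw [hxs]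
  rw [integral_const_mul, norm_mul, Complex.norm_real, Real.norm_of_nonneg (by positivity)]
  have h3 : ‖∫ t : ℝ, Complex.exp (I * L * t) *
      (I ^ 0 * iteratedDeriv 0 mangoldtKernel (σ + t * I))‖ ≤ C * J / L / L := by
    refine h0.trans ?_
    gcongr
    refine h1.trans ?_
    gcongr
  calc Real.exp 1 * x * _ ≤ Real.exp 1 * x * (C * J / L / L) := by gcongr
    _ = Real.exp 1 * (C * J) * x / L ^ 2 := by field_simp
    _ ≤ _ := by gcongr; linarith

/-- The integrated Chebyshev function `∑_{n ≤ x} Λ(n) (x - n)`. -/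
noncomputable def psiOne (x : ℝ) : ℝ :=
  ∑ n ∈ Finset.Ioc 0 ⌊x⌋₊, ArithmeticFunction.vonMangoldt n * (x - n)

lemma sum_Ioc_sub (N : ℕ) (x : ℝ) :
    ∑ n ∈ Finset.Ioc 0 N, (x - n) = N * x - N * (N + 1) / 2 := by
  induction N with
  | zero => simp
  | succ N ih =>
    rw [← Finset.insert_Ioc_right_eq_Ioc_add_one (Nat.zero_le N), Finset.sum_insert (by simp), ih]
    push_cast
    ring

lemma psiOne_bound : ∃ C : ℝ, 0 < C ∧ ∀ x : ℝ, Real.exp 1 ≤ x →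
    |psiOne x - x ^ 2 / 2| ≤ C * x ^ 2 / Real.log x ^ 2 := by
  obtain ⟨C, hC0, hC⟩ := norm_integral_mangoldtKernel_le
  refine ⟨C + 4, by positivity, fun x hx => ?_⟩
  have hx0 : 0 < x := (Real.exp_pos 1).trans_le hx
  set L := Real.log x with hL
  have hL1 : 1 ≤ L := by rwa [hL, Real.le_log_iff_exp_le hx0]
  have hL0 : 0 < L := by linarith
  have hsum := hasSum_mangoldtDefect_hat (σ := 1 + 1 / L) (by linarith [one_div_pos.2 hL0]) hx0
  have hfin : ∀ n ∉ Finset.Ioc 0 ⌊x⌋₊, (if n = 0 then 0 else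
      mangoldtDefect n * ((max 0 (1 - n / x) : ℝ) : ℂ)) = 0 := fun n hn => by
    rcases eq_or_ne n 0 with rfl | h0
    · simp
    · have : x < n := by
        rw [Finset.mem_Ioc, not_and, not_le] at hn
        exact (Nat.floor_lt hx0.le).1 (hn (Nat.pos_of_ne_zero h0))
      rw [if_neg h0, max_eq_left]
      · simp
      · rw [sub_nonpos, one_le_div hx0]; exact this.le
  have heq := (hasSum_sum_of_ne_finset_zero hfin).unique hsum
  have hreal : (x : ℂ) * ∑ n ∈ Finset.Ioc 0 ⌊x⌋₊, (if n = 0 then 0 else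
      mangoldtDefect n * ((max 0 (1 - n / x) : ℝ) : ℂ)) =
      ((psiOne x - ∑ n ∈ Finset.Ioc 0 ⌊x⌋₊, (x - n) : ℝ) : ℂ) := by
    rw [psiOne, ← Finset.sum_sub_distrib, Finset.mul_sum, Complex.ofReal_sum]
    refine Finset.sum_congr rfl fun n hn => ?_
    obtain ⟨h1, h2⟩ := Finset.mem_Ioc.1 hn
    have hn' : (n : ℝ) ≤ x := (Nat.le_floor_iff hx0.le).1 h2
    rw [if_neg h1.ne', max_eq_right (by rw [sub_nonneg, div_le_one hx0]; exact hn'), mangoldtDefect]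
    have : (x : ℂ) ≠ 0 := by exact_mod_cast hx0.ne'
    push_cast
    field_simp
  have hb : |psiOne x - ∑ n ∈ Finset.Ioc 0 ⌊x⌋₊, (x - n)| ≤ C * x ^ 2 / L ^ 2 := by
    rw [← Real.norm_eq_abs, ← Complex.norm_real, ← hreal, heq, norm_mul, norm_smul,
      Complex.norm_real, Real.norm_of_nonneg hx0.le, Real.norm_of_nonneg (by positivity)]
    have hpi : 1 / (2 * π) ≤ 1 := by
      rw [div_le_one (by positivity)]
      linarith [Real.pi_gt_three]
    calc x * (1 / (2 * π) * _) ≤ x * (1 * (C * x / L ^ 2)) := by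
          gcongr
          exact hC x hx
      _ = _ := by ring
  rw [sum_Ioc_sub] at hb
  have hN1 : (⌊x⌋₊ : ℝ) ≤ x := Nat.floor_le hx0.le
  have hN2 : x < ⌊x⌋₊ + 1 := Nat.lt_floor_add_one x
  set N : ℝ := (⌊x⌋₊ : ℝ)
  have hN : |N * x - N * (N + 1) / 2 - x ^ 2 / 2| ≤ x := by
    have hN0 : 0 ≤ N := Nat.cast_nonneg _
    have e : N * x - N * (N + 1) / 2 - x ^ 2 / 2 = -((x - N) ^ 2 + N) / 2 := by ring
    have h1 : (x - N) ^ 2 ≤ 1 := by nlinarith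
    have h2 : 1 ≤ x := (Real.one_le_exp zero_le_one).trans hx
    rw [e, abs_le]
    constructor <;> nlinarith [sq_nonneg (x - N)]
  have hLx : x ≤ 4 * x ^ 2 / L ^ 2 := by
    have h1 : L ≤ 2 * x ^ (1 / 2 : ℝ) := by
      have := Real.log_le_rpow_div hx0.le (by norm_num : (0:ℝ) < 1 / 2)
      linarith
    have h2 : L ^ 2 ≤ 4 * x := by
      calc L ^ 2 ≤ (2 * x ^ (1 / 2 : ℝ)) ^ 2 := by gcongr
        _ = 4 * (x ^ (1 / 2 : ℝ)) ^ 2 := by ring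
        _ = 4 * x := by
          rw [← Real.rpow_natCast, ← Real.rpow_mul hx0.le]; norm_num
    rw [le_div_iff₀ (by positivity)]
    nlinarith
  calc |psiOne x - x ^ 2 / 2| ≤ |psiOne x - (N * x - N * (N + 1) / 2)| +
        |N * x - N * (N + 1) / 2 - x ^ 2 / 2| := abs_sub_le _ _ _
    _ ≤ C * x ^ 2 / L ^ 2 + 4 * x ^ 2 / L ^ 2 := by linarith
    _ = _ := by ring

lemma psiOne_sub_bounds {x h : ℝ} (hx : 0 ≤ x) (hh : 0 ≤ h) :
    Chebyshev.psi x * h ≤ psiOne (x + h) - psiOne x ∧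
      psiOne (x + h) - psiOne x ≤ Chebyshev.psi (x + h) * h := by
  have hle : ⌊x⌋₊ ≤ ⌊x + h⌋₊ := Nat.floor_le_floor (by linarith)
  have hsplit : ∀ f : ℕ → ℝ, ∑ n ∈ Finset.Ioc 0 ⌊x + h⌋₊, f n =
      ∑ n ∈ Finset.Ioc 0 ⌊x⌋₊, f n + ∑ n ∈ Finset.Ioc ⌊x⌋₊ ⌊x + h⌋₊, f n := fun f =>
    (Finset.sum_Ioc_consecutive f (Nat.zero_le _) hle).symm
  have e : psiOne (x + h) - psiOne x = Chebyshev.psi x * h +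
      ∑ n ∈ Finset.Ioc ⌊x⌋₊ ⌊x + h⌋₊, ArithmeticFunction.vonMangoldt n * (x + h - n) := by
    rw [psiOne, hsplit, psiOne, Chebyshev.psi, Finset.sum_mul, add_sub_right_comm,
      ← Finset.sum_sub_distrib]
    congr 1
    exact Finset.sum_congr rfl fun n _ => by ring
  have hb : ∀ n ∈ Finset.Ioc ⌊x⌋₊ ⌊x + h⌋₊, 0 ≤ x + h - n ∧ x + h - n ≤ h := fun n hn => by
    obtain ⟨h1, h2⟩ := Finset.mem_Ioc.1 hn
    have h3 := (Nat.le_floor_iff (by linarith)).1 h2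
    have h4 := (Nat.floor_lt hx).1 h1
    exact ⟨by linarith, by linarith⟩
  rw [e]
  constructor
  · have : 0 ≤ ∑ n ∈ Finset.Ioc ⌊x⌋₊ ⌊x + h⌋₊, ArithmeticFunction.vonMangoldt n * (x + h - n) :=
      Finset.sum_nonneg fun n hn =>
        mul_nonneg ArithmeticFunction.vonMangoldt_nonneg (hb n hn).1
    linarith
  · rw [Chebyshev.psi, Chebyshev.psi, hsplit, add_mul, Finset.sum_mul (Finset.Ioc ⌊x⌋₊ ⌊x + h⌋₊)]
    gcongr with n hn
    exact (hb n hn).2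

lemma abs_psi_sub_le : ∃ C : ℝ, 0 < C ∧ ∀ x : ℝ, 2 ≤ x →
    |Chebyshev.psi x - x| ≤ C * x / Real.log x := by
  obtain ⟨C, hC0, hC⟩ := psiOne_bound
  refine ⟨5 * C + 1 + 4 * (Real.log 4 + 4), by positivity, fun x hx => ?_⟩
  have hx0 : 0 < x := by linarith
  set L := Real.log x with hL
  have hL0 : 0 < L := Real.log_pos (by linarith)
  have hl4 : 0 ≤ Real.log 4 := Real.log_nonneg (by norm_num)
  rcases lt_or_ge L 4 with h4 | h4
  · have h1 := Chebyshev.psi_le_const_mul_self hx0.le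
    have h2 := Chebyshev.psi_nonneg x
    have h3 : |Chebyshev.psi x - x| ≤ (Real.log 4 + 4) * x := by
      rw [abs_le]
      constructor <;> nlinarith
    rw [le_div_iff₀ hL0]
    calc |Chebyshev.psi x - x| * L ≤ (Real.log 4 + 4) * x * 4 := by gcongr
      _ = 4 * (Real.log 4 + 4) * x := by ring
      _ ≤ _ := by gcongr; linarith
  · have hex : Real.exp 1 ≤ x := by
      rw [← Real.le_log_iff_exp_le hx0]; linarith
    set h := x / L with hh
    have hhL : h * L = x := by rw [hh]; field_simp
    have hh0 : 0 < h := by positivity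
    have hh4 : h ≤ x / 4 := by rw [hh]; gcongr
    have b0 := abs_le.1 (hC x hex)
    have b1 := (psiOne_sub_bounds hx0.le hh0.le).1
    have b2 := (psiOne_sub_bounds (x := x - h) (by linarith) hh0.le).2
    rw [sub_add_cancel] at b2
    have hx2 : C * x ^ 2 / L ^ 2 = C * h ^ 2 := by rw [hh]; field_simp
    have c1 : psiOne (x + h) - (x + h) ^ 2 / 2 ≤ 4 * C * h ^ 2 := by
      refine (le_abs_self _).trans ((hC (x + h) (by linarith)).trans ?_)
      have : L ≤ Real.log (x + h) := Real.log_le_log hx0 (by linarith)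
      calc C * (x + h) ^ 2 / Real.log (x + h) ^ 2 ≤ C * (2 * x) ^ 2 / L ^ 2 := by gcongr; linarith
        _ = 4 * (C * x ^ 2 / L ^ 2) := by ring
        _ = _ := by rw [hx2]; ring
    have c2 : psiOne (x - h) - (x - h) ^ 2 / 2 ≤ 4 * C * h ^ 2 := by
      have hlog : L / 2 ≤ Real.log (x - h) := by
        have h1 : Real.log (x / 2) ≤ Real.log (x - h) := Real.log_le_log (by linarith) (by linarith)
        rw [Real.log_div hx0.ne' (by norm_num), ← hL] at h1
        have := Real.log_two_lt_d9
        linarith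
      have hex2 : Real.exp 1 ≤ x - h := by
        rw [← Real.le_log_iff_exp_le (by linarith)]; linarith
      refine (le_abs_self _).trans ((hC (x - h) hex2).trans ?_)
      calc C * (x - h) ^ 2 / Real.log (x - h) ^ 2 ≤ C * x ^ 2 / (L / 2) ^ 2 := by
            gcongr <;> linarith
        _ = 4 * (C * x ^ 2 / L ^ 2) := by ring
        _ = _ := by rw [hx2]; ring
    rw [hx2] at b0
    have d1 : Chebyshev.psi x * h ≤ (x + (5 * C + 1) * h) * h := by nlinarith [b0.1, b0.2]
    have d2 : (x - (5 * C + 1) * h) * h ≤ Chebyshev.psi x * h := by nlinarith [b0.1, b0.2]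
    have f1 := le_of_mul_le_mul_right d1 hh0
    have f2 := le_of_mul_le_mul_right d2 hh0
    calc |Chebyshev.psi x - x| ≤ (5 * C + 1) * h := by
          rw [abs_le]; constructor <;> linarith
      _ = (5 * C + 1) * x / L := by rw [hh]; ring
      _ ≤ _ := by
        gcongr ?_ * _ / _
        linarith

/-- Comparison of a weighted sum with a decreasing weight, through an upper bound for the
summatory function. -/
lemma sum_mul_antitone_le {c f : ℕ → ℝ} {K : ℝ} {N M : ℕ} (hNM : N < M) (hf : Antitone f)
    (hf0 : ∀ n, 0 ≤ f n)
    (hS : ∀ n, N < n → ∑ k ∈ Finset.Ioc 0 n, c k ≤ K * n) :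
    ∑ n ∈ Finset.Ioc N M, c n * f n ≤ (K * N - ∑ k ∈ Finset.Ioc 0 N, c k) * f (N + 1) +
      K * ∑ n ∈ Finset.Ioc N M, f n := by
  have key : ∀ d : ℕ, ∑ n ∈ Finset.Ioc N (N + d), (c n - K) * f n ≤
      (∑ k ∈ Finset.Ioc 0 (N + d), c k - K * (N + d : ℕ)) * f (N + d + 1) +
      (K * N - ∑ k ∈ Finset.Ioc 0 N, c k) * f (N + 1) := fun d => by
    induction d with
    | zero => simp; linarith
    | succ d ih =>
      have hT := hS (N + (d + 1)) (by omega)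
      have hff : f (N + d + 2) ≤ f (N + d + 1) := hf (by omega)
      have e1 : ∀ g : ℕ → ℝ, ∀ a ≤ N + d, ∑ n ∈ Finset.Ioc a (N + (d + 1)), g n =
          g (N + d + 1) + ∑ n ∈ Finset.Ioc a (N + d), g n := fun g a ha => by
        rw [← add_assoc, ← Finset.insert_Ioc_right_eq_Ioc_add_one ha, Finset.sum_insert (by simp)]
      rw [e1 c 0 (by omega)] at hT ⊢
      rw [e1 _ N (by omega)]
      have e2 : N + (d + 1) + 1 = N + d + 2 := by ring
      rw [e2]
      push_cast at hT ih ⊢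
      nlinarith
  obtain ⟨d, rfl⟩ := Nat.exists_eq_add_of_lt hNM
  have h := key (d + 1)
  have hT := hS (N + (d + 1)) (by omega)
  have e : ∑ n ∈ Finset.Ioc N (N + (d + 1)), (c n - K) * f n =
      ∑ n ∈ Finset.Ioc N (N + (d + 1)), c n * f n - K * ∑ n ∈ Finset.Ioc N (N + (d + 1)), f n := by
    rw [Finset.mul_sum, ← Finset.sum_sub_distrib]
    exact Finset.sum_congr rfl fun n _ => by ring
  rw [e] at h
  have := mul_nonneg (sub_nonneg.2 hT) (hf0 (N + (d + 1) + 1))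
  rw [add_assoc]
  nlinarith

lemma sum_Ioc_inv_sq_le {N : ℕ} (hN : 0 < N) (M : ℕ) :
    ∑ n ∈ Finset.Ioc N M, 1 / (n : ℝ) ^ 2 ≤ 1 / (N : ℝ) := by
  rcases le_total M N with h | h
  · simp [Finset.Ioc_eq_empty_of_le h]
  have : ∀ d : ℕ, ∑ n ∈ Finset.Ioc N (N + d), 1 / (n : ℝ) ^ 2 ≤
      1 / (N : ℝ) - 1 / ((N + d : ℕ) : ℝ) := fun d => by
    induction d with
    | zero => simp
    | succ d ih =>
      rw [← add_assoc, ← Finset.insert_Ioc_right_eq_Ioc_add_one (by omega),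
        Finset.sum_insert (by simp)]
      have h0 : (0:ℝ) < (N + d : ℕ) := by positivity
      have : 1 / ((N + d + 1 : ℕ) : ℝ) ^ 2 ≤
          1 / ((N + d : ℕ) : ℝ) - 1 / ((N + d + 1 : ℕ) : ℝ) := by
        rw [Nat.cast_succ, div_sub_div _ _ h0.ne' (by positivity)]
        rw [div_le_div_iff₀ (by positivity) (by positivity)]
        nlinarith
      linarith
  obtain ⟨d, rfl⟩ := Nat.exists_eq_add_of_le h
  refine (this d).trans ?_
  have : (0:ℝ) ≤ 1 / ((N + d : ℕ) : ℝ) := by positivity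
  linarith

/-- The sum of `1/p²` over primes beyond `y`. -/
lemma sum_prime_inv_sq_le : ∃ C : ℝ, 0 < C ∧ ∀ y : ℝ, 2 ≤ y → ∀ M : ℕ,
    ∑ p ∈ (Finset.Ioc ⌊y⌋₊ M).filter Nat.Prime, 1 / (p : ℝ) ^ 2 ≤
      (1 + C / Real.log y) / (y * Real.log y) := by
  obtain ⟨C, hC0, hC⟩ := abs_psi_sub_le
  refine ⟨3 * C + 2 * (1 + 2 * C), by positivity, fun y hy M => ?_⟩
  set L := Real.log y with hL
  have hL0 : 0 < L := Real.log_pos (by linarith)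
  have hy0 : 0 < y := by linarith
  have hLh : 1 / 2 ≤ L := by
    have h1 : Real.log 2 ≤ L := Real.log_le_log (by norm_num) hy
    have := Real.log_two_gt_d9
    linarith
  have hLy : L ≤ y := by linarith [Real.log_le_sub_one_of_pos hy0]
  set N := ⌊y⌋₊ with hN
  have hN2 : 2 ≤ N := Nat.le_floor (by exact_mod_cast hy)
  have hNy : (N : ℝ) ≤ y := Nat.floor_le hy0.le
  have hyN : y < N + 1 := Nat.lt_floor_add_one y
  rcases le_or_gt M N with h | h
  · rw [Finset.Ioc_eq_empty_of_le h]
    simp only [Finset.filter_empty, Finset.sum_empty]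
    positivity
  set K : ℝ := 1 + C / L with hK
  have hmain := sum_mul_antitone_le (c := fun n => ArithmeticFunction.vonMangoldt n)
    (f := fun n => 1 / (max 1 (n : ℝ)) ^ 2) (K := K) h
    (fun a b hab => by
      simp only
      gcongr)
    (fun n => by positivity) (fun n hn => by
      have hyn : y ≤ n := by
        have : (N : ℝ) + 1 ≤ n := by exact_mod_cast hn
        linarith
      have h1 := hC n (by linarith)
      have h2 := (abs_le.1 h1).2
      rw [Chebyshev.psi, Nat.floor_natCast] at h2
      have h3 : C * n / Real.log n ≤ C * n / L := by
        gcongr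
        exact Real.log_le_log hy0 hyn
      rw [hK, add_mul, one_mul, div_mul_eq_mul_div]
      linarith)
  have hmax : ∀ n ∈ Finset.Ioc N M, max 1 (n : ℝ) = n := fun n hn => by
    rw [max_eq_right]
    have := (Finset.mem_Ioc.1 hn).1
    exact_mod_cast (by omega : 1 ≤ n)
  have hpsi : y - C * y / L ≤ ∑ k ∈ Finset.Ioc 0 N, ArithmeticFunction.vonMangoldt k := by
    have := (abs_le.1 (hC y hy)).1
    rw [Chebyshev.psi] at this
    linarith
  have hleft : ∑ p ∈ (Finset.Ioc N M).filter Nat.Prime, 1 / (p : ℝ) ^ 2 ≤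
      (∑ n ∈ Finset.Ioc N M, ArithmeticFunction.vonMangoldt n * (1 / (max 1 (n : ℝ)) ^ 2)) / L := by
    rw [Finset.sum_div, Finset.sum_filter]
    refine Finset.sum_le_sum fun n hn => ?_
    rw [hmax n hn]
    split_ifs with hp
    · rw [ArithmeticFunction.vonMangoldt_apply_prime hp]
      have hyn : y ≤ n := by
        have : (N : ℝ) + 1 ≤ n := by exact_mod_cast (Finset.mem_Ioc.1 hn).1
        linarith
      have : L ≤ Real.log n := Real.log_le_log hy0 hyn
      rw [le_div_iff₀ hL0, mul_comm]
      gcongr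
    · have : 0 ≤ ArithmeticFunction.vonMangoldt n := ArithmeticFunction.vonMangoldt_nonneg
      positivity
  have hsq : ∑ n ∈ Finset.Ioc N M, 1 / (max 1 (n : ℝ)) ^ 2 ≤ 1 / (N : ℝ) := by
    rw [Finset.sum_congr rfl fun n hn => by rw [hmax n hn]]
    exact sum_Ioc_inv_sq_le (by omega) M
  have hfN : 1 / (max 1 ((N + 1 : ℕ) : ℝ)) ^ 2 ≤ 1 / y ^ 2 := by
    have : y ≤ max 1 ((N + 1 : ℕ) : ℝ) := le_max_of_le_right (by push_cast; linarith)
    gcongr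
  have hN1 : 1 / (N : ℝ) ≤ 1 / y * (1 + 2 / y) := by
    have hN' : (2:ℝ) ≤ N := by exact_mod_cast hN2
    rw [show 1 / y * (1 + 2 / y) = (y + 2) / y ^ 2 by field_simp, div_le_div_iff₀ (by linarith) (by positivity)]
    nlinarith
  have hCK : K ≤ 1 + 2 * C := by
    have : C / L ≤ C / (1 / 2) := by gcongr
    rw [hK]; linarith
  have hK0 : 0 < K := by positivity
  have hfirst : (K * N - ∑ k ∈ Finset.Ioc 0 N, ArithmeticFunction.vonMangoldt k) *
      (1 / (max 1 ((N + 1 : ℕ) : ℝ)) ^ 2) ≤ (2 * C / L) / y := by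
    have h1 : K * N - ∑ k ∈ Finset.Ioc 0 N, ArithmeticFunction.vonMangoldt k ≤ 2 * C * y / L := by
      have : K * N ≤ K * y := by gcongr
      have h2 : K * y = y + C * y / L := by rw [hK]; ring
      have h3 : 2 * C * y / L = C * y / L + C * y / L := by ring
      linarith
    calc _ ≤ 2 * C * y / L * (1 / (max 1 ((N + 1 : ℕ) : ℝ)) ^ 2) := by gcongr
      _ ≤ 2 * C * y / L * (1 / y ^ 2) := by gcongr
      _ = _ := by field_simp
  have hsecond : K * ∑ n ∈ Finset.Ioc N M, 1 / (max 1 (n : ℝ)) ^ 2 ≤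
      (1 + C / L + 2 * (1 + 2 * C) / L) / y := by
    calc _ ≤ K * (1 / y * (1 + 2 / y)) := by gcongr; linarith
      _ = (K + K * (2 / y)) / y := by ring
      _ ≤ (K + (1 + 2 * C) * (2 / L)) / y := by gcongr
      _ = _ := by rw [hK]; ring
  refine hleft.trans ?_
  rw [← div_div _ y L]
  gcongr
  calc _ ≤ 2 * C / L / y + (1 + C / L + 2 * (1 + 2 * C) / L) / y :=
        hmain.trans (add_le_add hfirst hsecond)
    _ = _ := by ring

/-- The sum of the reciprocals of the primes up to `x`. -/
noncomputable def primeRecip (x : ℝ) : ℝ :=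
  ∑ p ∈ (Finset.Icc 1 ⌊x⌋₊).filter Nat.Prime, 1 / (p : ℝ)

lemma abs_theta_sub_le : ∃ C > 0, ∀ x : ℝ, 2 ≤ x → |Chebyshev.theta x - x| ≤ C * x / Real.log x := by
  obtain ⟨C, hC, h⟩ := abs_psi_sub_le
  refine ⟨C + 32, by positivity, fun x hx => ?_⟩
  have hl : 0 < Real.log x := Real.log_pos (by linarith)
  have h1 := h x hx
  have h2 := Chebyshev.abs_psi_sub_theta_le_sqrt_mul_log (x := x) (by linarith)
  have h3 : Real.log x ≤ x ^ (1 / 4 : ℝ) / (1 / 4) := Real.log_le_rpow_div (by linarith) (by norm_num)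
  have h4 : 2 * √x * Real.log x ≤ 32 * x / Real.log x := by
    rw [le_div_iff₀ hl]
    have h5 : Real.log x * Real.log x ≤ 16 * √x := by
      have : (x ^ (1 / 4 : ℝ)) * (x ^ (1 / 4 : ℝ)) = √x := by
        rw [← Real.rpow_add (by linarith), Real.sqrt_eq_rpow]; norm_num
      have := mul_self_le_mul_self hl.le h3
      nlinarith
    calc 2 * √x * Real.log x * Real.log x = 2 * √x * (Real.log x * Real.log x) := by ring
      _ ≤ 2 * √x * (16 * √x) := by gcongr
      _ = 32 * (√x * √x) := by ring
      _ = 32 * x := by rw [Real.mul_self_sqrt (by linarith)]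
  calc |Chebyshev.theta x - x| = |(Chebyshev.psi x - x) - (Chebyshev.psi x - Chebyshev.theta x)| := by
        congr 1; ring
    _ ≤ C * x / Real.log x + 32 * x / Real.log x := (abs_sub _ _).trans (add_le_add h1 (h2.trans h4))
    _ = _ := by ring

lemma hasDerivAt_inv_mul_log {t : ℝ} (ht : 1 < t) :
    HasDerivAt (fun t : ℝ => 1 / (t * Real.log t)) (-(Real.log t + 1) / (t * Real.log t) ^ 2) t := by
  have hl : 0 < Real.log t := Real.log_pos ht
  have h := ((hasDerivAt_id t).mul (Real.hasDerivAt_log (by linarith : t ≠ 0))).inv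
    (mul_pos (by simp; linarith) hl).ne'
  refine (h.congr_deriv ?_).congr_of_eventuallyEq (.of_forall fun s => by simp)
  have : t ≠ 0 := by linarith
  simp; field_simp

lemma hasDerivAt_inv_log_sub_log_log {t : ℝ} (ht : 1 < t) :
    HasDerivAt (fun t : ℝ => 1 / Real.log t - Real.log (Real.log t)) (-(Real.log t + 1) / (t * Real.log t) ^ 2 * t) t := by
  have hl : 0 < Real.log t := Real.log_pos ht
  have h0 : t ≠ 0 := by linarith
  have h1 := (Real.hasDerivAt_log h0)
  have h := (h1.inv hl.ne').sub (h1.log hl.ne')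
  refine (h.congr_deriv ?_).congr_of_eventuallyEq (.of_forall fun s => by simp)
  field_simp; ring

lemma hasDerivAt_neg_inv_log {t : ℝ} (ht : 1 < t) :
    HasDerivAt (fun t : ℝ => -(1 / Real.log t)) (1 / (t * Real.log t ^ 2)) t := by
  have hl : 0 < Real.log t := Real.log_pos ht
  have h0 : t ≠ 0 := by linarith
  have h := ((Real.hasDerivAt_log h0).inv hl.ne').neg
  refine (h.congr_deriv ?_).congr_of_eventuallyEq (.of_forall fun s => by simp)
  field_simp

lemma sum_Ioc_prime_inv {a b : ℝ} (hab : a ≤ b) :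
    primeRecip b - primeRecip a = ∑ p ∈ (Finset.Ioc ⌊a⌋₊ ⌊b⌋₊).filter Nat.Prime, 1 / (p : ℝ) := by
  unfold primeRecip
  have : (Finset.Icc 1 ⌊b⌋₊).filter Nat.Prime =
      ((Finset.Icc 1 ⌊a⌋₊).filter Nat.Prime) ∪ ((Finset.Ioc ⌊a⌋₊ ⌊b⌋₊).filter Nat.Prime) := by
    have := Nat.floor_mono hab
    ext p; simp only [Finset.mem_filter, Finset.mem_Icc, Finset.mem_union, Finset.mem_Ioc]
    constructor
    · rintro ⟨⟨h1, h2⟩, h3⟩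
      by_cases h : p ≤ ⌊a⌋₊
      · exact Or.inl ⟨⟨h1, h⟩, h3⟩
      · exact Or.inr ⟨⟨by omega, h2⟩, h3⟩
    · rintro (⟨⟨h1, h2⟩, h3⟩ | ⟨⟨h1, h2⟩, h3⟩)
      · exact ⟨⟨h1, by omega⟩, h3⟩
      · exact ⟨⟨by omega, h2⟩, h3⟩
  rw [this, Finset.sum_union]
  · ring
  · rw [Finset.disjoint_left]
    intro p; simp only [Finset.mem_filter, Finset.mem_Icc, Finset.mem_Ioc]; omega

lemma primeRecip_sub_eq {a b : ℝ} (ha : 2 ≤ a) (hab : a ≤ b) :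
    primeRecip b - primeRecip a =
      1 / (b * Real.log b) * Chebyshev.theta b - 1 / (a * Real.log a) * Chebyshev.theta a -
        ∫ t in Set.Ioc a b, -(Real.log t + 1) / (t * Real.log t) ^ 2 * Chebyshev.theta t := by
  have key := sum_mul_eq_sub_sub_integral_mul (𝕜 := ℝ) (f := fun t : ℝ => 1 / (t * Real.log t))
    (fun n : ℕ => if n.Prime then Real.log n else 0) (by linarith : (0 : ℝ) ≤ a) hab
    (fun t ht => (hasDerivAt_inv_mul_log (by linarith [ht.1])).differentiableAt) (by
      have : ContinuousOn (fun t : ℝ => -(Real.log t + 1) / (t * Real.log t) ^ 2) (Set.Icc a b) := by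
        intro t ht
        have h1 : 1 < t := by linarith [ht.1]
        have hl : 0 < Real.log t := Real.log_pos h1
        have h0 : t ≠ 0 := by linarith
        have : ContinuousAt Real.log t := Real.continuousAt_log h0
        refine ContinuousAt.continuousWithinAt ?_
        fun_prop (disch := positivity)
      refine (this.integrableOn_Icc).congr_fun (fun t ht => ?_) measurableSet_Icc
      exact ((hasDerivAt_inv_mul_log (by linarith [ht.1])).deriv).symm)
  have hth : ∀ t : ℝ, ∑ n ∈ Finset.Icc 0 ⌊t⌋₊, (if n.Prime then Real.log n else 0) = Chebyshev.theta t := by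
    intro t; rw [Chebyshev.theta_eq_sum_Icc, Finset.sum_filter]
  simp only [hth] at key
  rw [sum_Ioc_prime_inv hab, Finset.sum_filter]
  have h1 : ∑ p ∈ Finset.Ioc ⌊a⌋₊ ⌊b⌋₊, (if p.Prime then 1 / (p : ℝ) else 0) =
      ∑ k ∈ Finset.Ioc ⌊a⌋₊ ⌊b⌋₊, 1 / ((k : ℝ) * Real.log k) * (if k.Prime then Real.log k else 0) := by
    refine Finset.sum_congr rfl fun p _ => ?_
    split_ifs with hp
    · have : 0 < Real.log (p : ℝ) := Real.log_pos (by exact_mod_cast hp.one_lt)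
      have := hp.pos
      field_simp
    · simp
  rw [h1, key]
  congr 1
  refine setIntegral_congr_fun measurableSet_Ioc fun t ht => ?_
  simp only [(hasDerivAt_inv_mul_log (by linarith [ht.1] : 1 < t)).deriv]

lemma continuousOn_deriv_inv_mul_log {a b : ℝ} (ha : 2 ≤ a) :
    ContinuousOn (fun t : ℝ => -(Real.log t + 1) / (t * Real.log t) ^ 2) (Set.Icc a b) := by
  intro t ht
  have h1 : 1 < t := by linarith [ht.1]
  have hl : 0 < Real.log t := Real.log_pos h1
  have h0 : t ≠ 0 := by linarith
  have : ContinuousAt Real.log t := Real.continuousAt_log h0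
  refine ContinuousAt.continuousWithinAt ?_
  fun_prop (disch := positivity)

lemma continuousOn_inv_mul_log_sq {a b : ℝ} (ha : 2 ≤ a) :
    ContinuousOn (fun t : ℝ => 1 / (t * Real.log t ^ 2)) (Set.Icc a b) := by
  intro t ht
  have h1 : 1 < t := by linarith [ht.1]
  have hl : 0 < Real.log t := Real.log_pos h1
  have h0 : 0 < t := by linarith
  have : ContinuousAt Real.log t := Real.continuousAt_log h0.ne'
  refine ContinuousAt.continuousWithinAt ?_
  fun_prop (disch := positivity)

lemma primeRecip_increment : ∃ C > 0, ∀ a b : ℝ, 2 ≤ a → a ≤ b →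
    |primeRecip b - primeRecip a - (Real.log (Real.log b) - Real.log (Real.log a))| ≤ C / Real.log a := by
  obtain ⟨C, hC, h⟩ := abs_theta_sub_le
  refine ⟨7 * C, by positivity, fun a b ha hab => ?_⟩
  have hla : 1 / 2 < Real.log a := by
    have := Real.log_two_gt_d9
    have := Real.log_le_log (by norm_num) ha
    linarith
  have hlab : Real.log a ≤ Real.log b := Real.log_le_log (by linarith) hab
  have hmint : IntegrableOn Chebyshev.theta (Set.Ioc a b) :=
    (Chebyshev.theta_mono.intervalIntegrable (μ := volume) (a := a) (b := b)).1
  have hc := continuousOn_deriv_inv_mul_log (a := a) (b := b) ha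
  have hI1 : IntegrableOn (fun t : ℝ => -(Real.log t + 1) / (t * Real.log t) ^ 2 * Chebyshev.theta t)
      (Set.Ioc a b) :=
    (IntegrableOn.continuousOn_mul hc (Chebyshev.theta_mono.monotoneOn _ |>.integrableOn_isCompact
      isCompact_Icc) isCompact_Icc).mono_set Set.Ioc_subset_Icc_self
  have hI2 : IntegrableOn (fun t : ℝ => -(Real.log t + 1) / (t * Real.log t) ^ 2 * t) (Set.Ioc a b) :=
    ((hc.mul continuousOn_id).integrableOn_Icc).mono_set Set.Ioc_subset_Icc_self
  have e1 : ∫ t in Set.Ioc a b, -(Real.log t + 1) / (t * Real.log t) ^ 2 * t =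
      (1 / Real.log b - Real.log (Real.log b)) - (1 / Real.log a - Real.log (Real.log a)) := by
    rw [← intervalIntegral.integral_of_le hab]
    refine intervalIntegral.integral_eq_sub_of_hasDerivAt
      (f := fun t : ℝ => 1 / Real.log t - Real.log (Real.log t)) (fun t ht => ?_) ?_
    · rw [Set.uIcc_of_le hab] at ht
      exact hasDerivAt_inv_log_sub_log_log (by linarith [ht.1])
    · rw [intervalIntegrable_iff_integrableOn_Ioc_of_le hab]; exact hI2
  have e2 : ∫ t in Set.Ioc a b, 3 * C * (1 / (t * Real.log t ^ 2)) = 3 * C * (1 / Real.log a - 1 / Real.log b) := by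
    rw [← intervalIntegral.integral_of_le hab, intervalIntegral.integral_const_mul,
      intervalIntegral.integral_eq_sub_of_hasDerivAt (f := fun t : ℝ => -(1 / Real.log t))
        (fun t ht => hasDerivAt_neg_inv_log ?_) ?_]
    · ring
    · rw [intervalIntegrable_iff_integrableOn_Ioc_of_le hab]
      exact ((continuousOn_inv_mul_log_sq ha).integrableOn_Icc).mono_set Set.Ioc_subset_Icc_self
    · rw [Set.uIcc_of_le hab] at ht
      linarith [ht.1]
  have hbd : ∀ t : ℝ, 2 ≤ t → |1 / (t * Real.log t) * (Chebyshev.theta t - t)| ≤ C * (1 / Real.log t ^ 2) := by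
    intro t ht
    have hl : 0 < Real.log t := Real.log_pos (by linarith)
    rw [abs_mul, abs_of_pos (by positivity)]
    calc 1 / (t * Real.log t) * |Chebyshev.theta t - t| ≤ 1 / (t * Real.log t) * (C * t / Real.log t) := by
          gcongr; exact h t ht
      _ = C * (1 / Real.log t ^ 2) := by field_simp
  have hE : |∫ t in Set.Ioc a b, -(Real.log t + 1) / (t * Real.log t) ^ 2 * (Chebyshev.theta t - t)| ≤
      3 * C * (1 / Real.log a - 1 / Real.log b) := by
    rw [← e2, ← Real.norm_eq_abs]
    refine norm_integral_le_of_norm_le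
      ((((continuousOn_inv_mul_log_sq ha).integrableOn_Icc).mono_set
        Set.Ioc_subset_Icc_self).const_mul _) ?_
    refine (ae_restrict_iff' measurableSet_Ioc).2 (Filter.Eventually.of_forall fun t ht => ?_)
    have ht2 : 2 ≤ t := by linarith [ht.1]
    have hl : 1 / 2 < Real.log t := hla.trans_le (Real.log_le_log (by linarith) ht.1.le)
    have h1 := hbd t ht2
    rw [abs_mul, abs_of_pos (by positivity)] at h1
    rw [norm_mul, Real.norm_eq_abs, Real.norm_eq_abs, neg_div, abs_neg,
      abs_of_pos (by positivity)]
    calc (Real.log t + 1) / (t * Real.log t) ^ 2 * |Chebyshev.theta t - t|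
        = (Real.log t + 1) / (t * Real.log t) * (1 / (t * Real.log t) * |Chebyshev.theta t - t|) := by
          field_simp
      _ ≤ (3 * Real.log t) / (t * Real.log t) * (C * (1 / Real.log t ^ 2)) := by
          gcongr; linarith
      _ = 3 * C * (1 / (t * Real.log t ^ 2)) := by field_simp
  have hsq : ∀ t : ℝ, Real.log a ≤ Real.log t → C * (1 / Real.log t ^ 2) ≤ 2 * C / Real.log a := by
    intro t ht
    have : 0 < Real.log t := by linarith
    rw [mul_one_div, div_le_div_iff₀ (by positivity) (by linarith)]
    nlinarith [mul_pos hC (by linarith : 0 < Real.log t)]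
  have hsplit : primeRecip b - primeRecip a - (Real.log (Real.log b) - Real.log (Real.log a)) =
      1 / (b * Real.log b) * (Chebyshev.theta b - b) - 1 / (a * Real.log a) * (Chebyshev.theta a - a) -
        ∫ t in Set.Ioc a b, -(Real.log t + 1) / (t * Real.log t) ^ 2 * (Chebyshev.theta t - t) := by
    rw [primeRecip_sub_eq ha hab]
    simp only [mul_sub]
    rw [integral_sub hI1 hI2, e1]
    have : 1 / (a * Real.log a) * a = 1 / Real.log a := by field_simp
    have : 1 / (b * Real.log b) * b = 1 / Real.log b := by
      have : b ≠ 0 := by linarith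
      field_simp
    linarith
  rw [hsplit]
  have h1 := (hbd b (by linarith)).trans (hsq b hlab)
  have h2 := (hbd a ha).trans (hsq a le_rfl)
  have h3 : 3 * C * (1 / Real.log a - 1 / Real.log b) ≤ 3 * C / Real.log a := by
    have : 0 < 1 / Real.log b := by apply one_div_pos.2; linarith
    rw [mul_sub, mul_one_div]
    nlinarith
  have h4 : 7 * C / Real.log a = 2 * C / Real.log a + 2 * C / Real.log a + 3 * C / Real.log a := by ring
  rw [h4]
  exact (abs_sub _ _).trans (add_le_add ((abs_sub _ _).trans (add_le_add h1 h2)) (hE.trans h3))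

lemma primeRecip_asymp : ∃ c C : ℝ, 0 < C ∧ ∀ x : ℝ, 2 ≤ x →
    |primeRecip x - Real.log (Real.log x) - c| ≤ C / Real.log x := by
  obtain ⟨C, hC, h⟩ := primeRecip_increment
  have hdist : ∀ a b : ℝ, 2 ≤ a → a ≤ b →
      |(primeRecip b - Real.log (Real.log b)) - (primeRecip a - Real.log (Real.log a))| ≤ C / Real.log a := by
    intro a b ha hab
    convert h a b ha hab using 2; ring
  have hcau : CauchySeq fun x : ℝ => primeRecip x - Real.log (Real.log x) := by
    rw [Metric.cauchySeq_iff']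
    intro ε hε
    have : Filter.Tendsto (fun x => C / Real.log x) Filter.atTop (nhds 0) :=
      Filter.Tendsto.const_div_atTop Real.tendsto_log_atTop C
    obtain ⟨N, hN, hN2⟩ := ((this.eventually (gt_mem_nhds hε)).and
      (Filter.eventually_ge_atTop 2)).exists
    exact ⟨N, fun n hn => by rw [Real.dist_eq]; exact (hdist N n hN2 hn).trans_lt hN⟩
  obtain ⟨c, hc⟩ := cauchySeq_tendsto_of_complete hcau
  refine ⟨c, C, hC, fun x hx => ?_⟩
  have h1 : Filter.Tendsto (fun b : ℝ => |(primeRecip b - Real.log (Real.log b)) - (primeRecip x - Real.log (Real.log x))|)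
      Filter.atTop (nhds |c - (primeRecip x - Real.log (Real.log x))|) := (hc.sub_const _).abs
  rw [abs_sub_comm]
  exact le_of_tendsto h1 (Filter.eventually_atTop.2 ⟨x, fun b hb => hdist x b hx hb⟩)

lemma abs_log_le_rpow {v : ℝ} (hv : 0 < v) : |Real.log v| ≤ 2 * v ^ (-(1 / 2) : ℝ) + v := by
  have h1 : 0 < v ^ (-(1 / 2) : ℝ) := Real.rpow_pos_of_pos hv _
  have h2 : Real.log v ≤ v := (Real.log_le_sub_one_of_pos hv).trans (by linarith)
  have h3 : -(1 / 2) * Real.log v ≤ v ^ (-(1 / 2) : ℝ) := by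
    rw [← Real.log_rpow hv]
    exact (Real.log_le_sub_one_of_pos h1).trans (by linarith)
  rw [abs_le]
  constructor <;> linarith

lemma integrableOn_rpow_mul_exp {δ : ℝ} (hδ : 0 < δ) {s : ℝ} (hs : 0 < s) :
    IntegrableOn (fun v : ℝ => v ^ (s - 1) * Real.exp (-(δ * v))) (Set.Ioi 0) := by
  have := integrableOn_rpow_mul_exp_neg_mul_rpow (s := s - 1) (p := 1) (b := δ) (by linarith)
    one_pos hδ
  simpa using this

lemma integrableOn_log_mul_exp {δ : ℝ} (hδ : 0 < δ) :
    IntegrableOn (fun v : ℝ => Real.log v * Real.exp (-(δ * v))) (Set.Ioi 0) := by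
  have h1 := (integrableOn_rpow_mul_exp hδ (by norm_num : (0 : ℝ) < 1 / 2)).const_mul 2
  have h2 := integrableOn_rpow_mul_exp hδ (by norm_num : (0 : ℝ) < 2)
  refine (h1.add h2).mono' (by fun_prop) ?_
  refine (ae_restrict_iff' measurableSet_Ioi).2 (.of_forall fun v hv => ?_)
  have := abs_log_le_rpow (v := v) hv
  rw [norm_mul, Real.norm_eq_abs, Real.norm_eq_abs, Real.abs_exp]
  norm_num at this ⊢
  nlinarith [Real.exp_pos (-(δ * v))]

lemma integral_log_mul_exp_neg :
    ∫ t in Set.Ioi (0 : ℝ), Real.log t * Real.exp (-t) = -Real.eulerMascheroniConstant := by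
  have h1 := Complex.hasDerivAt_GammaIntegral (s := 1) (by simp)
  have h2 : HasDerivAt Complex.GammaIntegral (-Real.eulerMascheroniConstant : ℂ) 1 := by
    refine Complex.hasDerivAt_Gamma_one.congr_of_eventuallyEq ?_
    filter_upwards [(isOpen_lt continuous_const Complex.continuous_re).mem_nhds
      (show (0 : ℝ) < (1 : ℂ).re by simp)] with s hs
    exact (Complex.Gamma_eq_integral hs).symm
  have h3 := h1.unique h2
  have h4 : ∫ t in Set.Ioi (0 : ℝ), ((Real.log t * Real.exp (-t) : ℝ) : ℂ) =
      (-Real.eulerMascheroniConstant : ℂ) := by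
    rw [← h3]
    refine setIntegral_congr_fun measurableSet_Ioi fun t _ => ?_
    simp
  rw [integral_complex_ofReal] at h4
  exact_mod_cast h4

lemma mul_integral_log_mul_exp {δ : ℝ} (hδ : 0 < δ) :
    δ * ∫ v in Set.Ioi (0 : ℝ), Real.log v * Real.exp (-(δ * v)) =
      -Real.eulerMascheroniConstant - Real.log δ := by
  have h := integral_comp_mul_left_Ioi (fun u : ℝ => (Real.log u - Real.log δ) * Real.exp (-u)) 0 hδ
  have h1 : ∫ v in Set.Ioi (0 : ℝ), Real.log v * Real.exp (-(δ * v)) =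
      ∫ v in Set.Ioi (0 : ℝ), (Real.log (δ * v) - Real.log δ) * Real.exp (-(δ * v)) := by
    refine setIntegral_congr_fun measurableSet_Ioi fun v hv => ?_
    simp only [Real.log_mul hδ.ne' (ne_of_gt hv)]
    ring
  rw [h1, h, mul_zero, smul_eq_mul, ← mul_assoc, mul_inv_cancel₀ hδ.ne', one_mul]
  simp only [sub_mul]
  have i1 := integrableOn_log_mul_exp (δ := 1) one_pos
  simp only [one_mul] at i1
  rw [integral_sub i1, integral_log_mul_exp_neg, integral_const_mul, integral_exp_neg_Ioi_zero]
  · ring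
  · have := (integrableOn_rpow_mul_exp (δ := 1) one_pos (s := 1) one_pos).const_mul (Real.log δ)
    simpa using this

lemma primeRecip_mono : Monotone primeRecip := by
  intro a b hab
  have := sum_Ioc_prime_inv hab
  have h2 : 0 ≤ ∑ p ∈ (Finset.Ioc ⌊a⌋₊ ⌊b⌋₊).filter Nat.Prime, 1 / (p : ℝ) :=
    Finset.sum_nonneg fun _ _ => by positivity
  linarith

lemma primeRecip_eq_zero {x : ℝ} (hx : x < 2) : primeRecip x = 0 := by
  unfold primeRecip
  refine Finset.sum_eq_zero fun p hp => ?_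
  simp only [Finset.mem_filter, Finset.mem_Icc] at hp
  have := hp.2.two_le
  have h1 : ⌊x⌋₊ < 2 := (Nat.floor_lt' (by norm_num)).2 (by exact_mod_cast hx)
  omega

lemma tsum_primes_rpow_eq {δ : ℝ} (hδ : 0 < δ) :
    ∑' p : Nat.Primes, (p : ℝ) ^ (-(1 + δ)) =
      δ * ∫ v in Set.Ioi (0 : ℝ), primeRecip (Real.exp v) * Real.exp (-(δ * v)) := by
  set f : ℕ → ℝ := fun n => if n.Prime then 1 / (n : ℝ) else 0 with hf
  have hf0 : ∀ n, 0 ≤ f n := fun n => by simp only [hf]; split_ifs <;> positivity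
  have hO : (fun n ↦ ∑ k ∈ Finset.Icc 1 n, f k) =O[Filter.atTop] fun n ↦ (n : ℝ) ^ (δ / 2) := by
    have hlog : (fun n : ℕ => 1 + Real.log n) =O[Filter.atTop] fun n : ℕ ↦ (n : ℝ) ^ (δ / 2) := by
      have h1 : (fun x : ℝ => 1 + Real.log x) =O[Filter.atTop] fun x ↦ x ^ (δ / 2) := by
        refine Asymptotics.IsBigO.add ?_ (isLittleO_log_rpow_atTop (by positivity)).isBigO
        refine Asymptotics.IsBigO.of_bound 1 ?_
        filter_upwards [Filter.eventually_ge_atTop 1] with x hx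
        have := Real.one_le_rpow hx (by positivity : 0 ≤ δ / 2)
        rw [Real.norm_of_nonneg (by linarith : 0 ≤ x ^ (δ / 2))]; simpa using this
      exact h1.comp_tendsto tendsto_natCast_atTop_atTop
    refine Asymptotics.IsBigO.trans (Asymptotics.IsBigO.of_bound 1 (.of_forall fun n => ?_)) hlog
    have h1 : ∑ k ∈ Finset.Icc 1 n, f k ≤ 1 + Real.log n := by
      have := harmonic_le_one_add_log n
      rw [harmonic_eq_sum_Icc] at this
      push_cast at this
      refine le_trans (Finset.sum_le_sum fun k _ => ?_) this
      simp only [hf]; split_ifs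
      · simp
      · positivity
    have h0 : 0 ≤ ∑ k ∈ Finset.Icc 1 n, f k := Finset.sum_nonneg fun _ _ => hf0 _
    rw [Real.norm_of_nonneg h0, one_mul]
    exact h1.trans (le_abs_self _)
  have key := LSeries_eq_mul_integral_of_nonneg f (r := δ / 2) (by positivity) (s := (δ : ℂ))
    (by simp; linarith) hO hf0
  have hL : LSeries (fun n => (f n : ℂ)) (δ : ℂ) =
      ((∑' p : Nat.Primes, (p : ℝ) ^ (-(1 + δ)) : ℝ) : ℂ) := by
    have h1 : ∑' p : Nat.Primes, (p : ℝ) ^ (-(1 + δ)) =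
        ∑' n : ℕ, Set.indicator {p : ℕ | p.Prime} (fun n : ℕ => (n : ℝ) ^ (-(1 + δ))) n :=
      tsum_subtype {p : ℕ | p.Prime} (fun n : ℕ => (n : ℝ) ^ (-(1 + δ)))
    rw [h1, LSeries, Complex.ofReal_tsum]
    congr 1; ext n
    rw [LSeries.term_def]
    by_cases hn : n.Prime
    · have hn0 : (0 : ℝ) < n := by exact_mod_cast hn.pos
      rw [if_neg hn.ne_zero, Set.indicator_of_mem (by exact hn)]
      simp only [hf, if_pos hn]
      rw [show ((n : ℂ) ^ (δ : ℂ)) = (((n : ℝ) ^ δ : ℝ) : ℂ) by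
        rw [Complex.ofReal_cpow hn0.le]; simp, ← Complex.ofReal_div, neg_add,
        Real.rpow_add hn0, Real.rpow_neg hn0.le δ, Real.rpow_neg_one]
      congr 1; field_simp
    · rw [Set.indicator_of_notMem (by exact hn)]
      simp [hf, hn]
  have hR : ∫ t in Set.Ioi (1 : ℝ), (∑ k ∈ Finset.Icc 1 ⌊t⌋₊, (f k : ℂ)) * t ^ (-((δ : ℂ) + 1)) =
      ((∫ t in Set.Ioi (1 : ℝ), primeRecip t * t ^ (-(δ + 1)) : ℝ) : ℂ) := by
    rw [← integral_complex_ofReal]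
    refine setIntegral_congr_fun measurableSet_Ioi fun t ht => ?_
    have ht0 : (0 : ℝ) < t := lt_trans one_pos ht
    simp only [primeRecip, Finset.sum_filter, ← hf]
    push_cast [Complex.ofReal_cpow ht0.le]
    rfl
  rw [hL, hR] at key
  have key2 : ∑' p : Nat.Primes, (p : ℝ) ^ (-(1 + δ)) =
      δ * ∫ t in Set.Ioi (1 : ℝ), primeRecip t * t ^ (-(δ + 1)) := by exact_mod_cast key
  rw [key2]
  congr 1
  have himg : Real.exp '' Set.Ioi 0 = Set.Ioi 1 := by
    ext t; constructor
    · rintro ⟨v, hv, rfl⟩; exact Real.one_lt_exp_iff.2 hv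
    · intro ht; exact ⟨Real.log t, Real.log_pos ht, Real.exp_log (lt_trans one_pos ht)⟩
  rw [← himg, integral_image_eq_integral_abs_deriv_smul measurableSet_Ioi
    (fun v _ => (Real.hasDerivAt_exp v).hasDerivWithinAt) Real.exp_injective.injOn]
  refine setIntegral_congr_fun measurableSet_Ioi fun v _ => ?_
  simp only [smul_eq_mul, Real.abs_exp]
  rw [← Real.exp_mul, mul_left_comm, ← Real.exp_add]
  congr 2; ring

lemma tsum_primes_asymp {c C : ℝ} (hC : 0 < C)
    (h : ∀ x : ℝ, 2 ≤ x → |primeRecip x - Real.log (Real.log x) - c| ≤ C / Real.log x) :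
    Filter.Tendsto (fun δ : ℝ => ∑' p : Nat.Primes, (p : ℝ) ^ (-(1 + δ)) + Real.log δ)
      (nhdsWithin 0 (Set.Ioi 0)) (nhds (c - Real.eulerMascheroniConstant)) := by
  set K : ℝ := 2 * C + 3 + |c| with hK
  have hE : ∀ v : ℝ, 0 < v →
      |primeRecip (Real.exp v) - Real.log v - c| ≤ K * v ^ ((1 / 2 : ℝ) - 1) := by
    intro v hv
    have hl2 := Real.log_two_gt_d9
    have hl2' := Real.log_two_lt_d9
    rcases le_or_gt (Real.log 2) v with h1 | h1
    · have h2 := h (Real.exp v) (by rwa [← Real.log_le_iff_le_exp (by norm_num)])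
      rw [Real.log_exp] at h2
      refine h2.trans ?_
      have h3 : v⁻¹ = v ^ ((1 / 2 : ℝ) - 1) * v ^ (-(1 / 2) : ℝ) := by
        rw [← Real.rpow_add hv, ← Real.rpow_neg_one]; norm_num
      have h4 : v ^ (-(1 / 2) : ℝ) ≤ 2 := by
        have : (1 / 4 : ℝ) ^ (-(1 / 2) : ℝ) = 2 := by
          rw [show (1 / 4 : ℝ) = (2 : ℝ) ^ (-2 : ℝ) by rw [Real.rpow_neg (by norm_num)]; norm_num,
            ← Real.rpow_mul (by norm_num)]; norm_num
        exact (Real.rpow_le_rpow_of_nonpos (by norm_num) (show (1 / 4 : ℝ) ≤ v by linarith)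
          (by norm_num)).trans_eq this
      rw [div_eq_mul_inv, h3]
      have h5 : 0 < v ^ ((1 / 2 : ℝ) - 1) := Real.rpow_pos_of_pos hv _
      have : C * (v ^ ((1 / 2 : ℝ) - 1) * v ^ (-(1 / 2) : ℝ)) ≤ C * (v ^ ((1 / 2 : ℝ) - 1) * 2) := by
        gcongr
      nlinarith [abs_nonneg c]
    · rw [primeRecip_eq_zero (by rwa [← Real.lt_log_iff_exp_lt (by norm_num)])]
      have h2 := abs_log_le_rpow hv
      have h3 : 1 ≤ v ^ ((1 / 2 : ℝ) - 1) :=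
        Real.one_le_rpow_of_pos_of_le_one_of_nonpos hv (by linarith) (by norm_num)
      have h4 : |0 - Real.log v - c| ≤ |Real.log v| + |c| := by
        rw [zero_sub]; exact (abs_sub _ _).trans (by rw [abs_neg])
      norm_num at h2 h3 ⊢
      rw [zero_sub] at h4
      nlinarith [abs_nonneg c]
  have hmeas : Measurable fun v : ℝ => primeRecip (Real.exp v) :=
    (primeRecip_mono.comp Real.exp_monotone).measurable
  have hmain : ∀ δ : ℝ, 0 < δ → |∑' p : Nat.Primes, (p : ℝ) ^ (-(1 + δ)) + Real.log δ -
      (c - Real.eulerMascheroniConstant)| ≤ K * Real.Gamma (1 / 2) * δ ^ (1 / 2 : ℝ) := by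
    intro δ hδ
    have ig := (integrableOn_rpow_mul_exp hδ (by norm_num : (0 : ℝ) < 1 / 2)).const_mul K
    have hbd : ∀ᵐ v ∂(volume.restrict (Set.Ioi (0 : ℝ))),
        ‖(primeRecip (Real.exp v) - Real.log v - c) * Real.exp (-(δ * v))‖ ≤
        K * (v ^ ((1 / 2 : ℝ) - 1) * Real.exp (-(δ * v))) := by
      refine (ae_restrict_iff' measurableSet_Ioi).2 (.of_forall fun v hv => ?_)
      rw [norm_mul, Real.norm_eq_abs, Real.norm_eq_abs, Real.abs_exp, ← mul_assoc]
      exact mul_le_mul_of_nonneg_right (hE v hv) (Real.exp_pos _).le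
    have iE : IntegrableOn (fun v => (primeRecip (Real.exp v) - Real.log v - c) *
        Real.exp (-(δ * v))) (Set.Ioi 0) := by
      refine ig.mono' ?_ hbd
      have := hmeas
      exact (by fun_prop : Measurable fun v => (primeRecip (Real.exp v) - Real.log v - c) *
        Real.exp (-(δ * v))).aestronglyMeasurable
    have i1 := integrableOn_log_mul_exp hδ
    have i0 : IntegrableOn (fun v : ℝ => c * Real.exp (-(δ * v))) (Set.Ioi 0) := by
      have := (integrableOn_rpow_mul_exp hδ (s := 1) one_pos).const_mul c
      simpa [IntegrableOn] using this
    have e0 : δ * ∫ v in Set.Ioi (0 : ℝ), c * Real.exp (-(δ * v)) = c := by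
      rw [integral_const_mul]
      have := integral_comp_mul_left_Ioi (fun u : ℝ => Real.exp (-u)) 0 hδ
      rw [this, mul_zero, integral_exp_neg_Ioi_zero, smul_eq_mul]
      field_simp
    have hsplit : ∫ v in Set.Ioi (0 : ℝ), primeRecip (Real.exp v) * Real.exp (-(δ * v)) =
        (∫ v in Set.Ioi (0 : ℝ), (primeRecip (Real.exp v) - Real.log v - c) * Real.exp (-(δ * v))) +
        (∫ v in Set.Ioi (0 : ℝ), Real.log v * Real.exp (-(δ * v))) +
        ∫ v in Set.Ioi (0 : ℝ), c * Real.exp (-(δ * v)) := by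
      rw [← integral_add iE i1, ← integral_add (by exact iE.add i1) i0]
      congr 1; ext v; ring
    have hE2 := norm_integral_le_of_norm_le ig hbd
    rw [integral_const_mul, Real.integral_rpow_mul_exp_neg_mul_Ioi (by norm_num) hδ] at hE2
    have e1 := mul_integral_log_mul_exp hδ
    rw [tsum_primes_rpow_eq hδ, hsplit, mul_add, mul_add, e0, e1]
    have hδ2 : δ * (1 / δ) ^ (1 / 2 : ℝ) = δ ^ (1 / 2 : ℝ) := by
      rw [one_div, Real.inv_rpow hδ.le, ← Real.rpow_neg hδ.le]
      nth_rewrite 1 [← Real.rpow_one δ]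
      rw [← Real.rpow_add hδ]; norm_num
    set I := ∫ v in Set.Ioi (0 : ℝ), (primeRecip (Real.exp v) - Real.log v - c) *
      Real.exp (-(δ * v))
    rw [show δ * I + (-Real.eulerMascheroniConstant - Real.log δ) + c + Real.log δ -
      (c - Real.eulerMascheroniConstant) = δ * I by ring, abs_mul, abs_of_pos hδ]
    calc δ * |I| ≤ δ * (K * ((1 / δ) ^ (1 / 2 : ℝ) * Real.Gamma (1 / 2))) := by gcongr; exact hE2
      _ = K * Real.Gamma (1 / 2) * (δ * (1 / δ) ^ (1 / 2 : ℝ)) := by ring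
      _ = _ := by rw [hδ2]
  rw [tendsto_iff_norm_sub_tendsto_zero]
  have hlim : Filter.Tendsto (fun δ : ℝ => K * Real.Gamma (1 / 2) * δ ^ (1 / 2 : ℝ))
      (nhdsWithin 0 (Set.Ioi 0)) (nhds 0) := by
    have : Filter.Tendsto (fun δ : ℝ => K * Real.Gamma (1 / 2) * δ ^ (1 / 2 : ℝ))
        (nhds 0) (nhds (K * Real.Gamma (1 / 2) * 0 ^ (1 / 2 : ℝ))) :=
      ((Real.continuous_rpow_const (by norm_num)).tendsto 0).const_mul _
    rw [Real.zero_rpow (by norm_num), mul_zero] at this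
    exact this.mono_left nhdsWithin_le_nhds
  refine squeeze_zero' (.of_forall fun _ => norm_nonneg _) ?_ hlim
  filter_upwards [self_mem_nhdsWithin] with δ hδ using hmain δ hδ

/-- The excess of `-log (1 - x)` over its linear part. -/
noncomputable def logExcess (x : ℝ) : ℝ := -Real.log (1 - x) - x

lemma logExcess_nonneg {x : ℝ} (hx : x < 1) : 0 ≤ logExcess x := by
  have := Real.log_le_sub_one_of_pos (by linarith : 0 < 1 - x)
  unfold logExcess; linarith

lemma logExcess_le {x : ℝ} (h0 : 0 ≤ x) (hx : x ≤ 1 / 2) : logExcess x ≤ 2 * x ^ 2 := by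
  have h1 := Real.log_le_sub_one_of_pos (inv_pos.2 (by linarith) : 0 < (1 - x)⁻¹)
  rw [Real.log_inv] at h1
  have h2 : (1 - x)⁻¹ - 1 ≤ x + 2 * x ^ 2 := by
    rw [sub_le_iff_le_add, inv_le_iff_one_le_mul₀ (by linarith)]
    nlinarith [mul_nonneg h0 (mul_nonneg h0 (by linarith : 0 ≤ 1 / 2 - x))]
  unfold logExcess; linarith

lemma prime_rpow_le {δ : ℝ} (hδ : 0 ≤ δ) (p : Nat.Primes) :
    0 ≤ (p : ℝ) ^ (-(1 + δ)) ∧ (p : ℝ) ^ (-(1 + δ)) ≤ 1 / 2 ∧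
      (p : ℝ) ^ (-(1 + δ)) ≤ (p : ℝ) ^ (-1 : ℝ) := by
  have h2 : (2 : ℝ) ≤ p := by exact_mod_cast p.2.two_le
  have h3 : (p : ℝ) ^ (-(1 + δ)) ≤ (p : ℝ) ^ (-1 : ℝ) :=
    Real.rpow_le_rpow_of_exponent_le (by linarith) (by linarith)
  refine ⟨by positivity, h3.trans ?_, h3⟩
  rw [Real.rpow_neg_one, one_div]
  exact inv_anti₀ (by norm_num) h2

lemma logExcess_prime_le {δ : ℝ} (hδ : 0 ≤ δ) (p : Nat.Primes) :
    ‖logExcess ((p : ℝ) ^ (-(1 + δ)))‖ ≤ 2 * (p : ℝ) ^ (-2 : ℝ) := by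
  obtain ⟨h0, h1, h2⟩ := prime_rpow_le hδ p
  rw [Real.norm_of_nonneg (logExcess_nonneg (by linarith))]
  refine (logExcess_le h0 h1).trans ?_
  have h3 : (p : ℝ) ^ (-2 : ℝ) = ((p : ℝ) ^ (-1 : ℝ)) ^ 2 := by
    rw [← Real.rpow_natCast, ← Real.rpow_mul (by positivity)]; norm_num
  rw [h3]; gcongr

lemma summable_two_mul_prime_rpow : Summable fun p : Nat.Primes => 2 * (p : ℝ) ^ (-2 : ℝ) :=
  (Nat.Primes.summable_rpow.2 (by norm_num)).mul_left 2

lemma summable_logExcess_prime {δ : ℝ} (hδ : 0 ≤ δ) :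
    Summable fun p : Nat.Primes => logExcess ((p : ℝ) ^ (-(1 + δ))) :=
  .of_norm_bounded summable_two_mul_prime_rpow (logExcess_prime_le hδ)

lemma exp_tsum_primes {δ : ℝ} (hδ : 0 < δ) :
    ((Real.exp (∑' p : Nat.Primes, (p : ℝ) ^ (-(1 + δ)) +
      ∑' p : Nat.Primes, logExcess ((p : ℝ) ^ (-(1 + δ)))) : ℝ) : ℂ) = riemannZeta ((1 + δ : ℝ) : ℂ) := by
  rw [← riemannZeta_eulerProduct_exp_log (by simpa using hδ),
    ← (Nat.Primes.summable_rpow.2 (by linarith)).tsum_add (summable_logExcess_prime hδ.le),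
    Complex.ofReal_exp, Complex.ofReal_tsum]
  congr 2; ext p
  obtain ⟨h0, h1, _⟩ := prime_rpow_le hδ.le p
  rw [show ((p : ℕ) : ℂ) ^ (-((1 + δ : ℝ) : ℂ)) = (((p : ℝ) ^ (-(1 + δ)) : ℝ) : ℂ) by
    rw [Complex.ofReal_cpow (by positivity)]; simp]
  rw [← Complex.ofReal_one, ← Complex.ofReal_sub, ← Complex.ofReal_log (by linarith),
    ← Complex.ofReal_neg]
  unfold logExcess; congr 1; ring

lemma mertens_constant {c C : ℝ} (hC : 0 < C)
    (h : ∀ x : ℝ, 2 ≤ x → |primeRecip x - Real.log (Real.log x) - c| ≤ C / Real.log x) :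
    c + ∑' p : Nat.Primes, logExcess ((p : ℝ) ^ (-1 : ℝ)) = Real.eulerMascheroniConstant := by
  have h1 := tsum_primes_asymp hC h
  have h2 : Filter.Tendsto (fun δ : ℝ => ∑' p : Nat.Primes, logExcess ((p : ℝ) ^ (-(1 + δ))))
      (nhdsWithin 0 (Set.Ioi 0)) (nhds (∑' p : Nat.Primes, logExcess ((p : ℝ) ^ (-1 : ℝ)))) := by
    refine tendsto_tsum_of_dominated_convergence summable_two_mul_prime_rpow (fun p => ?_) ?_
    · have hp : (2 : ℝ) ≤ p := by exact_mod_cast p.2.two_le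
      obtain ⟨h0, h1, _⟩ := prime_rpow_le le_rfl p
      rw [add_zero] at h0 h1
      have hc : ContinuousAt (fun δ : ℝ => logExcess ((p : ℝ) ^ (-(1 + δ)))) 0 := by
        have hr : ContinuousAt (fun δ : ℝ => (p : ℝ) ^ (-(1 + δ))) 0 :=
          ContinuousAt.rpow continuousAt_const (by fun_prop) (Or.inl (by positivity))
        unfold logExcess
        refine ((ContinuousAt.log (continuousAt_const.sub hr) ?_).neg).sub hr
        change 1 - (p : ℝ) ^ (-(1 + (0 : ℝ))) ≠ 0
        rw [add_zero]; exact (by linarith : (0 : ℝ) < 1 - (p : ℝ) ^ (-1 : ℝ)).ne'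
      have := hc.tendsto
      rw [add_zero] at this
      exact this.mono_left nhdsWithin_le_nhds
    · filter_upwards [self_mem_nhdsWithin] with δ hδ p using logExcess_prime_le (le_of_lt hδ) p
  have h3 := (Real.continuous_exp.tendsto _).comp (h1.add h2)
  have h4 : Filter.Tendsto (fun δ : ℝ => Real.exp ((∑' p : Nat.Primes, (p : ℝ) ^ (-(1 + δ)) +
      Real.log δ) + ∑' p : Nat.Primes, logExcess ((p : ℝ) ^ (-(1 + δ)))))
      (nhdsWithin 0 (Set.Ioi 0)) (nhds 1) := by
    have hz : Filter.Tendsto (fun δ : ℝ => ((1 + δ : ℝ) : ℂ)) (nhdsWithin 0 (Set.Ioi 0))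
        (nhdsWithin 1 {1}ᶜ) := by
      refine tendsto_nhdsWithin_iff.2 ⟨?_, ?_⟩
      · have : Filter.Tendsto (fun δ : ℝ => ((1 + δ : ℝ) : ℂ)) (nhds 0) (nhds ((1 + 0 : ℝ) : ℂ)) :=
          (by fun_prop : Continuous fun δ : ℝ => ((1 + δ : ℝ) : ℂ)).tendsto 0
        rw [add_zero, Complex.ofReal_one] at this
        exact this.mono_left nhdsWithin_le_nhds
      · filter_upwards [self_mem_nhdsWithin] with δ hδ
        have : δ ≠ 0 := ne_of_gt hδ
        simpa using this
    have h5 := (Complex.continuous_re.tendsto _).comp (riemannZeta_residue_one.comp hz)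
    rw [Complex.one_re] at h5
    refine h5.congr' ?_
    filter_upwards [self_mem_nhdsWithin] with δ hδ
    have hδ' : 0 < δ := hδ
    simp only [Function.comp]
    rw [← exp_tsum_primes hδ', ← Complex.ofReal_one, ← Complex.ofReal_sub, ← Complex.ofReal_mul,
      Complex.ofReal_re, add_sub_cancel_left]
    rw [add_right_comm, Real.exp_add _ (Real.log δ), Real.exp_log hδ', mul_comm]
  have h6 := tendsto_nhds_unique h3 h4
  rw [Real.exp_eq_one_iff] at h6
  linarith

/-- The product of `(1 - 1 / p)⁻¹` over the primes up to `Y`. -/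
noncomputable def mertensProd (Y : ℝ) : ℝ :=
  ∏ p ∈ (Finset.Icc 1 ⌊Y⌋₊).filter Nat.Prime, (1 - 1 / (p : ℝ))⁻¹

lemma mertensProd_le : ∃ C > 0, ∀ Y : ℝ, 2 ≤ Y →
    mertensProd Y ≤ Real.exp Real.eulerMascheroniConstant * Real.log Y * Real.exp (C / Real.log Y) := by
  obtain ⟨c, C, hC, h⟩ := primeRecip_asymp
  have hcon := mertens_constant hC h
  refine ⟨C, hC, fun Y hY => ?_⟩
  have hl : 0 < Real.log Y := Real.log_pos (by linarith)
  have e1 : mertensProd Y = Real.exp (primeRecip Y +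
      ∑ p ∈ (Finset.Icc 1 ⌊Y⌋₊).filter Nat.Prime, logExcess (1 / (p : ℝ))) := by
    unfold mertensProd primeRecip
    rw [← Finset.sum_add_distrib, Real.exp_sum]
    refine Finset.prod_congr rfl fun p hp => ?_
    have hp2 : (2 : ℝ) ≤ p := by exact_mod_cast (Finset.mem_filter.1 hp).2.two_le
    have : 1 / (p : ℝ) < 1 := by rw [div_lt_one (by linarith)]; linarith
    unfold logExcess
    rw [add_sub_cancel, Real.exp_neg, Real.exp_log (by linarith)]
  have e2 : ∑ p ∈ (Finset.Icc 1 ⌊Y⌋₊).filter Nat.Prime, logExcess (1 / (p : ℝ)) ≤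
      ∑' p : Nat.Primes, logExcess ((p : ℝ) ^ (-1 : ℝ)) := by
    have hs := summable_logExcess_prime (le_refl 0)
    simp only [add_zero] at hs
    have hnn : ∀ p : Nat.Primes, 0 ≤ logExcess ((p : ℝ) ^ (-1 : ℝ)) := by
      intro p
      obtain ⟨h0, h1, _⟩ := prime_rpow_le le_rfl p
      rw [add_zero] at h1
      exact logExcess_nonneg (by linarith)
    have h7 := Summable.sum_le_tsum (L := SummationFilter.unconditional Nat.Primes)
      (Finset.subtype Nat.Prime ((Finset.Icc 1 ⌊Y⌋₊).filter Nat.Prime) : Finset Nat.Primes)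
      (fun p _ => hnn p) hs
    refine le_trans (le_of_eq ?_) h7
    have h8 := Finset.sum_subtype_of_mem (p := Nat.Prime)
      (s := (Finset.Icc 1 ⌊Y⌋₊).filter Nat.Prime) (fun p : ℕ => logExcess (1 / (p : ℝ)))
      (fun p hp => (Finset.mem_filter.1 hp).2)
    rw [← h8]
    refine Finset.sum_congr rfl fun p _ => ?_
    rw [Real.rpow_neg_one, one_div]
  have e3 := (abs_le.1 (h Y hY)).2
  rw [e1]
  calc _ ≤ Real.exp (Real.eulerMascheroniConstant + Real.log (Real.log Y) + C / Real.log Y) := by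
        apply Real.exp_le_exp.2; linarith
    _ = _ := by rw [Real.exp_add, Real.exp_add, Real.exp_log hl]

lemma norm_sum_char_mul_conj_le {q : ℕ} (hq : q ≠ 0) (n m : ℕ) :
    ‖∑ χ : DirichletCharacter ℂ q, χ (n : ZMod q) * (starRingEnd ℂ) (χ (m : ZMod q))‖ ≤
      if n ≡ m [MOD q] then (q.totient : ℝ) else 0 := by
  have : NeZero q := ⟨hq⟩
  by_cases hm : IsUnit (m : ZMod q)
  · have h1 : ∑ χ : DirichletCharacter ℂ q, χ (n : ZMod q) * (starRingEnd ℂ) (χ (m : ZMod q)) =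
        if (m : ZMod q) = (n : ZMod q) then (q.totient : ℂ) else 0 := by
      rw [← DirichletCharacter.sum_char_inv_mul_char_eq ℂ hm (n : ZMod q)]
      refine Finset.sum_congr rfl fun χ _ => ?_
      rw [mul_comm]
      congr 1
      rw [starRingEnd_apply, MulChar.star_apply', MulChar.inv_apply_eq_inv']
      refine inv_eq_of_mul_eq_one_right ?_
      rw [← map_mul, mul_comm, ZMod.inv_mul_of_unit _ hm, map_one]
    rw [h1]
    by_cases h : n ≡ m [MOD q]
    · rw [if_pos h, if_pos ((ZMod.natCast_eq_natCast_iff _ _ _).2 h.symm)]; simp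
    · rw [if_neg h, if_neg fun h' => h ((ZMod.natCast_eq_natCast_iff _ _ _).1 h').symm]; simp
  · have : ∀ χ : DirichletCharacter ℂ q, χ (m : ZMod q) = 0 := fun χ => χ.map_nonunit hm
    simp only [this, map_zero, mul_zero, Finset.sum_const_zero, norm_zero]
    split_ifs <;> positivity

lemma card_modEq_le {q : ℕ} (hq : q ≠ 0) (X n : ℕ) :
    (((Finset.Ioc 0 X).filter fun m => m ≡ n [MOD q]).card : ℝ) ≤ 1 + (X : ℝ) / q := by
  have hq0 : (0 : ℚ) < q := by positivity
  have h := Nat.Ioc_filter_modEq_card 0 X (Nat.pos_of_ne_zero hq) n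
  have h1 : (((Finset.Ioc 0 X).filter fun m => m ≡ n [MOD q]).card : ℚ) ≤ 1 + (X : ℚ) / q := by
    have h2 : ((((Finset.Ioc 0 X).filter fun m => m ≡ n [MOD q]).card : ℤ) : ℚ) =
        ((max (⌊((X : ℚ) - n) / q⌋ - ⌊(((0 : ℕ) : ℚ) - n) / q⌋) 0 : ℤ) : ℚ) := by rw [h]
    rw [Int.cast_natCast] at h2
    rw [h2, Int.cast_max, max_le_iff]
    constructor
    · have h3 := Int.floor_le (((X : ℚ) - n) / q)
      have h4 := Int.lt_floor_add_one ((((0 : ℕ) : ℚ) - n) / q)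
      have h5 : ((X : ℚ) - n) / q = (((0 : ℕ) : ℚ) - n) / q + X / q := by
        push_cast; ring
      push_cast at h3 h4 h5 ⊢
      linarith
    · push_cast; positivity
  have h6 : ((((Finset.Ioc 0 X).filter fun m => m ≡ n [MOD q]).card : ℚ) : ℝ) ≤
      ((1 + (X : ℚ) / q : ℚ) : ℝ) := by exact_mod_cast h1
  push_cast at h6
  exact h6

lemma sum_char_sq_le {q : ℕ} (hq : q ≠ 0) {X : ℕ} {N : Finset ℕ} (hN : N ⊆ Finset.Ioc 0 X)
    (B : ℕ → ℂ) :
    ∑ χ : DirichletCharacter ℂ q, ‖∑ n ∈ N, B n * χ (n : ZMod q)‖ ^ 2 ≤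
      q.totient * (1 + (X : ℝ) / q) * ∑ n ∈ N, ‖B n‖ ^ 2 := by
  have h1 : ((∑ χ : DirichletCharacter ℂ q, ‖∑ n ∈ N, B n * χ (n : ZMod q)‖ ^ 2 : ℝ) : ℂ) =
      ∑ n ∈ N, ∑ m ∈ N, B n * (starRingEnd ℂ) (B m) *
        ∑ χ : DirichletCharacter ℂ q, χ (n : ZMod q) * (starRingEnd ℂ) (χ (m : ZMod q)) := by
    push_cast
    simp_rw [← Complex.mul_conj', map_sum, Finset.sum_mul_sum, Finset.mul_sum]
    rw [Finset.sum_comm]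
    refine Finset.sum_congr rfl fun n _ => ?_
    rw [Finset.sum_comm]
    refine Finset.sum_congr rfl fun m _ => Finset.sum_congr rfl fun χ _ => ?_
    rw [map_mul]; ring
  have h0 : 0 ≤ ∑ χ : DirichletCharacter ℂ q, ‖∑ n ∈ N, B n * χ (n : ZMod q)‖ ^ 2 :=
    Finset.sum_nonneg fun _ _ => by positivity
  have h2 : ∑ χ : DirichletCharacter ℂ q, ‖∑ n ∈ N, B n * χ (n : ZMod q)‖ ^ 2 ≤
      ∑ n ∈ N, ∑ m ∈ N, ‖B n‖ * ‖B m‖ * (if n ≡ m [MOD q] then (q.totient : ℝ) else 0) := by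
    rw [← Real.norm_of_nonneg h0, ← Complex.norm_real, h1]
    refine (norm_sum_le _ _).trans (Finset.sum_le_sum fun n _ => ?_)
    refine (norm_sum_le _ _).trans (Finset.sum_le_sum fun m _ => ?_)
    rw [norm_mul, norm_mul, RCLike.norm_conj]
    gcongr
    exact norm_sum_char_mul_conj_le hq n m
  have hcard : ∀ n, ∑ m ∈ N, (if m ≡ n [MOD q] then (q.totient : ℝ) else 0) ≤
      q.totient * (1 + (X : ℝ) / q) := by
    intro n
    rw [← Finset.sum_filter, Finset.sum_const, nsmul_eq_mul, mul_comm]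
    gcongr
    refine le_trans ?_ (card_modEq_le hq X n)
    exact_mod_cast Finset.card_le_card (Finset.filter_subset_filter _ hN)
  have h3 : ∑ n ∈ N, ∑ m ∈ N, ‖B n‖ * ‖B m‖ * (if n ≡ m [MOD q] then (q.totient : ℝ) else 0) ≤
      ∑ n ∈ N, ∑ m ∈ N, ((‖B n‖ ^ 2 / 2) * (if m ≡ n [MOD q] then (q.totient : ℝ) else 0) +
        (‖B m‖ ^ 2 / 2) * (if n ≡ m [MOD q] then (q.totient : ℝ) else 0)) := by
    refine Finset.sum_le_sum fun n _ => Finset.sum_le_sum fun m _ => ?_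
    have hc : (m ≡ n [MOD q]) ↔ (n ≡ m [MOD q]) := ⟨fun h => h.symm, fun h => h.symm⟩
    simp only [hc]
    rw [← add_mul]
    gcongr
    nlinarith [sq_nonneg (‖B n‖ - ‖B m‖)]
  refine (h2.trans h3).trans ?_
  simp_rw [Finset.sum_add_distrib]
  rw [Finset.sum_comm (f := fun n m => (‖B m‖ ^ 2 / 2) *
    (if n ≡ m [MOD q] then (q.totient : ℝ) else 0))]
  simp_rw [← Finset.mul_sum]
  have h4 : ∀ n ∈ N, ‖B n‖ ^ 2 / 2 * ∑ m ∈ N, (if m ≡ n [MOD q] then (q.totient : ℝ) else 0) ≤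
      ‖B n‖ ^ 2 / 2 * (q.totient * (1 + (X : ℝ) / q)) := fun n _ => by
    gcongr; exact hcard n
  have h5 := Finset.sum_le_sum h4
  rw [← Finset.sum_mul, ← Finset.sum_div] at h5
  linarith

lemma card_tuples_le {k : ℕ} {Q : Finset ℕ} (hQ : ∀ p ∈ Q, p.Prime) (n : ℕ) :
    ((Fintype.piFinset fun _ : Fin k => Q).filter fun t => ∏ i, t i = n).card ≤ k.factorial := by
  set S := (Fintype.piFinset fun _ : Fin k => Q).filter fun t => ∏ i, t i = n with hS
  have hperm : ∀ t ∈ S, (List.ofFn t).Perm n.primeFactorsList := by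
    intro t ht
    simp only [hS, Finset.mem_filter, Fintype.mem_piFinset] at ht
    refine Nat.primeFactorsList_unique ?_ ?_
    · rw [List.prod_ofFn]; exact ht.2
    · intro p hp
      obtain ⟨i, rfl⟩ := (List.mem_ofFn' _ _).1 hp
      exact hQ _ (ht.1 i)
  rcases S.eq_empty_or_nonempty with h | ⟨t0, ht0⟩
  · rw [h]; simp
  have hlen : n.primeFactorsList.length = k := by
    rw [← (hperm t0 ht0).length_eq, List.length_ofFn]
  calc S.card ≤ (n.primeFactorsList.permutations.toFinset).card := by
        refine Finset.card_le_card_of_injOn (fun t => List.ofFn t) (fun t ht => ?_) ?_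
        · simpa using hperm t ht
        · intro a _ b _ hab; exact List.ofFn_injective hab
    _ ≤ n.primeFactorsList.permutations.length := List.toFinset_card_le _
    _ = k.factorial := by rw [List.length_permutations, hlen]

/-- The `2 * k`-th moment of a prime-supported character sum. -/
lemma sum_char_pow_le {q : ℕ} (hq : q ≠ 0) {k W : ℕ} {Q : Finset ℕ}
    (hQ : ∀ p ∈ Q, p.Prime ∧ p ≤ W) (b : ℕ → ℂ) :
    ∑ χ : DirichletCharacter ℂ q, ‖∑ p ∈ Q, b p * χ (p : ZMod q)‖ ^ (2 * k) ≤
      q.totient * (1 + (W : ℝ) ^ k / q) * (k.factorial * (∑ p ∈ Q, ‖b p‖ ^ 2) ^ k) := by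
  set T := Fintype.piFinset fun _ : Fin k => Q with hT
  set N := T.image fun t => ∏ i, t i with hN
  set B : ℕ → ℂ := fun n => ∑ t ∈ T.filter (fun t => ∏ i, t i = n), ∏ i, b (t i) with hB
  have hNsub : N ⊆ Finset.Ioc 0 (W ^ k) := by
    intro n hn
    obtain ⟨t, ht, rfl⟩ := Finset.mem_image.1 hn
    rw [hT, Fintype.mem_piFinset] at ht
    rw [Finset.mem_Ioc]
    refine ⟨Finset.prod_pos fun i _ => (hQ _ (ht i)).1.pos, ?_⟩
    calc ∏ i, t i ≤ ∏ _i : Fin k, W := Finset.prod_le_prod' fun i _ => (hQ _ (ht i)).2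
      _ = W ^ k := by simp
  have hexp : ∀ χ : DirichletCharacter ℂ q,
      (∑ p ∈ Q, b p * χ (p : ZMod q)) ^ k = ∑ n ∈ N, B n * χ (n : ZMod q) := by
    intro χ
    rw [Finset.sum_pow', ← Finset.sum_fiberwise_of_maps_to
      (s := T) (t := N) (g := fun t => ∏ i, t i) (fun t ht => Finset.mem_image_of_mem _ ht)]
    refine Finset.sum_congr rfl fun n _ => ?_
    rw [hB, Finset.sum_mul]
    refine Finset.sum_congr rfl fun t ht => ?_
    rw [← (Finset.mem_filter.1 ht).2, Finset.prod_mul_distrib, Nat.cast_prod, map_prod]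
  have h1 : ∀ χ : DirichletCharacter ℂ q, ‖∑ p ∈ Q, b p * χ (p : ZMod q)‖ ^ (2 * k) =
      ‖∑ n ∈ N, B n * χ (n : ZMod q)‖ ^ 2 := by
    intro χ
    rw [← hexp χ, norm_pow, ← pow_mul, mul_comm]
  simp_rw [h1]
  refine (sum_char_sq_le hq hNsub B).trans ?_
  push_cast
  have h2 : ∑ n ∈ N, ‖B n‖ ^ 2 ≤ k.factorial * (∑ p ∈ Q, ‖b p‖ ^ 2) ^ k := by
    calc ∑ n ∈ N, ‖B n‖ ^ 2
        ≤ ∑ n ∈ N, k.factorial * ∑ t ∈ T.filter (fun t => ∏ i, t i = n), ∏ i, ‖b (t i)‖ ^ 2 := by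
          refine Finset.sum_le_sum fun n _ => ?_
          have h3 : ‖B n‖ ≤ ∑ t ∈ T.filter (fun t => ∏ i, t i = n), ∏ i, ‖b (t i)‖ := by
            refine (norm_sum_le _ _).trans (le_of_eq ?_)
            simp_rw [norm_prod]
          have h4 := sq_sum_le_card_mul_sum_sq (s := T.filter (fun t => ∏ i, t i = n))
            (f := fun t => ∏ i, ‖b (t i)‖)
          have h5 : ((T.filter (fun t => ∏ i, t i = n)).card : ℝ) ≤ k.factorial := by
            exact_mod_cast card_tuples_le (fun p hp => (hQ p hp).1) n
          calc ‖B n‖ ^ 2 ≤ (∑ t ∈ T.filter (fun t => ∏ i, t i = n), ∏ i, ‖b (t i)‖) ^ 2 := by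
                gcongr
            _ ≤ _ := h4
            _ ≤ k.factorial * ∑ t ∈ T.filter (fun t => ∏ i, t i = n), (∏ i, ‖b (t i)‖) ^ 2 := by
                gcongr
            _ = _ := by simp_rw [Finset.prod_pow]
      _ = k.factorial * ∑ t ∈ T, ∏ i, ‖b (t i)‖ ^ 2 := by
          rw [← Finset.mul_sum, Finset.sum_fiberwise_of_maps_to
            (fun t ht => Finset.mem_image_of_mem _ ht)]
      _ = _ := by rw [Finset.sum_pow']
  gcongr

/-- The largest prime factor, with value `0` on `1`. -/
def maxPrime (n : ℕ) : ℕ := n.primeFactors.sup id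

lemma le_maxPrime {n p : ℕ} (hn : n ≠ 0) (hp : p.Prime) (h : p ∣ n) : p ≤ maxPrime n :=
  Finset.le_sup (f := id) (Nat.mem_primeFactors.2 ⟨hp, h, hn⟩)

lemma maxPrime_le {n B : ℕ} (h : ∀ p, p.Prime → p ∣ n → p ≤ B) : maxPrime n ≤ B :=
  Finset.sup_le fun p hp => h p (Nat.prime_of_mem_primeFactors hp) (Nat.dvd_of_mem_primeFactors hp)

lemma maxPrime_mem {n p : ℕ} (hn : n ≠ 0) (hp : p.Prime) (h : p ∣ n) :
    (maxPrime n).Prime ∧ maxPrime n ∣ n := by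
  obtain ⟨r, hr, h1⟩ := Finset.exists_mem_eq_sup n.primeFactors
    ⟨p, Nat.mem_primeFactors.2 ⟨hp, h, hn⟩⟩ id
  have h2 : maxPrime n = r := h1
  rw [h2]
  exact ⟨Nat.prime_of_mem_primeFactors hr, Nat.dvd_of_mem_primeFactors hr⟩

lemma maxPrime_mul {m p : ℕ} (hm : m ≠ 0) (hp : p.Prime) (h : maxPrime m ≤ p) :
    maxPrime (m * p) = p := by
  refine le_antisymm (maxPrime_le fun r hr hd => ?_)
    (le_maxPrime (mul_ne_zero hm hp.ne_zero) hp (dvd_mul_left p m))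
  rcases (Nat.Prime.dvd_mul hr).1 hd with h1 | h1
  · exact (le_maxPrime hm hr h1).trans h
  · exact Nat.le_of_dvd hp.pos h1

/-- The twisted sum of `χ(p) e(pβ) / p` over the primes `a < p ≤ b`. -/
noncomputable def primeBlock {q : ℕ} (χ : DirichletCharacter ℂ q) (a b : ℕ) (β : ℝ) : ℂ :=
  ∑ p ∈ (Finset.Ioc a b).filter Nat.Prime, χ (p : ZMod q) * e2pi (p * β) / p

lemma norm_e2pi (x : ℝ) : ‖e2pi x‖ = 1 := by
  rw [e2pi, show (2 * Real.pi * Complex.I * x : ℂ) = ((2 * Real.pi * x : ℝ) : ℂ) * Complex.I by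
    push_cast; ring]
  exact Complex.norm_exp_ofReal_mul_I _

/-- Integers whose prime factors are at most `W`, one of which exceeds `w`. -/
noncomputable def smoothShell (w W Z : ℕ) : Finset ℕ :=
  (Finset.Icc 1 Z).filter fun n =>
    (∀ p, p.Prime → p ∣ n → p ≤ W) ∧ ∃ p, p.Prime ∧ p ∣ n ∧ w < p

lemma sum_smoothShell_eq {q : ℕ} (χ : DirichletCharacter ℂ q) (w W Z : ℕ) (α : ℝ) :
    ∑ n ∈ smoothShell w W Z, χ (n : ZMod q) * e2pi (n * α) / n =
      ∑ m ∈ (Finset.Icc 1 Z).filter (fun n => ∀ p, p.Prime → p ∣ n → p ≤ W),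
        χ (m : ZMod q) / m *
          primeBlock χ (max w (maxPrime m - 1)) (max w (min W (Z / m))) (m * α) := by
  simp_rw [primeBlock, Finset.mul_sum]
  rw [Finset.sum_sigma']
  refine Finset.sum_nbij' (fun n => ⟨n / maxPrime n, maxPrime n⟩) (fun x => x.1 * x.2)
    (fun n hn => ?_) (fun x hx => ?_) (fun n hn => ?_) (fun x hx => ?_) (fun n hn => ?_)
  · simp only [smoothShell, Finset.mem_filter, Finset.mem_Icc] at hn
    obtain ⟨⟨hn1, hnZ⟩, hs, p, hp, hpn, hwp⟩ := hn
    obtain ⟨hP, hPd⟩ := maxPrime_mem (by omega) hp hpn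
    obtain ⟨m, hm⟩ := hPd
    set P := maxPrime n with hPdef
    have hdiv : n / P = m := by rw [hm]; exact Nat.mul_div_cancel_left _ hP.pos
    have hm0 : m ≠ 0 := by rintro rfl; omega
    have hmn : m ∣ n := ⟨P, by rw [hm]; ring⟩
    have hPp : p ≤ P := le_maxPrime (by omega) hp hpn
    have hPm : maxPrime m ≤ P :=
      maxPrime_le fun r hr hd => le_maxPrime (by omega) hr (hd.trans hmn)
    have hPW : P ≤ W := hs P hP ⟨m, hm⟩
    have hPZ : P ≤ Z / m := by
      rw [Nat.le_div_iff_mul_le (by omega)]; omega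
    have hP1 := hP.pos
    simp only [Finset.mem_sigma, Finset.mem_filter, Finset.mem_Icc, Finset.mem_Ioc, hdiv]
    refine ⟨⟨⟨by omega, (Nat.le_of_dvd (by omega) hmn).trans hnZ⟩,
      fun r hr hd => hs r hr (hd.trans hmn)⟩, ⟨?_, ?_⟩, hP⟩
    · exact max_lt (by omega) (by omega)
    · exact le_max_of_le_right (le_min hPW hPZ)
  · obtain ⟨m, p⟩ := x
    simp only [Finset.mem_sigma, Finset.mem_filter, Finset.mem_Icc, Finset.mem_Ioc, max_lt_iff,
      le_max_iff, le_min_iff] at hx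
    obtain ⟨⟨⟨hm1, hmZ⟩, hs⟩, ⟨⟨hwp, hmp⟩, hple⟩, hp⟩ := hx
    have hple' : p ≤ W ∧ p ≤ Z / m := by omega
    have := (Nat.le_div_iff_mul_le (by omega : 0 < m)).1 hple'.2
    simp only [smoothShell, Finset.mem_filter, Finset.mem_Icc]
    refine ⟨⟨Nat.mul_pos hm1 hp.pos, by rw [mul_comm]; exact this⟩, fun r hr hd => ?_,
      p, hp, dvd_mul_left _ _, hwp⟩
    rcases (Nat.Prime.dvd_mul hr).1 hd with h1 | h1
    · exact hs r hr h1
    · exact (Nat.le_of_dvd hp.pos h1).trans hple'.1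
  · simp only [smoothShell, Finset.mem_filter, Finset.mem_Icc] at hn
    obtain ⟨⟨hn1, hnZ⟩, hs, p, hp, hpn, hwp⟩ := hn
    exact Nat.div_mul_cancel (maxPrime_mem (by omega) hp hpn).2
  · obtain ⟨m, p⟩ := x
    simp only [Finset.mem_sigma, Finset.mem_filter, Finset.mem_Icc, Finset.mem_Ioc, max_lt_iff,
      le_max_iff, le_min_iff] at hx
    obtain ⟨⟨⟨hm1, hmZ⟩, hs⟩, ⟨⟨hwp, hmp⟩, hple⟩, hp⟩ := hx
    have h1 : maxPrime (m * p) = p := maxPrime_mul (by omega) hp (by omega)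
    simp only [h1, Nat.mul_div_cancel _ hp.pos]
  · simp only [smoothShell, Finset.mem_filter, Finset.mem_Icc] at hn
    obtain ⟨⟨hn1, hnZ⟩, hs, p, hp, hpn, hwp⟩ := hn
    obtain ⟨hP, hPd⟩ := maxPrime_mem (by omega) hp hpn
    have h := Nat.div_mul_cancel hPd
    set P := maxPrime n
    set m := n / P
    have h' : (n : ℂ) = m * P := by rw [← h]; push_cast; ring
    have h2 : ((n : ℕ) : ZMod q) = m * P := by rw [← h]; push_cast; ring
    have h3 : (n : ℝ) = m * P := by rw [← h]; push_cast; ring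
    simp only
    rw [h', h2, h3, map_mul, show (m * P * α : ℝ) = P * (m * α) by ring]
    simp only [div_eq_mul_inv, mul_inv]
    ring

lemma sum_smooth_inv_le (W Z : ℕ) :
    ∑ m ∈ (Finset.Icc 1 Z).filter (fun n => ∀ p, p.Prime → p ∣ n → p ≤ W), 1 / (m : ℝ) ≤
      mertensProd W := by
  let f : ℕ →* ℝ :=
    { toFun := fun n => (n : ℝ)⁻¹
      map_one' := by simp
      map_mul' := fun a b => by push_cast; rw [mul_inv] }
  have hf : ∀ {p : ℕ}, p.Prime → ‖f p‖ < 1 := fun {p} hp => by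
    have : (1 : ℝ) < p := by exact_mod_cast hp.one_lt
    simpa [f] using inv_lt_one_of_one_lt₀ this
  obtain ⟨_, h2⟩ :=
    EulerProduct.summable_and_hasSum_smoothNumbers_prod_primesBelow_geometric hf (W + 1)
  have h3 : ∏ p ∈ (W + 1).primesBelow, (1 - f p)⁻¹ = mertensProd W := by
    rw [mertensProd]
    refine Finset.prod_congr ?_ fun p _ => by simp [f]
    ext p
    simp only [Nat.mem_primesBelow, Finset.mem_filter, Finset.mem_Icc, Nat.floor_natCast]
    exact ⟨fun h => ⟨⟨h.2.pos, by omega⟩, h.2⟩, fun h => ⟨by omega, h.2⟩⟩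
  rw [h3] at h2
  set s := (Finset.Icc 1 Z).filter (fun n => ∀ p, p.Prime → p ∣ n → p ≤ W) with hs
  have hmem : ∀ m ∈ s, m ∈ (W + 1).smoothNumbers := fun m hm => by
    rw [Nat.mem_smoothNumbers']
    intro p hp hd
    have := (Finset.mem_filter.1 hm).2 p hp hd
    omega
  have h4 := sum_le_hasSum (s.attach.map
    ⟨fun m => (⟨m.1, hmem m.1 m.2⟩ : (W + 1).smoothNumbers), fun a b hab =>
      Subtype.ext (Subtype.mk.inj hab)⟩) (fun i _ => by simp [f]) h2
  rw [Finset.sum_map] at h4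
  rw [← Finset.sum_attach]
  refine le_trans (le_of_eq (Finset.sum_congr rfl fun m _ => ?_)) h4
  exact one_div _

/-- A smooth shell is controlled by the prime blocks inside it. -/
lemma norm_sum_smoothShell_le {q : ℕ} (χ : DirichletCharacter ℂ q) {w W Z : ℕ} (hwW : w ≤ W)
    {B : ℝ} (hB : ∀ a b β, w ≤ a → a ≤ W → w ≤ b → b ≤ W → ‖primeBlock χ a b β‖ ≤ B) (α : ℝ) :
    ‖∑ n ∈ smoothShell w W Z, χ (n : ZMod q) * e2pi (n * α) / n‖ ≤ mertensProd W * B := by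
  have hB0 : 0 ≤ B := (norm_nonneg _).trans (hB w w 0 le_rfl hwW le_rfl hwW)
  rw [sum_smoothShell_eq]
  refine (norm_sum_le _ _).trans ?_
  refine le_trans ?_ (mul_le_mul_of_nonneg_right (sum_smooth_inv_le W Z) hB0)
  rw [Finset.sum_mul]
  refine Finset.sum_le_sum fun m hm => ?_
  rw [norm_mul]
  simp only [Finset.mem_filter, Finset.mem_Icc] at hm
  refine mul_le_mul ?_ (hB _ _ _ (le_max_left _ _) (max_le hwW ?_) (le_max_left _ _)
    (max_le hwW (min_le_left _ _))) (norm_nonneg _) (by positivity)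
  · rw [norm_div, Complex.norm_natCast]
    gcongr
    exact DirichletCharacter.norm_le_one χ _
  · exact (Nat.sub_le _ _).trans (maxPrime_le hm.2)

lemma norm_e2pi_sub_le (x y : ℝ) : ‖e2pi x - e2pi y‖ ≤ 2 * Real.pi * |x - y| := by
  have h : e2pi x - e2pi y =
      e2pi y * (Complex.exp (Complex.I * ((2 * Real.pi * (x - y) : ℝ) : ℂ)) - 1) := by
    rw [mul_sub, mul_one, e2pi, e2pi, ← Complex.exp_add]
    congr 2
    push_cast; ring
  rw [h, norm_mul, norm_e2pi, one_mul]
  refine Real.norm_exp_I_mul_ofReal_sub_one_le.trans (le_of_eq ?_)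
  rw [Real.norm_eq_abs, abs_mul, abs_of_pos Real.two_pi_pos]

lemma e2pi_natCast_mul_fract (p : ℕ) (β : ℝ) : e2pi (p * β) = e2pi (p * Int.fract β) := by
  have h : (p * β : ℝ) = p * Int.fract β + ((p * ⌊β⌋ : ℤ) : ℝ) := by
    rw [Int.fract]; push_cast; ring
  rw [h, e2pi, e2pi]
  refine Eq.trans (congrArg Complex.exp ?_) (Complex.exp_periodic.int_mul (p * ⌊β⌋ : ℤ) _)
  push_cast; ring

lemma primeBlock_fract {q : ℕ} (χ : DirichletCharacter ℂ q) (a b : ℕ) (β : ℝ) :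
    primeBlock χ a b β = primeBlock χ a b (Int.fract β) := by
  simp only [primeBlock]
  exact Finset.sum_congr rfl fun p _ => by rw [e2pi_natCast_mul_fract]

lemma primeBlock_add {q : ℕ} (χ : DirichletCharacter ℂ q) {a b c : ℕ} (hab : a ≤ b) (hbc : b ≤ c)
    (β : ℝ) : primeBlock χ a b β + primeBlock χ b c β = primeBlock χ a c β := by
  simp only [primeBlock]
  rw [← Finset.Ioc_union_Ioc_eq_Ioc hab hbc, Finset.filter_union, Finset.sum_union]
  exact Finset.disjoint_filter_filter (Finset.Ioc_disjoint_Ioc_of_le le_rfl)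

lemma norm_primeBlock_le {q : ℕ} (χ : DirichletCharacter ℂ q) {a b w : ℕ} (hw : 0 < w)
    (hwa : w ≤ a) (hab : a ≤ b) (β : ℝ) : ‖primeBlock χ a b β‖ ≤ ((b : ℝ) - a) / w := by
  have hw' : (0 : ℝ) < w := by exact_mod_cast hw
  calc ‖primeBlock χ a b β‖
      ≤ ∑ p ∈ (Finset.Ioc a b).filter Nat.Prime, 1 / (w : ℝ) := by
        refine norm_sum_le_of_le _ fun p hp => ?_
        have hp' := Finset.mem_Ioc.1 (Finset.mem_filter.1 hp).1
        have hpw : (w : ℝ) ≤ p := by exact_mod_cast (hwa.trans hp'.1.le)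
        rw [norm_div, norm_mul, norm_e2pi, mul_one, Complex.norm_natCast]
        gcongr
        exact DirichletCharacter.norm_le_one χ _
    _ ≤ ∑ p ∈ Finset.Ioc a b, 1 / (w : ℝ) :=
        Finset.sum_le_sum_of_subset_of_nonneg (Finset.filter_subset _ _) fun _ _ _ => by positivity
    _ = _ := by
        rw [Finset.sum_const, Nat.card_Ioc, nsmul_eq_mul, Nat.cast_sub hab]; ring

lemma norm_primeBlock_sub_le {q : ℕ} (χ : DirichletCharacter ℂ q) (a b : ℕ) (β β' : ℝ) :
    ‖primeBlock χ a b β - primeBlock χ a b β'‖ ≤ 2 * Real.pi * b * |β - β'| := by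
  simp only [primeBlock]
  rw [← Finset.sum_sub_distrib]
  calc ‖∑ p ∈ (Finset.Ioc a b).filter Nat.Prime, (χ (p : ZMod q) * e2pi (p * β) / p -
          χ (p : ZMod q) * e2pi (p * β') / p)‖
      ≤ ∑ p ∈ (Finset.Ioc a b).filter Nat.Prime, 2 * Real.pi * |β - β'| := by
        refine norm_sum_le_of_le _ fun p hp => ?_
        have hp0 : (0 : ℝ) < p := by exact_mod_cast (Finset.mem_filter.1 hp).2.pos
        rw [← sub_div, ← mul_sub, norm_div, norm_mul, Complex.norm_natCast, div_le_iff₀ hp0]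
        calc ‖χ (p : ZMod q)‖ * ‖e2pi (p * β) - e2pi (p * β')‖
            ≤ 1 * (2 * Real.pi * |p * β - p * β'|) :=
              mul_le_mul (DirichletCharacter.norm_le_one χ _) (norm_e2pi_sub_le _ _)
                (norm_nonneg _) zero_le_one
          _ = _ := by rw [← mul_sub, abs_mul, abs_of_pos hp0]; ring
    _ ≤ ∑ p ∈ Finset.Ioc a b, 2 * Real.pi * |β - β'| :=
        Finset.sum_le_sum_of_subset_of_nonneg (Finset.filter_subset _ _) fun _ _ _ => by positivity
    _ ≤ _ := by
        rw [Finset.sum_const, Nat.card_Ioc, nsmul_eq_mul]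
        have : ((b - a : ℕ) : ℝ) ≤ b := by exact_mod_cast Nat.sub_le b a
        calc ((b - a : ℕ) : ℝ) * (2 * Real.pi * |β - β'|) ≤ b * (2 * Real.pi * |β - β'|) := by
              gcongr
          _ = _ := by ring

lemma sum_primeBlock_pow_le {q : ℕ} (hq : q ≠ 0) {k w W a b : ℕ} (ha : w ≤ a) (hb : b ≤ W)
    (β : ℝ) :
    ∑ χ : DirichletCharacter ℂ q, ‖primeBlock χ a b β‖ ^ (2 * k) ≤
      q.totient * (1 + (W : ℝ) ^ k / q) * (k.factorial *
        (∑ p ∈ (Finset.Ioc w W).filter Nat.Prime, 1 / (p : ℝ) ^ 2) ^ k) := by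
  have h := sum_char_pow_le hq (k := k) (W := W) (Q := (Finset.Ioc a b).filter Nat.Prime)
    (fun p hp => ⟨(Finset.mem_filter.1 hp).2,
      (Finset.mem_Ioc.1 (Finset.mem_filter.1 hp).1).2.trans hb⟩) (fun p => e2pi (p * β) / p)
  refine le_trans (le_of_eq (Finset.sum_congr rfl fun χ _ => ?_)) (h.trans ?_)
  · rw [primeBlock]
    congr 2
    exact Finset.sum_congr rfl fun p _ => by ring
  · have h1 : ∑ p ∈ (Finset.Ioc a b).filter Nat.Prime, ‖e2pi (p * β) / (p : ℂ)‖ ^ 2 ≤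
        ∑ p ∈ (Finset.Ioc w W).filter Nat.Prime, 1 / (p : ℝ) ^ 2 := by
      refine le_trans (le_of_eq (Finset.sum_congr rfl fun p _ => ?_))
        (Finset.sum_le_sum_of_subset_of_nonneg
          (Finset.filter_subset_filter _ (Finset.Ioc_subset_Ioc ha hb))
          fun _ _ _ => by positivity)
      rw [norm_div, norm_e2pi, Complex.norm_natCast, div_pow, one_pow]
    gcongr

/-- Discretising both the end points and the frequency of a prime block. -/
lemma exists_block_majorant {q : ℕ} (hq : q ≠ 0) (k : ℕ) {w W h R : ℕ} (hw : 0 < w)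
    (hh : 0 < h) (hR : 0 < R) :
    ∃ M : DirichletCharacter ℂ q → ℝ, (∀ χ, 0 ≤ M χ) ∧
      ∑ χ, M χ ^ (2 * k) ≤ (((W - w) / h + 1 : ℕ) : ℝ) ^ 2 * R *
        (q.totient * (1 + (W : ℝ) ^ k / q) * (k.factorial *
          (∑ p ∈ (Finset.Ioc w W).filter Nat.Prime, 1 / (p : ℝ) ^ 2) ^ k)) ∧
      ∀ χ a b β, w ≤ a → a ≤ W → w ≤ b → b ≤ W →
        ‖primeBlock χ a b β‖ ≤ M χ + (2 * h / w + 2 * Real.pi * W / R) := by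
  set D := (W - w) / h + 1 with hD
  set G := (Finset.range D ×ˢ Finset.range D) ×ˢ Finset.range R with hG
  have hGne : G.Nonempty :=
    ⟨((0, 0), 0), by simp [hG, hD, hR]⟩
  set t : DirichletCharacter ℂ q → (ℕ × ℕ) × ℕ → ℝ := fun χ x =>
    ‖primeBlock χ (w + x.1.1 * h) (w + x.1.2 * h) (x.2 / R)‖ with ht
  have hend : ∀ i < D, w + i * h ≤ max w W := by
    intro i hi
    have h1 : i * h ≤ W - w :=
      (Nat.mul_le_mul_right h (by omega : i ≤ (W - w) / h)).trans (Nat.div_mul_le_self _ _)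
    omega
  have hw' : (0 : ℝ) < w := by exact_mod_cast hw
  have hR' : (0 : ℝ) < R := by exact_mod_cast hR
  by_cases hwW : w ≤ W
  swap
  · refine ⟨fun _ => 0, fun _ => le_rfl, ?_, fun χ a b β h1 h2 => by omega⟩
    rcases Nat.eq_zero_or_pos k with rfl | hk
    · have hcard := sum_primeBlock_pow_le hq (k := 0) (le_refl w) (le_refl W) 0
      simp only [mul_zero, pow_zero] at hcard ⊢
      refine hcard.trans (le_mul_of_one_le_left (by positivity) ?_)
      have h1 : (1 : ℝ) ≤ D := by exact_mod_cast Nat.le_add_left 1 _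
      have h2 : (1 : ℝ) ≤ R := by exact_mod_cast hR
      nlinarith
    · rw [Finset.sum_eq_zero fun χ _ => zero_pow (by omega)]
      positivity
  refine ⟨fun χ => G.sup' hGne (t χ), fun χ => ?_, ?_, fun χ a b β ha haW hb hbW => ?_⟩
  · obtain ⟨x, hx⟩ := id hGne
    exact (norm_nonneg _).trans (Finset.le_sup' (t χ) hx)
  · calc ∑ χ, (G.sup' hGne (t χ)) ^ (2 * k) ≤ ∑ χ, ∑ x ∈ G, t χ x ^ (2 * k) := by
          refine Finset.sum_le_sum fun χ _ => ?_
          obtain ⟨x, hx, hxe⟩ := Finset.exists_mem_eq_sup' hGne (t χ)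
          rw [hxe]
          exact Finset.single_le_sum (f := fun x => t χ x ^ (2 * k))
            (fun x _ => by positivity) hx
      _ = ∑ x ∈ G, ∑ χ, t χ x ^ (2 * k) := Finset.sum_comm
      _ ≤ ∑ _x ∈ G, (q.totient * (1 + (W : ℝ) ^ k / q) * (k.factorial *
          (∑ p ∈ (Finset.Ioc w W).filter Nat.Prime, 1 / (p : ℝ) ^ 2) ^ k)) := by
          refine Finset.sum_le_sum fun x hx => ?_
          simp only [hG, Finset.mem_product, Finset.mem_range] at hx
          refine sum_primeBlock_pow_le hq (Nat.le_add_right _ _) ?_ _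
          simpa [hwW] using hend _ hx.1.2
      _ = _ := by
          rw [Finset.sum_const, nsmul_eq_mul]
          congr 1
          simp only [hG, Finset.card_product, Finset.card_range]
          push_cast; ring
  · have hsup : ∀ x ∈ G, t χ x ≤ G.sup' hGne (t χ) := fun x hx => Finset.le_sup' (t χ) hx
    set S := G.sup' hGne (t χ)
    have hS0 : 0 ≤ S := by
      obtain ⟨x, hx⟩ := id hGne
      exact (norm_nonneg _).trans (hsup x hx)
    rcases lt_or_ge b a with hba | hab
    · rw [primeBlock, Finset.Ioc_eq_empty (by omega)]
      simp only [Finset.filter_empty, Finset.sum_empty, norm_zero]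
      positivity
    set i := (a - w) / h
    set j := (b - w) / h
    have hi : i < D := Nat.lt_succ_of_le (Nat.div_le_div_right (by omega))
    have hj : j < D := Nat.lt_succ_of_le (Nat.div_le_div_right (by omega))
    have hij : i ≤ j := Nat.div_le_div_right (by omega)
    have hia : w + i * h ≤ a := by have : i * h ≤ a - w := Nat.div_mul_le_self (a - w) h; omega
    have hjb : w + j * h ≤ b := by have : j * h ≤ b - w := Nat.div_mul_le_self (b - w) h; omega
    have hia' : a ≤ w + i * h + h := by
      have : a - w < i * h + h := Nat.lt_div_mul_add hh
      omega
    have hjb' : b ≤ w + j * h + h := by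
      have : b - w < j * h + h := Nat.lt_div_mul_add hh
      omega
    have hij' : w + i * h ≤ w + j * h := by have := Nat.mul_le_mul_right h hij; omega
    set θ := Int.fract β
    have hθ0 : 0 ≤ θ := Int.fract_nonneg β
    have hθ1 : θ < 1 := Int.fract_lt_one β
    set r := ⌊R * θ⌋₊
    have hr : r < R := by
      have h1 : R * θ < (R : ℕ) := by nlinarith
      exact (Nat.floor_lt (by positivity)).2 h1
    have hr1 : (r : ℝ) ≤ R * θ := Nat.floor_le (by positivity)
    have hr2 : R * θ < r + 1 := Nat.lt_floor_add_one _
    have hθr : |θ - r / R| ≤ 1 / R := by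
      have h1 : θ - r / R = (R * θ - r) / R := by field_simp
      rw [h1, abs_of_nonneg (div_nonneg (by linarith) hR'.le)]
      gcongr
      linarith
    have hgrid := hsup ((i, j), r) (by simp [hG, hi, hj, hr])
    simp only [ht] at hgrid
    have e1 := primeBlock_add χ hij' hjb θ
    have e2 := primeBlock_add χ hia hab θ
    have e3 : primeBlock χ a b β = primeBlock χ (w + i * h) (w + j * h) (r / R) +
        (primeBlock χ (w + i * h) (w + j * h) θ - primeBlock χ (w + i * h) (w + j * h) (r / R)) +
        primeBlock χ (w + j * h) b θ - primeBlock χ (w + i * h) a θ := by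
      rw [primeBlock_fract]
      linear_combination e2 - e1
    have n1 := norm_primeBlock_sub_le χ (w + i * h) (w + j * h) θ (r / R)
    have n2 := norm_primeBlock_le χ hw (Nat.le_add_right w (j * h)) hjb θ
    have n3 := norm_primeBlock_le χ hw (Nat.le_add_right w (i * h)) hia θ
    have n1' : 2 * Real.pi * ((w + j * h : ℕ) : ℝ) * |θ - r / R| ≤ 2 * Real.pi * W / R := by
      have hW : ((w + j * h : ℕ) : ℝ) ≤ W := by exact_mod_cast hjb.trans hbW
      calc 2 * Real.pi * ((w + j * h : ℕ) : ℝ) * |θ - r / R|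
          ≤ 2 * Real.pi * W * (1 / R) := by gcongr
        _ = _ := by ring
    have n2' : ((b : ℝ) - (w + j * h : ℕ)) / w ≤ h / w := by
      have : (b : ℝ) ≤ (w + j * h : ℕ) + h := by exact_mod_cast hjb'
      gcongr; linarith
    have n3' : ((a : ℝ) - (w + i * h : ℕ)) / w ≤ h / w := by
      have : (a : ℝ) ≤ (w + i * h : ℕ) + h := by exact_mod_cast hia'
      gcongr; linarith
    rw [e3]
    refine (norm_sub_le _ _).trans ?_
    have t1 := norm_add_le (primeBlock χ (w + i * h) (w + j * h) (r / R) +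
        (primeBlock χ (w + i * h) (w + j * h) θ - primeBlock χ (w + i * h) (w + j * h) (r / R)))
        (primeBlock χ (w + j * h) b θ)
    have t2 := norm_add_le (primeBlock χ (w + i * h) (w + j * h) (r / R))
      (primeBlock χ (w + i * h) (w + j * h) θ - primeBlock χ (w + i * h) (w + j * h) (r / R))
    have : 2 * (h : ℝ) / w = h / w + h / w := by ring
    linarith

lemma sum_pow_eq_rpow {ι : Type*} (s : Finset ι) (f : ι → ℝ) (hf : ∀ i, 0 ≤ f i) (k : ℕ) :
    ∑ i ∈ s, f i ^ (2 * k) = ∑ i ∈ s, |f i| ^ ((2 * k : ℕ) : ℝ) :=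
  Finset.sum_congr rfl fun i _ => by rw [Real.rpow_natCast, abs_of_nonneg (hf i)]

/-- Minkowski's inequality, phrased for bounds on moments. -/
lemma moment_add_le {ι : Type*} (s : Finset ι) {f g : ι → ℝ} (hf : ∀ i, 0 ≤ f i)
    (hg : ∀ i, 0 ≤ g i) {k : ℕ} (hk : 1 ≤ k) {c X Y : ℝ} (hc : 0 ≤ c) (hX : 0 ≤ X) (hY : 0 ≤ Y)
    (hfX : ∑ i ∈ s, f i ^ (2 * k) ≤ c * X ^ (2 * k))
    (hgY : ∑ i ∈ s, g i ^ (2 * k) ≤ c * Y ^ (2 * k)) :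
    ∑ i ∈ s, (f i + g i) ^ (2 * k) ≤ c * (X + Y) ^ (2 * k) := by
  have hp1 : (1 : ℝ) ≤ ((2 * k : ℕ) : ℝ) := by exact_mod_cast (by omega : 1 ≤ 2 * k)
  have hp0 : ((2 * k : ℕ) : ℝ) ≠ 0 := by linarith
  have hroot : ∀ {u : ι → ℝ} {U : ℝ}, (∀ i, 0 ≤ u i) → 0 ≤ U →
      ∑ i ∈ s, u i ^ (2 * k) ≤ c * U ^ (2 * k) →
      (∑ i ∈ s, |u i| ^ ((2 * k : ℕ) : ℝ)) ^ (1 / ((2 * k : ℕ) : ℝ)) ≤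
        c ^ (1 / ((2 * k : ℕ) : ℝ)) * U := by
    intro u U hu hU h
    rw [← sum_pow_eq_rpow s u hu]
    calc (∑ i ∈ s, u i ^ (2 * k)) ^ (1 / ((2 * k : ℕ) : ℝ))
        ≤ (c * U ^ (2 * k)) ^ (1 / ((2 * k : ℕ) : ℝ)) :=
          Real.rpow_le_rpow (Finset.sum_nonneg fun i _ => pow_nonneg (hu i) _) h (by positivity)
      _ = _ := by
          rw [Real.mul_rpow hc (by positivity), ← Real.rpow_natCast U, ← Real.rpow_mul hU,
            mul_one_div_cancel hp0, Real.rpow_one]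
  have h1 := Real.Lp_add_le s f g hp1
  have h2 := h1.trans (add_le_add (hroot hf hX hfX) (hroot hg hY hgY))
  have hfg : ∀ i, 0 ≤ f i + g i := fun i => add_nonneg (hf i) (hg i)
  rw [← sum_pow_eq_rpow s _ hfg, ← mul_add] at h2
  have h3 : 0 ≤ ∑ i ∈ s, (f i + g i) ^ (2 * k) :=
    Finset.sum_nonneg fun i _ => pow_nonneg (hfg i) _
  have h4 := Real.rpow_le_rpow (by positivity) h2 (by linarith : 0 ≤ ((2 * k : ℕ) : ℝ))
  rw [← Real.rpow_mul h3, one_div_mul_cancel hp0, Real.rpow_one,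
    Real.mul_rpow (by positivity) (by positivity), ← Real.rpow_mul hc, one_div_mul_cancel hp0,
    Real.rpow_one, Real.rpow_natCast] at h4
  exact h4

/-- The exponential sums over a smooth shell have normalised `2 * k`-th moment norm at most `X`. -/
def ShellBound (q k w W Z : ℕ) (X : ℝ) : Prop :=
  0 ≤ X ∧ ∃ N : DirichletCharacter ℂ q → ℝ, (∀ χ, 0 ≤ N χ) ∧
    ∑ χ, N χ ^ (2 * k) ≤ q.totient * X ^ (2 * k) ∧
    ∀ χ α, ‖∑ n ∈ smoothShell w W Z, χ (n : ZMod q) * e2pi (n * α) / n‖ ≤ N χ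

lemma ShellBound.mono {q k w W Z : ℕ} {X Y : ℝ} (h : ShellBound q k w W Z X) (hXY : X ≤ Y) :
    ShellBound q k w W Z Y := by
  obtain ⟨hX, N, h0, h1, h2⟩ := h
  exact ⟨hX.trans hXY, N, h0, h1.trans (by gcongr), h2⟩

lemma smoothShell_union {w W W' : ℕ} (h : w ≤ W) (h' : W ≤ W') (Z : ℕ) :
    smoothShell w W Z ∪ smoothShell W W' Z = smoothShell w W' Z := by
  ext n
  simp only [smoothShell, Finset.mem_union, Finset.mem_filter]
  constructor
  · rintro (⟨hn, h1, p, hp, hd, hw⟩ | ⟨hn, h1, p, hp, hd, hw⟩)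
    · exact ⟨hn, fun r hr hrd => (h1 r hr hrd).trans h', p, hp, hd, hw⟩
    · exact ⟨hn, h1, p, hp, hd, by omega⟩
  · rintro ⟨hn, h1, p, hp, hd, hw⟩
    by_cases hs : ∀ r, r.Prime → r ∣ n → r ≤ W
    · exact Or.inl ⟨hn, hs, p, hp, hd, hw⟩
    · push Not at hs
      exact Or.inr ⟨hn, h1, hs⟩

lemma smoothShell_disjoint (w W W' Z : ℕ) :
    Disjoint (smoothShell w W Z) (smoothShell W W' Z) := by
  rw [Finset.disjoint_left]
  intro n h1 h2
  obtain ⟨p, hp, hd, hw⟩ := (Finset.mem_filter.1 h2).2.2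
  exact absurd ((Finset.mem_filter.1 h1).2.1 p hp hd) (by omega)

lemma ShellBound.trans {q k w W W' Z : ℕ} {X Y : ℝ} (hk : 1 ≤ k) (hw : w ≤ W) (hW : W ≤ W')
    (h : ShellBound q k w W Z X) (h' : ShellBound q k W W' Z Y) :
    ShellBound q k w W' Z (X + Y) := by
  obtain ⟨hX, N, h0, h1, h2⟩ := h
  obtain ⟨hY, N', h0', h1', h2'⟩ := h'
  refine ⟨add_nonneg hX hY, fun χ => N χ + N' χ, fun χ => add_nonneg (h0 χ) (h0' χ),
    moment_add_le _ h0 h0' hk (by positivity) hX hY h1 h1', fun χ α => ?_⟩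
  rw [← smoothShell_union hw hW, Finset.sum_union (smoothShell_disjoint _ _ _ _)]
  exact (norm_add_le _ _).trans (add_le_add (h2 χ α) (h2' χ α))

lemma ShellBound.refl (q w Z : ℕ) {k : ℕ} (hk : 1 ≤ k) : ShellBound q k w w Z 0 := by
  refine ⟨le_rfl, fun _ => 0, fun _ => le_rfl, ?_, fun χ α => ?_⟩
  · simp [show k ≠ 0 by omega]
  · have : smoothShell w w Z = ∅ := by
      refine Finset.filter_eq_empty_iff.2 ?_
      rintro n - ⟨h1, p, hp, hd, hw⟩
      exact absurd (h1 p hp hd) (by omega)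
    simp [this]

lemma ShellBound.sum {q k Z : ℕ} (hk : 1 ≤ k) {w : ℕ → ℕ} (hw : Monotone w) {X : ℕ → ℝ} (J : ℕ)
    (h : ∀ j < J, ShellBound q k (w j) (w (j + 1)) Z (X j)) :
    ShellBound q k (w 0) (w J) Z (∑ j ∈ Finset.range J, X j) := by
  induction J with
  | zero => simpa using ShellBound.refl q (w 0) Z hk
  | succ J ih =>
    rw [Finset.sum_range_succ]
    exact (ih fun j hj => h j (by omega)).trans hk (hw (Nat.zero_le J)) (hw (Nat.le_succ J))
      (h J (Nat.lt_succ_self J))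

lemma mertensProd_nonneg (Y : ℝ) : 0 ≤ mertensProd Y := by
  refine Finset.prod_nonneg fun p hp => inv_nonneg.2 ?_
  have : (1 : ℝ) ≤ p := by exact_mod_cast (Finset.mem_filter.1 hp).2.one_le
  rw [sub_nonneg, div_le_one (by linarith)]
  exact this

lemma card_dirichletCharacter {q : ℕ} (hq : q ≠ 0) :
    (Fintype.card (DirichletCharacter ℂ q) : ℝ) = q.totient := by
  have : NeZero q := ⟨hq⟩
  rw [← Nat.card_eq_fintype_card, DirichletCharacter.card_eq_totient_of_hasEnoughRootsOfUnity]

/-- The moment bound for a single shell. -/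
lemma shellBound_of_block {q : ℕ} (hq : q ≠ 0) {k w W h R : ℕ} (Z : ℕ) (hk : 1 ≤ k) (hw : 0 < w)
    (hwW : w ≤ W) (hh : 0 < h) (hR : 0 < R) {X : ℝ} (hX : 0 ≤ X)
    (hbound : (((W - w) / h + 1 : ℕ) : ℝ) ^ 2 * R * ((1 + (W : ℝ) ^ k / q) * (k.factorial *
      (∑ p ∈ (Finset.Ioc w W).filter Nat.Prime, 1 / (p : ℝ) ^ 2) ^ k)) ≤ X ^ (2 * k)) :
    ShellBound q k w W Z (mertensProd W * (X + (2 * h / w + 2 * Real.pi * W / R))) := by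
  obtain ⟨M, hM0, hM, hT⟩ := exists_block_majorant hq k (W := W) hw hh hR
  set E : ℝ := 2 * h / w + 2 * Real.pi * W / R with hE
  have hE0 : 0 ≤ E := by positivity
  have hV := mertensProd_nonneg W
  have h1 : ∑ χ, M χ ^ (2 * k) ≤ q.totient * X ^ (2 * k) := by
    refine hM.trans (le_trans (le_of_eq ?_)
      (mul_le_mul_of_nonneg_left hbound (by positivity : (0 : ℝ) ≤ q.totient)))
    ring
  have h2 : ∑ _χ : DirichletCharacter ℂ q, E ^ (2 * k) ≤ q.totient * E ^ (2 * k) := by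
    rw [Finset.sum_const, nsmul_eq_mul, Finset.card_univ, card_dirichletCharacter hq]
  have h3 := moment_add_le Finset.univ hM0 (fun _ => hE0) hk (Nat.cast_nonneg _) hX hE0 h1 h2
  refine ⟨by positivity, fun χ => mertensProd W * (M χ + E),
    fun χ => mul_nonneg hV (add_nonneg (hM0 χ) hE0), ?_, fun χ α => ?_⟩
  · simp_rw [mul_pow]
    rw [← Finset.mul_sum]
    calc mertensProd W ^ (2 * k) * ∑ χ, (M χ + E) ^ (2 * k)
        ≤ mertensProd W ^ (2 * k) * (q.totient * (X + E) ^ (2 * k)) := by gcongr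
      _ = _ := by ring
  · exact norm_sum_smoothShell_le χ hwW (fun a b β => hT χ a b β) α

lemma sum_Syz_pow_le {q k : ℕ} {y z : ℝ} (hy : 0 ≤ y) {W : ℕ} (hW : ⌊z⌋₊ ≤ W) {X : ℝ}
    (h : ShellBound q k ⌊y⌋₊ W ⌊z⌋₊ X) :
    ∑ χ : DirichletCharacter ℂ q, Syz χ y z ^ (2 * k) ≤ q.totient * X ^ (2 * k) := by
  obtain ⟨hX, N, h0, h1, h2⟩ := h
  refine le_trans (Finset.sum_le_sum fun χ _ => ?_) h1
  have hset : (Finset.Icc 1 ⌊z⌋₊).filter (fun n => ∃ p : ℕ, p.Prime ∧ p ∣ n ∧ y < (p : ℝ)) =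
      smoothShell ⌊y⌋₊ W ⌊z⌋₊ := by
    refine Finset.filter_congr fun n hn => ?_
    rw [Finset.mem_Icc] at hn
    simp_rw [Nat.floor_lt hy]
    exact ⟨fun hp => ⟨fun p _ hd => (Nat.le_of_dvd (by omega) hd).trans (by omega), hp⟩,
      fun hp => hp.2⟩
  have hne : Nonempty (Set.Icc (0 : ℝ) 1) := ⟨⟨0, by simp⟩⟩
  have h3 : Syz χ y z ≤ N χ := by
    rw [Syz, SA, hset]
    exact ciSup_le fun α => h2 χ α
  have h4 : 0 ≤ Syz χ y z := Real.iSup_nonneg fun α => norm_nonneg _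
  gcongr

lemma mertensProd_two_mul_le : ∃ C > 0, ∀ w : ℕ, 2 ≤ w →
    mertensProd ((2 * w : ℕ) : ℝ) ≤ C * Real.log w := by
  obtain ⟨C, hC, h⟩ := mertensProd_le
  refine ⟨Real.exp Real.eulerMascheroniConstant * 2 * Real.exp (C / Real.log 2), by positivity,
    fun w hw => ?_⟩
  have hw' : (2 : ℝ) ≤ w := by exact_mod_cast hw
  have h2 : (2 : ℝ) ≤ ((2 * w : ℕ) : ℝ) := by push_cast; linarith
  refine (h _ h2).trans ?_
  have hl2 : 0 < Real.log 2 := Real.log_pos (by norm_num)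
  have hlw : Real.log 2 ≤ Real.log w := Real.log_le_log (by norm_num) hw'
  have h3 : Real.log ((2 * w : ℕ) : ℝ) ≤ 2 * Real.log w := by
    push_cast
    rw [Real.log_mul (by norm_num) (by positivity)]
    linarith
  have h4 : Real.log 2 ≤ Real.log ((2 * w : ℕ) : ℝ) := Real.log_le_log (by norm_num) h2
  calc Real.exp Real.eulerMascheroniConstant * Real.log ((2 * w : ℕ) : ℝ) *
        Real.exp (C / Real.log ((2 * w : ℕ) : ℝ))
      ≤ Real.exp Real.eulerMascheroniConstant * (2 * Real.log w) *
        Real.exp (C / Real.log 2) := by gcongr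
    _ = _ := by ring

lemma exp_mul_natCast (a : ℝ) (n : ℕ) : Real.exp a ^ n = Real.exp (a * n) := by
  rw [mul_comm, Real.exp_nat_mul]

lemma rpow_mul_pow_le {k : ℕ} (hk : 3 ≤ k) {w : ℝ} (hw : 2 ≤ w) :
    8 * w ^ ((11 : ℝ) / 8) * (k / w) ^ k ≤
      (Real.exp 6 * (Real.sqrt (k / w) + w ^ (-(1 : ℝ) / 8))) ^ (2 * k) := by
  have hw0 : 0 < w := by linarith
  have hk' : (3 : ℝ) ≤ k := by exact_mod_cast hk
  have hs : 0 ≤ Real.sqrt (k / w) := Real.sqrt_nonneg _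
  have ht : 0 ≤ w ^ (-(1 : ℝ) / 8) := Real.rpow_nonneg hw0.le _
  have he8 : (8 : ℝ) ≤ Real.exp 3 := by
    have h1 : (2 : ℝ) ≤ Real.exp 1 := by linarith [Real.add_one_le_exp 1]
    calc (8 : ℝ) = 2 ^ 3 := by norm_num
      _ ≤ Real.exp 1 ^ 3 := by gcongr
      _ = Real.exp 3 := by rw [exp_mul_natCast]; norm_num
  have he8k : (8 : ℝ) ≤ Real.exp (3 * k) := he8.trans (Real.exp_le_exp.2 (by linarith))
  rcases le_or_gt (k : ℝ) (w ^ ((1 : ℝ) / 6)) with hkw | hkw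
  · have h1 : (k : ℝ) / w ≤ w ^ (-(5 : ℝ) / 6) := by
      rw [div_le_iff₀ hw0]
      refine hkw.trans (le_of_eq ?_)
      rw [← Real.rpow_add_one hw0.ne']; norm_num
    calc 8 * w ^ ((11 : ℝ) / 8) * (k / w) ^ k
        ≤ Real.exp (3 * k) * w ^ ((11 : ℝ) / 8) * (w ^ (-(5 : ℝ) / 6)) ^ k := by gcongr
      _ = Real.exp (3 * k) * w ^ ((11 : ℝ) / 8 + (-(5 : ℝ) / 6) * k) := by
          rw [← Real.rpow_natCast (w ^ (-(5 : ℝ) / 6)), ← Real.rpow_mul hw0.le, mul_assoc,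
            ← Real.rpow_add hw0]
      _ ≤ Real.exp (12 * k) * w ^ ((-(1 : ℝ) / 8) * (2 * k : ℕ)) := by
          refine mul_le_mul (Real.exp_le_exp.2 (by linarith))
            (Real.rpow_le_rpow_of_exponent_le (by linarith) ?_) (by positivity) (by positivity)
          push_cast; linarith
      _ = (Real.exp 6 * w ^ (-(1 : ℝ) / 8)) ^ (2 * k) := by
          rw [mul_pow, exp_mul_natCast, ← Real.rpow_natCast (w ^ (-(1 : ℝ) / 8)),
            ← Real.rpow_mul hw0.le]
          push_cast; ring_nf
      _ ≤ _ := by gcongr; linarith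
  · have h1 : Real.log w ≤ 6 * k := by
      have := Real.log_le_rpow_div hw0.le (by norm_num : (0 : ℝ) < 1 / 6)
      linarith
    have h2 : w ^ ((11 : ℝ) / 8) ≤ Real.exp (9 * k) := by
      rw [Real.rpow_def_of_pos hw0]
      exact Real.exp_le_exp.2 (by linarith)
    calc 8 * w ^ ((11 : ℝ) / 8) * (k / w) ^ k
        ≤ Real.exp (3 * k) * Real.exp (9 * k) * (k / w) ^ k := by gcongr
      _ = (Real.exp 6 * Real.sqrt (k / w)) ^ (2 * k) := by
          rw [mul_pow, exp_mul_natCast, pow_mul (Real.sqrt _), Real.sq_sqrt (by positivity),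
            ← Real.exp_add]
          push_cast; ring_nf
      _ ≤ _ := by gcongr; linarith

/-- The moment bound for a dyadic shell. -/
lemma exists_shellBound_dyadic : ∃ C > 0, ∀ q k w Z : ℕ, q ≠ 0 → 3 ≤ k → 2 ≤ w →
    ShellBound q k w (2 * w) Z (C * Real.log w * (Real.sqrt (k / w) + (w : ℝ) ^ (-(1 : ℝ) / 8) +
      Real.sqrt k * ((w : ℝ) ^ ((11 : ℝ) / 8) / q) ^ (1 / (2 * k : ℝ)))) := by
  obtain ⟨C, hC, hV⟩ := mertensProd_two_mul_le
  refine ⟨C * (Real.exp 6 + 20), by positivity, fun q k w Z hq hk hw => ?_⟩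
  have hw2 : (2 : ℝ) ≤ w := by exact_mod_cast hw
  have hw0 : (0 : ℝ) < w := by linarith
  have hq0 : (0 : ℝ) < q := by exact_mod_cast Nat.pos_of_ne_zero hq
  have hk' : (3 : ℝ) ≤ k := by exact_mod_cast hk
  have hpow1 : ∀ a : ℝ, 0 ≤ a → 1 ≤ (w : ℝ) ^ a := fun a ha =>
    Real.one_le_rpow (by linarith) ha
  have hceil : ∀ x : ℝ, 1 ≤ x → (⌈x⌉₊ : ℝ) ≤ 2 * x := fun x hx => by
    linarith [Nat.ceil_lt_add_one (show 0 ≤ x by linarith)]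
  set h := ⌈(w : ℝ) ^ ((7 : ℝ) / 8)⌉₊ with hh
  set R := ⌈(w : ℝ) ^ ((9 : ℝ) / 8)⌉₊ with hR
  have hh1 : (w : ℝ) ^ ((7 : ℝ) / 8) ≤ h := Nat.le_ceil _
  have hh2 : (h : ℝ) ≤ 2 * (w : ℝ) ^ ((7 : ℝ) / 8) := hceil _ (hpow1 _ (by norm_num))
  have hR1 : (w : ℝ) ^ ((9 : ℝ) / 8) ≤ R := Nat.le_ceil _
  have hR2 : (R : ℝ) ≤ 2 * (w : ℝ) ^ ((9 : ℝ) / 8) := hceil _ (hpow1 _ (by norm_num))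
  have hp7 : 0 < (w : ℝ) ^ ((7 : ℝ) / 8) := by positivity
  have hp9 : 0 < (w : ℝ) ^ ((9 : ℝ) / 8) := by positivity
  have hhpos : 0 < h := Nat.ceil_pos.2 hp7
  have hRpos : 0 < R := Nat.ceil_pos.2 hp9
  have hh0 : (0 : ℝ) < h := by exact_mod_cast hhpos
  have hD : (((2 * w - w) / h + 1 : ℕ) : ℝ) ≤ 2 * (w : ℝ) ^ ((1 : ℝ) / 8) := by
    have h1 : (((2 * w - w) / h : ℕ) : ℝ) ≤ (w : ℝ) / h := by
      rw [show 2 * w - w = w by omega]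
      exact Nat.cast_div_le
    have h2 : (w : ℝ) / h ≤ (w : ℝ) ^ ((1 : ℝ) / 8) := by
      rw [div_le_iff₀ hh0]
      calc (w : ℝ) = (w : ℝ) ^ ((1 : ℝ) / 8) * (w : ℝ) ^ ((7 : ℝ) / 8) := by
            rw [← Real.rpow_add hw0]; norm_num
        _ ≤ _ := by gcongr
    have h3 := hpow1 (1 / 8) (by norm_num)
    push_cast
    linarith
  have hDR : (((2 * w - w) / h + 1 : ℕ) : ℝ) ^ 2 * R ≤ 8 * (w : ℝ) ^ ((11 : ℝ) / 8) := by
    calc (((2 * w - w) / h + 1 : ℕ) : ℝ) ^ 2 * R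
        ≤ (2 * (w : ℝ) ^ ((1 : ℝ) / 8)) ^ 2 * (2 * (w : ℝ) ^ ((9 : ℝ) / 8)) := by gcongr
      _ = 8 * ((w : ℝ) ^ ((1 : ℝ) / 8) * (w : ℝ) ^ ((1 : ℝ) / 8) * (w : ℝ) ^ ((9 : ℝ) / 8)) := by
          ring
      _ = _ := by rw [← Real.rpow_add hw0, ← Real.rpow_add hw0]; norm_num
  have hS : ∑ p ∈ (Finset.Ioc w (2 * w)).filter Nat.Prime, 1 / (p : ℝ) ^ 2 ≤ 1 / (w : ℝ) :=
    (Finset.sum_le_sum_of_subset_of_nonneg (Finset.filter_subset _ _)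
      fun _ _ _ => by positivity).trans (sum_Ioc_inv_sq_le (show 0 < w by omega) _)
  have hfac : (k.factorial : ℝ) ≤ (k : ℝ) ^ k := by exact_mod_cast Nat.factorial_le_pow k
  set X1 := Real.exp 6 * (Real.sqrt (k / w) + (w : ℝ) ^ (-(1 : ℝ) / 8)) with hX1
  set X2 := Real.exp 6 *
    (Real.sqrt k * ((w : ℝ) ^ ((11 : ℝ) / 8) / q) ^ (1 / (2 * k : ℝ))) with hX2
  have hX10 : 0 ≤ X1 := by positivity
  have hX20 : 0 ≤ X2 := by positivity
  have he : (8 : ℝ) * 2 ^ k ≤ Real.exp 6 ^ (2 * k) := by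
    have h1 : (2 : ℝ) ≤ Real.exp 6 := by linarith [Real.add_one_le_exp 6]
    calc (8 : ℝ) * 2 ^ k = 2 ^ (3 + k) := by rw [pow_add]; norm_num
      _ ≤ 2 ^ (2 * k) := pow_le_pow_right₀ (by norm_num) (by omega)
      _ ≤ _ := by gcongr
  have hX2k : X2 ^ (2 * k) =
      Real.exp 6 ^ (2 * k) * ((k : ℝ) ^ k * ((w : ℝ) ^ ((11 : ℝ) / 8) / q)) := by
    rw [hX2, mul_pow, mul_pow, pow_mul (Real.sqrt _), Real.sq_sqrt (by positivity),
      ← Real.rpow_natCast (_ ^ (1 / (2 * k : ℝ))), ← Real.rpow_mul (by positivity)]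
    have : 1 / (2 * k : ℝ) * ((2 * k : ℕ) : ℝ) = 1 := by
      push_cast; field_simp
    rw [this, Real.rpow_one]
  have hmain : (((2 * w - w) / h + 1 : ℕ) : ℝ) ^ 2 * R * ((1 + ((2 * w : ℕ) : ℝ) ^ k / q) *
      (k.factorial * (∑ p ∈ (Finset.Ioc w (2 * w)).filter Nat.Prime, 1 / (p : ℝ) ^ 2) ^ k)) ≤
      (X1 + X2) ^ (2 * k) := by
    calc _ ≤ 8 * (w : ℝ) ^ ((11 : ℝ) / 8) * ((1 + ((2 * w : ℕ) : ℝ) ^ k / q) *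
          ((k : ℝ) ^ k * (1 / w) ^ k)) := by gcongr
      _ = 8 * (w : ℝ) ^ ((11 : ℝ) / 8) * (k / w) ^ k +
          8 * 2 ^ k * ((k : ℝ) ^ k * ((w : ℝ) ^ ((11 : ℝ) / 8) / q)) := by
          push_cast
          simp only [div_pow, mul_pow, one_pow]
          field_simp
      _ ≤ X1 ^ (2 * k) + X2 ^ (2 * k) := by
          rw [hX2k]
          exact add_le_add (rpow_mul_pow_le hk hw2) (by gcongr)
      _ ≤ _ := pow_add_pow_le hX10 hX20 (by omega)
  refine (shellBound_of_block hq Z (by omega) (by omega) (by omega) hhpos hRpos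
    (add_nonneg hX10 hX20) hmain).mono ?_
  have herr : 2 * (h : ℝ) / w + 2 * Real.pi * ((2 * w : ℕ) : ℝ) / R ≤
      20 * (w : ℝ) ^ (-(1 : ℝ) / 8) := by
    have h1 : 2 * (h : ℝ) / w ≤ 4 * (w : ℝ) ^ (-(1 : ℝ) / 8) := by
      rw [div_le_iff₀ hw0, mul_assoc, ← Real.rpow_add_one hw0.ne']
      norm_num at hh2 ⊢
      linarith
    have h2 : 2 * Real.pi * ((2 * w : ℕ) : ℝ) / R ≤ 16 * (w : ℝ) ^ (-(1 : ℝ) / 8) := by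
      rw [div_le_iff₀ (by exact_mod_cast hRpos)]
      push_cast
      calc 2 * Real.pi * (2 * (w : ℝ)) ≤ 16 * w := by nlinarith [Real.pi_le_four]
        _ = 16 * (w : ℝ) ^ (-(1 : ℝ) / 8) * (w : ℝ) ^ ((9 : ℝ) / 8) := by
          rw [mul_assoc, ← Real.rpow_add hw0]; norm_num
        _ ≤ _ := by gcongr
    linarith
  have hlog : 0 ≤ Real.log w := Real.log_nonneg (by linarith)
  have hsq : 0 ≤ Real.sqrt ((k : ℝ) / w) := Real.sqrt_nonneg _
  have h8 : 0 ≤ (w : ℝ) ^ (-(1 : ℝ) / 8) := by positivity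
  have hX2' : 0 ≤ Real.sqrt k * ((w : ℝ) ^ ((11 : ℝ) / 8) / q) ^ (1 / (2 * k : ℝ)) := by positivity
  calc mertensProd ((2 * w : ℕ) : ℝ) *
        (X1 + X2 + (2 * (h : ℝ) / w + 2 * Real.pi * ((2 * w : ℕ) : ℝ) / R))
      ≤ (C * Real.log w) * (X1 + X2 + 20 * (w : ℝ) ^ (-(1 : ℝ) / 8)) := by
        gcongr
        exact hV w hw
    _ ≤ (C * Real.log w) * ((Real.exp 6 + 20) * (Real.sqrt (k / w) + (w : ℝ) ^ (-(1 : ℝ) / 8) +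
          Real.sqrt k * ((w : ℝ) ^ ((11 : ℝ) / 8) / q) ^ (1 / (2 * k : ℝ)))) := by
        gcongr
        rw [hX1, hX2]
        linarith
    _ = _ := by ring

lemma sum_succ_mul_pow_le : ∃ S > 0, ∀ J : ℕ,
    ∑ j ∈ Finset.range J, ((j : ℝ) + 1) * ((2 : ℝ) ^ (-(1 : ℝ) / 8)) ^ j ≤ S := by
  set ρ : ℝ := (2 : ℝ) ^ (-(1 : ℝ) / 8) with hρ
  have hρ0 : 0 < ρ := by positivity
  have hρ1 : ρ < 1 := Real.rpow_lt_one_of_one_lt_of_neg (by norm_num) (by norm_num)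
  have hn : ‖ρ‖ < 1 := by rwa [Real.norm_of_nonneg hρ0.le]
  have h1 : Summable fun j : ℕ => ((j : ℝ) + 1) * ρ ^ j := by
    have h2 := (summable_pow_mul_geometric_of_norm_lt_one 1 hn).add
      (summable_geometric_of_norm_lt_one hn)
    refine h2.congr fun j => ?_
    ring
  refine ⟨∑' j : ℕ, ((j : ℝ) + 1) * ρ ^ j, h1.tsum_pos (fun j => by positivity) 0 (by simp), ?_⟩
  exact fun J => h1.sum_le_tsum _ fun j _ => by positivity

/-- The contribution of the integers with large prime factors that comes from the size of `q`. -/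
lemma sqrt_mul_rpow_le {q k : ℕ} (hk : 3 ≤ k) (hL : 1 ≤ Real.log (Real.log q))
    (hkq : (k : ℝ) ≤ Real.log q / (400 * Real.log (Real.log q))) {w : ℝ} (hw0 : 0 < w)
    (hw : w ≤ (q : ℝ) ^ ((11 : ℝ) / 21)) :
    Real.sqrt k * (w ^ ((11 : ℝ) / 8) / q) ^ (1 / (2 * k : ℝ)) ≤ (Real.log q ^ 54)⁻¹ := by
  set L := Real.log q with hLdef
  have hk' : (3 : ℝ) ≤ k := by exact_mod_cast hk
  have hL0 : 0 < L := by
    by_contra h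
    have h0 : 0 ≤ L := Real.log_natCast_nonneg q
    have : L = 0 := le_antisymm (not_lt.1 h) h0
    rw [this, Real.log_zero] at hL
    norm_num at hL
  have hL1 : 1 ≤ L := by
    have := (Real.le_log_iff_exp_le hL0).1 hL
    linarith [Real.add_one_le_exp 1]
  have hq0 : (0 : ℝ) < q := by
    rcases Nat.eq_zero_or_pos q with rfl | h
    · simp [hLdef] at hL0
    · exact_mod_cast h
  have hkq' : k * (400 * Real.log L) ≤ L := (le_div_iff₀ (by linarith)).1 hkq
  have hkL : (k : ℝ) ≤ L := by nlinarith
  have h1 : w ^ ((11 : ℝ) / 8) / q ≤ (q : ℝ) ^ (-(47 : ℝ) / 168) := by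
    rw [div_le_iff₀ hq0, ← Real.rpow_add_one hq0.ne']
    calc w ^ ((11 : ℝ) / 8) ≤ ((q : ℝ) ^ ((11 : ℝ) / 21)) ^ ((11 : ℝ) / 8) := by gcongr
      _ = _ := by rw [← Real.rpow_mul hq0.le]; norm_num
  have h2 : (w ^ ((11 : ℝ) / 8) / q) ^ (1 / (2 * k : ℝ)) ≤ (L ^ 55)⁻¹ := by
    calc (w ^ ((11 : ℝ) / 8) / q) ^ (1 / (2 * k : ℝ))
        ≤ ((q : ℝ) ^ (-(47 : ℝ) / 168)) ^ (1 / (2 * k : ℝ)) := by gcongr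
      _ = Real.exp (-(L * (47 / 168) / (2 * k))) := by
          rw [← Real.rpow_mul hq0.le, Real.rpow_def_of_pos hq0, ← hLdef]
          congr 1; ring
      _ ≤ Real.exp (-(55 * Real.log L)) := by
          refine Real.exp_le_exp.2 (neg_le_neg ?_)
          rw [le_div_iff₀ (by linarith)]
          nlinarith
      _ = (L ^ 55)⁻¹ := by
          rw [Real.exp_neg, show (55 : ℝ) * Real.log L = ((55 : ℕ) : ℝ) * Real.log L by norm_num,
            Real.exp_nat_mul, Real.exp_log hL0]
  have h3 : Real.sqrt k ≤ L := by
    rw [Real.sqrt_le_iff]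
    exact ⟨hL0.le, by nlinarith⟩
  calc Real.sqrt k * (w ^ ((11 : ℝ) / 8) / q) ^ (1 / (2 * k : ℝ)) ≤ L * (L ^ 55)⁻¹ := by gcongr
    _ = _ := by rw [pow_succ L 54]; field_simp

/-- The moment bound for all integers with a prime factor exceeding `w`. -/
lemma exists_shellBound_tail : ∃ C > 0, ∀ q k w Z : ℕ, 3 ≤ k → 1 ≤ Real.log (Real.log q) →
    (k : ℝ) ≤ Real.log q / (400 * Real.log (Real.log q)) → (Z : ℝ) ≤ (q : ℝ) ^ ((11 : ℝ) / 21) →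
    2 ≤ w → ∃ W, Z ≤ W ∧ w ≤ W ∧ ShellBound q k w W Z
      (C * (Real.log w * (Real.sqrt (k / w) + (w : ℝ) ^ (-(1 : ℝ) / 8)) +
        (Real.log q ^ 50)⁻¹)) := by
  obtain ⟨C, hC, hdy⟩ := exists_shellBound_dyadic
  obtain ⟨S, hS, hsum⟩ := sum_succ_mul_pow_le
  refine ⟨C * (S + 3), by positivity, fun q k w Z hk hL hkq hZ hw => ?_⟩
  set ρ : ℝ := (2 : ℝ) ^ (-(1 : ℝ) / 8) with hρ
  have hρ0 : 0 < ρ := by positivity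
  have hq0 : q ≠ 0 := by rintro rfl; norm_num at hL
  have hq1 : (1 : ℝ) ≤ q := by exact_mod_cast Nat.pos_of_ne_zero hq0
  have hw2 : (2 : ℝ) ≤ w := by exact_mod_cast hw
  have hw0 : (0 : ℝ) < w := by linarith
  set L := Real.log q with hLdef
  have hL1 : 1 ≤ L := by
    have h0 : 0 ≤ L := Real.log_natCast_nonneg q
    by_contra h
    have := Real.log_nonpos h0 (by linarith)
    linarith
  have hlw : 0 < Real.log w := Real.log_pos (by linarith)
  have hl2w : Real.log 2 ≤ Real.log w := Real.log_le_log (by norm_num) hw2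
  have hex : ∃ J, Z ≤ 2 ^ J * w :=
    ⟨Z, (Nat.lt_two_pow_self).le.trans (Nat.le_mul_of_pos_right _ (by omega))⟩
  set J := Nat.find hex with hJ
  have hJspec : Z ≤ 2 ^ J * w := Nat.find_spec hex
  have hlt : ∀ j < J, 2 ^ j * w < Z := fun j hj => not_le.1 (Nat.find_min hex hj)
  have hZq : (Z : ℝ) ≤ q :=
    hZ.trans ((Real.rpow_le_rpow_of_exponent_le hq1 (by norm_num)).trans_eq (Real.rpow_one _))
  have hJL : (J : ℝ) ≤ 3 * L := by
    rcases Nat.eq_zero_or_pos J with h0 | h0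
    · rw [h0]; push_cast; linarith
    · have h1 := hlt (J - 1) (by omega)
      have h2 : ((2 : ℝ)) ^ (J - 1) ≤ q := by
        have h3 : 2 ^ (J - 1) ≤ Z := (Nat.le_mul_of_pos_right _ (by omega)).trans h1.le
        exact le_trans (by exact_mod_cast h3) hZq
      have h3 := Real.log_le_log (by positivity) h2
      rw [Real.log_pow, Nat.cast_sub h0] at h3
      have h4 := Real.log_two_gt_d9
      push_cast at h3
      have h5 : (0 : ℝ) ≤ (J : ℝ) - 1 := by
        have : (1 : ℝ) ≤ J := by exact_mod_cast h0
        linarith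
      nlinarith
  have hmono : Monotone fun j : ℕ => 2 ^ j * w :=
    fun i j hij => Nat.mul_le_mul_right w (Nat.pow_le_pow_right (by norm_num) hij)
  set A : ℝ := Real.log w * (Real.sqrt (k / w) + (w : ℝ) ^ (-(1 : ℝ) / 8)) with hA
  have hA0 : 0 ≤ A := by positivity
  have hstep : ∀ j < J, ShellBound q k (2 ^ j * w) (2 ^ (j + 1) * w) Z
      (C * (A * (((j : ℝ) + 1) * ρ ^ j) + (L ^ 53)⁻¹)) := by
    intro j hj
    have h2j : (1 : ℝ) ≤ 2 ^ j := one_le_pow₀ (by norm_num)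
    have hwj : 2 ≤ 2 ^ j * w := hw.trans (Nat.le_mul_of_pos_left _ (by positivity))
    have h := hdy q k (2 ^ j * w) Z hq0 hk hwj
    rw [← mul_assoc, ← pow_succ'] at h
    refine h.mono ?_
    have hjZ : ((2 ^ j * w : ℕ) : ℝ) ≤ Z := by exact_mod_cast (hlt j hj).le
    have hsec := sqrt_mul_rpow_le (w := ((2 ^ j * w : ℕ) : ℝ)) hk hL hkq
      (by push_cast; positivity) (hjZ.trans hZ)
    have hlogq : Real.log ((2 ^ j * w : ℕ) : ℝ) ≤ L :=
      Real.log_le_log (by push_cast; positivity) (hjZ.trans hZq)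
    have hlog0 : 0 ≤ Real.log ((2 ^ j * w : ℕ) : ℝ) := Real.log_natCast_nonneg _
    have hlog : Real.log ((2 ^ j * w : ℕ) : ℝ) ≤ ((j : ℝ) + 1) * Real.log w := by
      push_cast
      rw [Real.log_mul (by positivity) hw0.ne', Real.log_pow]
      nlinarith [(Nat.cast_nonneg j : (0 : ℝ) ≤ j)]
    have h8 : ((2 ^ j * w : ℕ) : ℝ) ^ (-(1 : ℝ) / 8) = ρ ^ j * (w : ℝ) ^ (-(1 : ℝ) / 8) := by
      push_cast
      rw [Real.mul_rpow (by positivity) hw0.le, hρ, ← Real.rpow_natCast, ← Real.rpow_natCast,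
        ← Real.rpow_mul (by norm_num), ← Real.rpow_mul (by norm_num), mul_comm (j : ℝ)]
    have hρ2 : (1 : ℝ) / 2 ≤ ρ ^ 2 := by
      rw [hρ, ← Real.rpow_natCast, ← Real.rpow_mul (by norm_num)]
      calc (1 : ℝ) / 2 = 2 ^ (-1 : ℝ) := by rw [Real.rpow_neg_one]; norm_num
        _ ≤ _ := Real.rpow_le_rpow_of_exponent_le (by norm_num) (by norm_num)
    have hsq : Real.sqrt (k / ((2 ^ j * w : ℕ) : ℝ)) ≤ ρ ^ j * Real.sqrt (k / w) := by
      rw [show (k : ℝ) / ((2 ^ j * w : ℕ) : ℝ) = (1 / 2) ^ j * (k / w) by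
        push_cast; rw [div_pow, one_pow]; field_simp]
      calc Real.sqrt ((1 / 2) ^ j * (k / w)) ≤ Real.sqrt ((ρ ^ 2) ^ j * (k / w)) := by gcongr
        _ = _ := by
          rw [Real.sqrt_mul (by positivity), ← pow_mul, mul_comm 2 j, pow_mul,
            Real.sqrt_sq (by positivity)]
    calc C * Real.log ((2 ^ j * w : ℕ) : ℝ) * (Real.sqrt (k / ((2 ^ j * w : ℕ) : ℝ)) +
          ((2 ^ j * w : ℕ) : ℝ) ^ (-(1 : ℝ) / 8) + Real.sqrt k *
            (((2 ^ j * w : ℕ) : ℝ) ^ ((11 : ℝ) / 8) / q) ^ (1 / (2 * k : ℝ)))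
        = C * (Real.log ((2 ^ j * w : ℕ) : ℝ) * (Real.sqrt (k / ((2 ^ j * w : ℕ) : ℝ)) +
          ((2 ^ j * w : ℕ) : ℝ) ^ (-(1 : ℝ) / 8)) + Real.log ((2 ^ j * w : ℕ) : ℝ) *
          (Real.sqrt k *
            (((2 ^ j * w : ℕ) : ℝ) ^ ((11 : ℝ) / 8) / q) ^ (1 / (2 * k : ℝ)))) := by ring
      _ ≤ C * ((((j : ℝ) + 1) * Real.log w) * (ρ ^ j * Real.sqrt (k / w) +
          ρ ^ j * (w : ℝ) ^ (-(1 : ℝ) / 8)) + L * (L ^ 54)⁻¹) := by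
        rw [h8]
        gcongr
      _ = _ := by
        rw [hA, pow_succ L 53]
        field_simp
  refine ⟨2 ^ J * w, hJspec, Nat.le_mul_of_pos_left _ (by positivity), ?_⟩
  have h := ShellBound.sum (q := q) (k := k) (Z := Z) (by omega) hmono J hstep
  simp only [pow_zero, one_mul] at h
  refine h.mono ?_
  rw [← Finset.mul_sum, Finset.sum_add_distrib, ← Finset.mul_sum, Finset.sum_const,
    Finset.card_range, nsmul_eq_mul, mul_assoc C]
  have h1 := hsum J
  have h2 : (J : ℝ) * (L ^ 53)⁻¹ ≤ 3 * (L ^ 50)⁻¹ := by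
    calc (J : ℝ) * (L ^ 53)⁻¹ ≤ 3 * L * (L ^ 53)⁻¹ := by gcongr
      _ = 3 * (L ^ 52)⁻¹ := by rw [pow_succ L 52]; field_simp
      _ ≤ _ := by gcongr; norm_num
  have h3 : 0 ≤ (L ^ 50)⁻¹ := by positivity
  gcongr
  calc A * ∑ j ∈ Finset.range J, ((j : ℝ) + 1) * ρ ^ j + J * (L ^ 53)⁻¹
      ≤ A * S + 3 * (L ^ 50)⁻¹ := by gcongr
    _ ≤ _ := by nlinarith

lemma factorial_le_exp_mul {k : ℕ} (hk : 1 ≤ k) :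
    (k.factorial : ℝ) ≤ Real.exp 1 * k * (k / Real.exp 1) ^ k := by
  induction k, hk using Nat.le_induction with
  | base => simp
  | succ k hk ih =>
    have hk0 : (0 : ℝ) < k := by exact_mod_cast hk
    have he : 0 < Real.exp 1 := Real.exp_pos 1
    have h1 : Real.exp 1 * (k : ℝ) ^ (k + 1) ≤ ((k : ℝ) + 1) ^ (k + 1) := by
      have h2 : (1 : ℝ) / (k + 1) ≤ Real.log ((k + 1) / k) := by
        have h3 := Real.one_sub_inv_le_log_of_pos (show (0 : ℝ) < (k + 1) / k by positivity)
        refine le_trans (le_of_eq ?_) h3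
        field_simp
        ring
      have h4 : Real.exp 1 ≤ (((k : ℝ) + 1) / k) ^ (k + 1) := by
        rw [← Real.exp_log (show (0 : ℝ) < ((k + 1) / k) by positivity), ← Real.exp_nat_mul]
        refine Real.exp_le_exp.2 ?_
        rw [div_le_iff₀ (by positivity)] at h2
        push_cast
        linarith
      rw [div_pow, le_div_iff₀ (by positivity)] at h4
      exact h4
    rw [Nat.factorial_succ]
    push_cast
    calc ((k : ℝ) + 1) * k.factorial
        ≤ ((k : ℝ) + 1) * (Real.exp 1 * k * (k / Real.exp 1) ^ k) := by gcongr
      _ = ((k : ℝ) + 1) * (Real.exp 1 * (k : ℝ) ^ (k + 1)) / Real.exp 1 ^ k := by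
          rw [div_pow]; ring
      _ ≤ ((k : ℝ) + 1) * (((k : ℝ) + 1) ^ (k + 1)) / Real.exp 1 ^ k := by gcongr
      _ = _ := by rw [div_pow, pow_succ (Real.exp 1)]; field_simp

lemma log_mul_rpow_neg_le {y : ℝ} (hy : 1 < y) :
    Real.log y * y ^ (-(1 : ℝ) / 8) ≤ 104 ^ 13 * (Real.log y ^ 12)⁻¹ := by
  have hy0 : 0 < y := by linarith
  have hl : 0 < Real.log y := Real.log_pos hy
  have h1 := Real.log_le_rpow_div hy0.le (by norm_num : (0 : ℝ) < 1 / 104)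
  have h2 : Real.log y ^ 13 ≤ 104 ^ 13 * y ^ ((1 : ℝ) / 8) := by
    calc Real.log y ^ 13 ≤ (104 * y ^ ((1 : ℝ) / 104)) ^ 13 := by
          gcongr; linarith
      _ = 104 ^ 13 * y ^ ((1 : ℝ) / 8) := by
          rw [mul_pow, ← Real.rpow_natCast (y ^ ((1 : ℝ) / 104)), ← Real.rpow_mul hy0.le]
          norm_num
  rw [le_mul_inv_iff₀ (by positivity)]
  calc Real.log y * y ^ (-(1 : ℝ) / 8) * Real.log y ^ 12
      = Real.log y ^ 13 * y ^ (-(1 : ℝ) / 8) := by ring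
    _ ≤ 104 ^ 13 * y ^ ((1 : ℝ) / 8) * y ^ (-(1 : ℝ) / 8) := by gcongr
    _ = _ := by rw [mul_assoc, ← Real.rpow_add hy0]; norm_num

lemma rpow_neg_eighth_le {y w : ℝ} (hy : 0 < y) (hw : y / 2 ≤ w) :
    w ^ (-(1 : ℝ) / 8) ≤ 2 * y ^ (-(1 : ℝ) / 8) := by
  calc w ^ (-(1 : ℝ) / 8) ≤ (y / 2) ^ (-(1 : ℝ) / 8) :=
        Real.rpow_le_rpow_of_nonpos (by linarith) hw (by norm_num)
    _ = y ^ (-(1 : ℝ) / 8) * 2 ^ ((1 : ℝ) / 8) := by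
        rw [Real.div_rpow hy.le (by norm_num), div_eq_mul_inv, ← Real.rpow_neg (by norm_num)]
        norm_num
    _ ≤ y ^ (-(1 : ℝ) / 8) * 2 := by
        gcongr
        calc (2 : ℝ) ^ ((1 : ℝ) / 8) ≤ 2 ^ (1 : ℝ) :=
              Real.rpow_le_rpow_of_exponent_le (by norm_num) (by norm_num)
          _ = 2 := Real.rpow_one 2
    _ = _ := by ring

lemma tail_term_le {K y w : ℝ} {k : ℕ} (hK : 0 ≤ K) (hy : 1 < y) (hw : y / 2 ≤ w)
    (hlog : Real.log w ≤ 2 * Real.log y) (hk : k * Real.log y ^ 26 ≤ K * w) :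
    Real.log w * (Real.sqrt (k / w) + w ^ (-(1 : ℝ) / 8)) ≤
      (2 * Real.sqrt K + 4 * 104 ^ 13) * (Real.log y ^ 12)⁻¹ := by
  have hy0 : 0 < y := by linarith
  have hw0 : 0 < w := by linarith
  have hl : 0 < Real.log y := Real.log_pos hy
  have h1 : Real.sqrt (k / w) ≤ Real.sqrt K * (Real.log y ^ 13)⁻¹ := by
    rw [show (Real.log y ^ 13)⁻¹ = Real.sqrt ((Real.log y ^ 26)⁻¹) by
      rw [Real.sqrt_inv, show Real.log y ^ 26 = (Real.log y ^ 13) ^ 2 by ring,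
        Real.sqrt_sq (by positivity)], ← Real.sqrt_mul hK]
    refine Real.sqrt_le_sqrt ?_
    rw [div_le_iff₀ hw0, mul_right_comm, le_mul_inv_iff₀ (by positivity)]
    exact hk
  have h2 := rpow_neg_eighth_le hy0 hw
  have h3 := log_mul_rpow_neg_le hy
  calc Real.log w * (Real.sqrt (k / w) + w ^ (-(1 : ℝ) / 8))
      ≤ 2 * Real.log y * (Real.sqrt K * (Real.log y ^ 13)⁻¹ + 2 * y ^ (-(1 : ℝ) / 8)) := by gcongr
    _ = 2 * Real.sqrt K * (Real.log y * (Real.log y ^ 13)⁻¹) +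
        4 * (Real.log y * y ^ (-(1 : ℝ) / 8)) := by ring
    _ ≤ 2 * Real.sqrt K * (Real.log y ^ 12)⁻¹ + 4 * (104 ^ 13 * (Real.log y ^ 12)⁻¹) := by
        have : Real.log y * (Real.log y ^ 13)⁻¹ = (Real.log y ^ 12)⁻¹ := by
          rw [pow_succ _ 12]; field_simp
        rw [this]
        gcongr
    _ = _ := by ring

lemma one_le_loglog_bounds {q k : ℕ} (hL : 1 ≤ Real.log (Real.log q))
    (hkq : (k : ℝ) ≤ Real.log q / (400 * Real.log (Real.log q))) :
    (k : ℝ) ≤ Real.log q ∧ (Real.log q ^ 4) ^ k ≤ (q : ℝ) := by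
  have hL1 : 1 ≤ Real.log q := by
    have h0 : 0 ≤ Real.log q := Real.log_natCast_nonneg q
    by_contra h
    have := Real.log_nonpos h0 (by linarith)
    linarith
  have hq0 : (0 : ℝ) < q := by
    rcases Nat.eq_zero_or_pos q with rfl | h
    · norm_num at hL1
    · exact_mod_cast h
  have hkq' : k * (400 * Real.log (Real.log q)) ≤ Real.log q :=
    (le_div_iff₀ (by linarith)).1 hkq
  have hk0 : (0 : ℝ) ≤ k := Nat.cast_nonneg k
  refine ⟨by nlinarith, ?_⟩
  calc (Real.log q ^ 4) ^ k = Real.exp (((4 * k : ℕ) : ℝ) * Real.log (Real.log q)) := by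
        rw [Real.exp_nat_mul, Real.exp_log (by linarith), pow_mul]
    _ ≤ Real.exp (Real.log q) := by
        refine Real.exp_le_exp.2 ?_
        push_cast
        nlinarith
    _ = q := Real.exp_log hq0

lemma mertensProd_ceil_le : ∃ C > 0, ∀ y : ℝ, 2 ≤ Real.log y → Real.log y ^ 52 ≤ y →
    mertensProd (⌈y * Real.log y ^ 26⌉₊ : ℝ) ≤ Real.exp Real.eulerMascheroniConstant *
      Real.log y * Real.exp (C * (Real.log (Real.log y) / Real.log y)) ∧
    mertensProd (⌈y * Real.log y ^ 26⌉₊ : ℝ) ≤ C * Real.log y := by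
  obtain ⟨C, hC, h⟩ := mertensProd_le
  refine ⟨27 + 2 * C + Real.exp Real.eulerMascheroniConstant * 2 * Real.exp C, by positivity,
    fun y hl hy => ?_⟩
  set l := Real.log y with hldef
  set u := Real.log l / l with hu
  have hl0 : 0 < l := by linarith
  have h52 : (2 : ℝ) ^ 52 ≤ l ^ 52 := by gcongr
  have hy0 : 0 < y := by linarith
  have hl26 : (1 : ℝ) ≤ l ^ 26 := one_le_pow₀ (by linarith)
  have hyl : y ≤ y * l ^ 26 := le_mul_of_one_le_right hy0.le hl26
  set Y : ℝ := (⌈y * l ^ 26⌉₊ : ℝ) with hY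
  have hY1 : y * l ^ 26 ≤ Y := Nat.le_ceil _
  have hY2 : Y ≤ y * l ^ 27 := by
    have h1 := Nat.ceil_lt_add_one (show 0 ≤ y * l ^ 26 by positivity)
    have h2 : y * l ^ 27 = y * l ^ 26 * l := by ring
    rw [h2]
    have h3 : (1 : ℝ) ≤ y * l ^ 26 := by linarith
    nlinarith
  have hyY : y ≤ Y := hyl.trans hY1
  have hlogY1 : l ≤ Real.log Y := Real.log_le_log hy0 hyY
  have hlogY2 : Real.log Y ≤ l + 27 * Real.log l := by
    calc Real.log Y ≤ Real.log (y * l ^ 27) := Real.log_le_log (by linarith) hY2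
      _ = _ := by
        rw [Real.log_mul hy0.ne' (by positivity), Real.log_pow]; push_cast; ring
  have hll : 1 / 2 ≤ Real.log l := by
    have h1 := Real.log_two_gt_d9
    have h2 := Real.log_le_log (by norm_num) hl
    linarith
  have hu0 : 0 < u := by positivity
  have hinv : 1 / l ≤ 2 * u := by
    rw [hu, ← mul_div_assoc]
    gcongr
    linarith
  have hlogY3 : Real.log Y ≤ l * Real.exp (27 * u) := by
    calc Real.log Y ≤ l + 27 * Real.log l := hlogY2
      _ = l * (27 * u + 1) := by rw [hu]; field_simp; ring
      _ ≤ _ := by gcongr; exact Real.add_one_le_exp _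
  have hlogY4 : Real.log Y ≤ 2 * l := by
    have h1 : Y ≤ y ^ 2 := by
      have h2 : l ^ 27 ≤ y := (pow_le_pow_right₀ (by linarith) (by norm_num)).trans hy
      calc Y ≤ y * l ^ 27 := hY2
        _ ≤ y * y := by gcongr
        _ = _ := by ring
    calc Real.log Y ≤ Real.log (y ^ 2) := Real.log_le_log (by linarith) h1
      _ = _ := by rw [Real.log_pow]; push_cast; ring
  have hV := h Y (by linarith)
  have hCY : C / Real.log Y ≤ C / l := by gcongr
  have hE := Real.exp_pos Real.eulerMascheroniConstant
  constructor
  · calc mertensProd Y ≤ _ := hV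
      _ ≤ Real.exp Real.eulerMascheroniConstant * (l * Real.exp (27 * u)) *
          Real.exp (C * (2 * u)) := by
          gcongr
          calc C / Real.log Y ≤ C * (1 / l) := by rw [mul_one_div]; exact hCY
            _ ≤ _ := by gcongr
      _ = Real.exp Real.eulerMascheroniConstant * l * Real.exp ((27 + 2 * C) * u) := by
          rw [show (27 + 2 * C) * u = 27 * u + C * (2 * u) by ring, Real.exp_add]; ring
      _ ≤ _ := by
          refine mul_le_mul_of_nonneg_left (Real.exp_le_exp.2 ?_) (by positivity)
          exact mul_le_mul_of_nonneg_right (le_add_of_nonneg_right (by positivity)) hu0.le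
  · calc mertensProd Y ≤ _ := hV
      _ ≤ Real.exp Real.eulerMascheroniConstant * (2 * l) * Real.exp C := by
          gcongr
          exact hCY.trans (div_le_self hC.le (by linarith))
      _ = (Real.exp Real.eulerMascheroniConstant * 2 * Real.exp C) * l := by ring
      _ ≤ _ := mul_le_mul_of_nonneg_right (le_add_of_nonneg_left (by positivity)) hl0.le

lemma main_moment_le {k : ℕ} (hk : 1 ≤ k) {C l y Y D T S : ℝ} (hC : 0 < C) (hl : 1 ≤ l)
    (hy : y = Real.exp l) (hkl : l ^ 2 ≤ k) (hY3 : 3 ≤ Y) (hY : Y ≤ y ^ 2) (hkY : (k : ℝ) ≤ Y)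
    (hD0 : 0 ≤ D) (hD : D ≤ Y) (hT0 : 0 ≤ T) (hT : T ≤ 2) (hS0 : 0 ≤ S)
    (hS : S ≤ (1 + C / l) / (y * l)) :
    D ^ 2 * Y ^ 2 * (T * (k.factorial * S ^ k)) ≤
      (Real.exp ((8 + C) / l) * Real.sqrt (k / (Real.exp 1 * y * l))) ^ (2 * k) := by
  have hl0 : 0 < l := by linarith
  have hy0 : 0 < y := hy ▸ Real.exp_pos l
  have he0 : 0 < Real.exp 1 := Real.exp_pos 1
  have hk0 : (0 : ℝ) < k := by exact_mod_cast hk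
  have hfac := factorial_le_exp_mul hk
  have he3 : Real.exp 1 ≤ 3 := by linarith [Real.exp_one_lt_d9]
  have h8 : Y ^ 4 * 2 * (Real.exp 1 * k) ≤ Real.exp (16 * l) := by
    calc Y ^ 4 * 2 * (Real.exp 1 * k) ≤ Y ^ 4 * Y * (Y * Y) := by
          gcongr <;> linarith
      _ = Y ^ 7 := by ring
      _ ≤ Y ^ 8 := pow_le_pow_right₀ (by linarith) (by norm_num)
      _ ≤ (y ^ 2) ^ 8 := by gcongr
      _ = Real.exp (((16 : ℕ) : ℝ) * l) := by rw [Real.exp_nat_mul, ← hy]; ring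
      _ = _ := by norm_num
  have h16 : Real.exp (16 * l) ≤ Real.exp (8 / l) ^ (2 * k) := by
    rw [exp_mul_natCast]
    refine Real.exp_le_exp.2 ?_
    push_cast
    rw [div_mul_eq_mul_div, le_div_iff₀ hl0]
    nlinarith
  have hC2 : 1 + C / l ≤ Real.exp (C / l) ^ 2 := by
    have h1 := Real.add_one_le_exp (C / l)
    have h2 : 0 ≤ C / l := by positivity
    nlinarith
  have hC0 : 0 ≤ 1 + C / l := by positivity
  calc D ^ 2 * Y ^ 2 * (T * (k.factorial * S ^ k))
      ≤ Y ^ 2 * Y ^ 2 * (2 * ((Real.exp 1 * k * (k / Real.exp 1) ^ k) *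
        ((1 + C / l) / (y * l)) ^ k)) := by
        gcongr
    _ = (Y ^ 4 * 2 * (Real.exp 1 * k)) *
        ((1 + C / l) ^ k * ((k : ℝ) / (Real.exp 1 * y * l)) ^ k) := by
        rw [div_pow (k : ℝ), div_pow (1 + C / l), div_pow (k : ℝ), mul_pow, mul_pow, mul_pow]
        generalize (1 + C / l) ^ k = t
        field_simp
    _ ≤ Real.exp (8 / l) ^ (2 * k) * ((Real.exp (C / l) ^ 2) ^ k *
        ((k : ℝ) / (Real.exp 1 * y * l)) ^ k) := by
        gcongr
        exact h8.trans h16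
    _ = _ := by
        rw [mul_pow, pow_mul (Real.sqrt _), Real.sq_sqrt (by positivity), add_div,
          Real.exp_add, mul_pow, pow_mul (Real.exp (C / l))]
        exact (mul_assoc _ _ _).symm

set_option maxHeartbeats 1000000 in
/-- The moment bound for the shell that produces the main term. -/
lemma exists_shellBound_main : ∃ C > 0, ∀ (q k Z : ℕ) (y : ℝ), 3 ≤ k →
    1 ≤ Real.log (Real.log q) → (k : ℝ) ≤ Real.log q / (400 * Real.log (Real.log q)) →
    (k : ℝ) ≤ y → 2 ≤ Real.log y → Real.log y ^ 52 ≤ y → y < k * Real.log y ^ 26 →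
    ShellBound q k ⌊y⌋₊ ⌈y * Real.log y ^ 26⌉₊ Z
      (Real.exp (C * (Real.log (Real.log y) / Real.log y)) *
        Real.sqrt (Real.exp (2 * Real.eulerMascheroniConstant - 1) * k * Real.log y / y) +
        C * (Real.log y ^ 12)⁻¹) := by
  obtain ⟨C₁, hC₁, hV⟩ := mertensProd_ceil_le
  obtain ⟨C₂, hC₂, hS⟩ := sum_prime_inv_sq_le
  refine ⟨C₁ + 2 * (8 + C₂) + C₁ * (24 * 104 ^ 13), by positivity,
    fun q k Z y hk hL hkq hky hl hy52 hyk => ?_⟩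
  obtain ⟨hV1, hV2⟩ := hV y hl hy52
  obtain ⟨hkL, hq⟩ := one_le_loglog_bounds hL hkq
  set l := Real.log y with hldef
  set u := Real.log l / l with hu
  set w := ⌊y⌋₊ with hw
  set Y := ⌈y * l ^ 26⌉₊ with hYdef
  have hl0 : 0 < l := by linarith
  have h52 : (2 : ℝ) ^ 52 ≤ l ^ 52 := by gcongr
  have hy2 : (4 : ℝ) ≤ y := by linarith
  have hy0 : 0 < y := by linarith
  have hk3 : (3 : ℝ) ≤ k := by exact_mod_cast hk
  have hl26 : (1 : ℝ) ≤ l ^ 26 := one_le_pow₀ (by linarith)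
  have hY1 : y * l ^ 26 ≤ (Y : ℝ) := Nat.le_ceil _
  have hyY : y ≤ (Y : ℝ) := (le_mul_of_one_le_right hy0.le hl26).trans hY1
  have hY2 : (Y : ℝ) ≤ y ^ 2 := by
    have h1 := Nat.ceil_lt_add_one (show 0 ≤ y * l ^ 26 by positivity)
    have h2 : l ^ 26 * 2 ≤ y := by
      calc l ^ 26 * 2 ≤ l ^ 26 * l := by gcongr
        _ = l ^ 27 := by ring
        _ ≤ l ^ 52 := pow_le_pow_right₀ (by linarith) (by norm_num)
        _ ≤ y := hy52
    nlinarith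
  have hyk2 : y ≤ (k : ℝ) ^ 2 := by
    have h1 : y ^ 2 ≤ (k * l ^ 26) ^ 2 := by gcongr
    have h2 : (k * l ^ 26) ^ 2 = (k : ℝ) ^ 2 * l ^ 52 := by ring
    have h3 : (k : ℝ) ^ 2 * l ^ 52 ≤ (k : ℝ) ^ 2 * y := by gcongr
    nlinarith
  have hkl : l ^ 2 ≤ k := by
    have h1 : l ^ 2 * l ^ 26 ≤ k * l ^ 26 := by
      calc l ^ 2 * l ^ 26 = l ^ 28 := by ring
        _ ≤ l ^ 52 := pow_le_pow_right₀ (by linarith) (by norm_num)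
        _ ≤ y := hy52
        _ ≤ _ := hyk.le
    exact le_of_mul_le_mul_right h1 (by positivity)
  have hYq : (Y : ℝ) ^ k ≤ q := by
    refine le_trans ?_ hq
    gcongr
    calc (Y : ℝ) ≤ y ^ 2 := hY2
      _ ≤ ((k : ℝ) ^ 2) ^ 2 := by gcongr
      _ = (k : ℝ) ^ 4 := by ring
      _ ≤ _ := by gcongr
  have hq0 : q ≠ 0 := by rintro rfl; norm_num at hL
  have hqpos : (0 : ℝ) < q := by exact_mod_cast Nat.pos_of_ne_zero hq0
  have hw1 : 1 ≤ w := Nat.le_floor (by push_cast; linarith)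
  have hwy : (w : ℝ) ≤ y := Nat.floor_le hy0.le
  have hwy2 : y / 2 ≤ w := by linarith [Nat.lt_floor_add_one y]
  have hw0 : (0 : ℝ) < w := by exact_mod_cast hw1
  have hwY : w ≤ Y := by exact_mod_cast hwy.trans hyY
  have hY0 : (0 : ℝ) < Y := by linarith
  have hYpos : 0 < Y := by exact_mod_cast hY0
  set h := ⌈(w : ℝ) ^ ((7 : ℝ) / 8)⌉₊ with hh
  have hp7 : 1 ≤ (w : ℝ) ^ ((7 : ℝ) / 8) := Real.one_le_rpow (by exact_mod_cast hw1) (by norm_num)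
  have hh2 : (h : ℝ) ≤ 2 * (w : ℝ) ^ ((7 : ℝ) / 8) := by
    linarith [Nat.ceil_lt_add_one (show 0 ≤ (w : ℝ) ^ ((7 : ℝ) / 8) by linarith)]
  have hhpos : 0 < h := Nat.ceil_pos.2 (by linarith)
  set X : ℝ := Real.exp ((8 + C₂) / l) * Real.sqrt (k / (Real.exp 1 * y * l)) with hX
  have hX0 : 0 ≤ X := by positivity
  have hbound : (((Y - w) / h + 1 : ℕ) : ℝ) ^ 2 * (Y ^ 2 : ℕ) * ((1 + (Y : ℝ) ^ k / q) *
      (k.factorial * (∑ p ∈ (Finset.Ioc w Y).filter Nat.Prime, 1 / (p : ℝ) ^ 2) ^ k)) ≤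
      X ^ (2 * k) := by
    have hD : (((Y - w) / h + 1 : ℕ) : ℝ) ≤ Y := by
      have := Nat.div_le_self (Y - w) h
      exact_mod_cast (by omega : (Y - w) / h + 1 ≤ Y)
    have hsum := hS y (by linarith) Y
    have hone : 1 + (Y : ℝ) ^ k / q ≤ 2 := by
      have := (div_le_one hqpos).2 hYq
      linarith
    push_cast at hD ⊢
    exact main_moment_le (by omega) hC₂ (by linarith) (Real.exp_log hy0).symm hkl (by linarith)
      hY2 (hky.trans hyY) (by positivity) hD (by positivity) hone
      (Finset.sum_nonneg fun _ _ => by positivity) hsum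
  refine (shellBound_of_block hq0 Z (by omega) (by omega) hwY hhpos
    (by positivity : 0 < Y ^ 2) hX0 hbound).mono ?_
  have hw8 : (w : ℝ) ^ (-(1 : ℝ) / 8) ≤ 2 * y ^ (-(1 : ℝ) / 8) := rpow_neg_eighth_le hy0 hwy2
  have herr : 2 * (h : ℝ) / w + 2 * Real.pi * Y / (Y ^ 2 : ℕ) ≤ 24 * y ^ (-(1 : ℝ) / 8) := by
    have h1 : 2 * (h : ℝ) / w ≤ 4 * (w : ℝ) ^ (-(1 : ℝ) / 8) := by
      rw [div_le_iff₀ hw0, mul_assoc, ← Real.rpow_add_one hw0.ne']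
      norm_num at hh2 ⊢
      linarith
    have h2 : 2 * Real.pi * Y / (Y ^ 2 : ℕ) ≤ 8 * y ^ (-(1 : ℝ) / 8) := by
      push_cast
      calc 2 * Real.pi * Y / (Y : ℝ) ^ 2 = 2 * Real.pi / Y := by field_simp
        _ ≤ 8 / y := by
            gcongr
            linarith [Real.pi_le_four]
        _ = 8 * y ^ (-1 : ℝ) := by rw [Real.rpow_neg_one]; ring
        _ ≤ _ := by
            gcongr
            · linarith
            · norm_num
    have h3 : 0 ≤ y ^ (-(1 : ℝ) / 8) := by positivity
    linarith
  have hlog := log_mul_rpow_neg_le (show 1 < y by linarith)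
  rw [← hldef] at hlog
  have hll : 1 / 2 ≤ Real.log l := by
    have h1 := Real.log_two_gt_d9
    have h2 := Real.log_le_log (by norm_num) hl
    linarith
  have hu0 : 0 < u := by positivity
  have hinv : (8 + C₂) / l ≤ 2 * (8 + C₂) * u := by
    rw [hu, ← mul_div_assoc]
    gcongr
    have := mul_le_mul_of_nonneg_left hll (show 0 ≤ 2 * (8 + C₂) by positivity)
    linarith
  have hVX : mertensProd (Y : ℝ) * X ≤ Real.exp ((C₁ + 2 * (8 + C₂)) * u) *
      Real.sqrt (Real.exp (2 * Real.eulerMascheroniConstant - 1) * k * l / y) := by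
    have hsqrt : Real.exp Real.eulerMascheroniConstant * l * Real.sqrt (k / (Real.exp 1 * y * l)) =
        Real.sqrt (Real.exp (2 * Real.eulerMascheroniConstant - 1) * k * l / y) := by
      rw [← Real.sqrt_sq (show 0 ≤ Real.exp Real.eulerMascheroniConstant * l by positivity),
        ← Real.sqrt_mul (by positivity)]
      congr 1
      rw [Real.exp_sub, mul_comm 2 Real.eulerMascheroniConstant, mul_pow, exp_mul_natCast]
      push_cast
      field_simp
    calc mertensProd (Y : ℝ) * X ≤ (Real.exp Real.eulerMascheroniConstant * l *
          Real.exp (C₁ * u)) * (Real.exp (2 * (8 + C₂) * u) *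
            Real.sqrt (k / (Real.exp 1 * y * l))) := by
          rw [hX]; gcongr
      _ = Real.exp (C₁ * u) * Real.exp (2 * (8 + C₂) * u) *
          (Real.exp Real.eulerMascheroniConstant * l *
            Real.sqrt (k / (Real.exp 1 * y * l))) := by ring
      _ = _ := by rw [hsqrt, ← Real.exp_add]; ring_nf
  calc mertensProd (Y : ℝ) * (X + (2 * (h : ℝ) / w + 2 * Real.pi * Y / (Y ^ 2 : ℕ)))
      = mertensProd (Y : ℝ) * X +
        mertensProd (Y : ℝ) * (2 * (h : ℝ) / w + 2 * Real.pi * Y / (Y ^ 2 : ℕ)) := by ring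
    _ ≤ Real.exp ((C₁ + 2 * (8 + C₂)) * u) *
        Real.sqrt (Real.exp (2 * Real.eulerMascheroniConstant - 1) * k * l / y) +
        (C₁ * l) * (24 * y ^ (-(1 : ℝ) / 8)) := by
        gcongr
    _ = Real.exp ((C₁ + 2 * (8 + C₂)) * u) *
        Real.sqrt (Real.exp (2 * Real.eulerMascheroniConstant - 1) * k * l / y) +
        C₁ * 24 * (l * y ^ (-(1 : ℝ) / 8)) := by ring
    _ ≤ Real.exp ((C₁ + 2 * (8 + C₂)) * u) *
        Real.sqrt (Real.exp (2 * Real.eulerMascheroniConstant - 1) * k * l / y) +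
        C₁ * 24 * (104 ^ 13 * (l ^ 12)⁻¹) := by
        gcongr
    _ ≤ Real.exp ((C₁ + 2 * (8 + C₂) + C₁ * (24 * 104 ^ 13)) * u) *
        Real.sqrt (Real.exp (2 * Real.eulerMascheroniConstant - 1) * k * l / y) +
        (C₁ * (24 * 104 ^ 13)) * (l ^ 12)⁻¹ := by
        refine add_le_add ?_ (le_of_eq (by ring))
        refine mul_le_mul_of_nonneg_right (Real.exp_le_exp.2 ?_) (Real.sqrt_nonneg _)
        exact mul_le_mul_of_nonneg_right (le_add_of_nonneg_right (by positivity)) hu0.le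
    _ ≤ _ := by
        refine add_le_add le_rfl (mul_le_mul_of_nonneg_right ?_ (by positivity))
        exact le_add_of_nonneg_left (by positivity)

lemma one_lt_log_three : (1.02 : ℝ) < Real.log 3 := by
  have h2 := Real.log_two_gt_d9
  have h32 := Real.one_sub_inv_le_log_of_pos (show (0 : ℝ) < 3 / 2 by norm_num)
  have h : Real.log 3 = Real.log 2 + Real.log (3 / 2) := by
    rw [← Real.log_mul (by norm_num) (by norm_num)]; norm_num
  rw [h]
  norm_num at h32 h2 ⊢
  linarith

lemma one_le_loglog {q k : ℕ} (hk : 3 ≤ k)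
    (h : (k : ℝ) ≤ Real.log q / (400 * Real.log (Real.log q))) :
    1 ≤ Real.log (Real.log q) := by
  have hk' : (3 : ℝ) ≤ k := by exact_mod_cast hk
  have hL0 : 0 ≤ Real.log q := Real.log_natCast_nonneg q
  have hpos : 0 < Real.log (Real.log q) := by
    by_contra hneg
    have := div_nonpos_of_nonneg_of_nonpos hL0
      (show 400 * Real.log (Real.log q) ≤ 0 by linarith)
    linarith
  have hL1 : 1 < Real.log q := (Real.log_pos_iff hL0).1 hpos
  have hq3 : 3 ≤ q := by
    by_contra hq
    have hq2 : (q : ℝ) ≤ 2 := by exact_mod_cast (show q ≤ 2 by omega)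
    have hq0 : (0 : ℝ) < q := by
      rcases Nat.eq_zero_or_pos q with rfl | h0
      · simp at hL1
        linarith
      · exact_mod_cast h0
    have := Real.log_le_log hq0 hq2
    have := Real.log_two_lt_d9
    linarith
  have hlog3 : Real.log 3 ≤ Real.log q :=
    Real.log_le_log (by norm_num) (by exact_mod_cast hq3)
  have hL2 : 1.02 < Real.log q := one_lt_log_three.trans_le hlog3
  have hll : (0.019 : ℝ) ≤ Real.log (Real.log q) := by
    have h1 := Real.one_sub_inv_le_log_of_pos (show 0 < Real.log q by linarith)
    have h2 : (Real.log q)⁻¹ ≤ (1.02 : ℝ)⁻¹ := inv_anti₀ (by norm_num) hL2.le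
    norm_num at h2 ⊢
    linarith
  rw [le_div_iff₀ (by positivity)] at h
  have h22 : 22 ≤ Real.log q := by nlinarith
  rw [Real.le_log_iff_exp_le (by linarith)]
  linarith [Real.exp_one_lt_d9]

lemma exists_log_pow_le : ∃ y₀ : ℝ, 1 < y₀ ∧ ∀ y, y₀ ≤ y → 2 ≤ Real.log y ∧ Real.log y ^ 52 ≤ y := by
  have h1 := Real.tendsto_log_atTop.eventually_ge_atTop 2
  have h2 := (isLittleO_pow_log_id_atTop (n := 52)).bound one_pos
  obtain ⟨a, ha⟩ := Filter.eventually_atTop.1 (h1.and h2)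
  refine ⟨max a 2, by simp, fun y hy => ?_⟩
  have hy2 : 2 ≤ y := (le_max_right _ _).trans hy
  obtain ⟨h3, h4⟩ := ha y ((le_max_left _ _).trans hy)
  refine ⟨h3, ?_⟩
  simp only [id, one_mul, Real.norm_eq_abs] at h4
  rw [abs_of_nonneg (show 0 ≤ y by linarith)] at h4
  exact (le_abs_self _).trans h4

/-- The tail contribution measured in powers of `log y`. -/
lemma exists_shellBound_tail_log (K : ℝ) (hK : 0 ≤ K) : ∃ C > 0, ∀ (q k w Z : ℕ) (y : ℝ), 3 ≤ k →
    (k : ℝ) ≤ Real.log q / (400 * Real.log (Real.log q)) →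
    (Z : ℝ) ≤ (q : ℝ) ^ ((11 : ℝ) / 21) → 2 ≤ w → 3 ≤ y → Real.log y ≤ Real.log q →
    y / 2 ≤ w → Real.log w ≤ 2 * Real.log y → k * Real.log y ^ 26 ≤ K * w →
    ∃ W, Z ≤ W ∧ w ≤ W ∧ ShellBound q k w W Z (C * (Real.log y ^ 12)⁻¹) := by
  obtain ⟨C, hC, h⟩ := exists_shellBound_tail
  refine ⟨C * (2 * Real.sqrt K + 4 * 104 ^ 13 + 1), by positivity, ?_⟩
  intro q k w Z y hk hkq hZ hw hy hyq hyw hlog hkw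
  obtain ⟨W, hZW, hwW, hS⟩ := h q k w Z hk (one_le_loglog hk hkq) hkq hZ hw
  refine ⟨W, hZW, hwW, hS.mono ?_⟩
  have hl1 : 1 ≤ Real.log y := by
    have := Real.log_le_log (by norm_num) hy
    linarith [one_lt_log_three]
  have h1 := tail_term_le hK (by linarith) hyw hlog hkw
  have h2 : (Real.log q ^ 50)⁻¹ ≤ (Real.log y ^ 12)⁻¹ := by
    refine inv_anti₀ (by positivity) ?_
    calc Real.log y ^ 12 ≤ Real.log y ^ 50 := pow_le_pow_right₀ hl1 (by norm_num)
      _ ≤ Real.log q ^ 50 := pow_le_pow_left₀ (by linarith) hyq 50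
  rw [mul_assoc]
  refine mul_le_mul_of_nonneg_left ?_ hC.le
  linarith

/-- A moment bound for the whole range of smoothness above `y`. -/
lemma exists_shellBound_total : ∃ C > 0, ∀ (q k Z : ℕ) (y : ℝ), 3 ≤ k →
    (k : ℝ) ≤ Real.log q / (400 * Real.log (Real.log q)) →
    (Z : ℝ) ≤ (q : ℝ) ^ ((11 : ℝ) / 21) → 3 ≤ y → (k : ℝ) ≤ y → Real.log y ≤ Real.log q →
    ∃ W, Z ≤ W ∧ ShellBound q k ⌊y⌋₊ W Z
      (Real.exp (C * (Real.log (Real.log y) / Real.log y)) *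
        Real.sqrt (Real.exp (2 * Real.eulerMascheroniConstant - 1) * k * Real.log y / y) +
        C * (Real.log y ^ 12)⁻¹) := by
  obtain ⟨y₀, hy₀, hlarge⟩ := exists_log_pow_le
  obtain ⟨C₁, hC₁, hmain⟩ := exists_shellBound_main
  have hly₀ : 0 < Real.log y₀ := Real.log_pos hy₀
  obtain ⟨C₂, hC₂, htail⟩ := exists_shellBound_tail_log (2 + 2 * Real.log y₀ ^ 26) (by positivity)
  refine ⟨C₁ + C₂, by positivity, ?_⟩
  intro q k Z y hk hkq hZ hy hky hyq
  have hl1 : 1 ≤ Real.log y := by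
    have := Real.log_le_log (by norm_num) hy
    linarith [one_lt_log_three]
  have hll : 0 ≤ Real.log (Real.log y) := Real.log_nonneg hl1
  have hk0 : (0 : ℝ) ≤ k := Nat.cast_nonneg k
  by_cases hcase : y₀ ≤ y ∧ y < k * Real.log y ^ 26
  · obtain ⟨hyy₀, hyk⟩ := hcase
    obtain ⟨hl2, hl52⟩ := hlarge y hyy₀
    have hS := hmain q k Z y hk (one_le_loglog hk hkq) hkq hky hl2 hl52 hyk
    have hl26 : 1 ≤ Real.log y ^ 26 := one_le_pow₀ hl1
    have hyl : y ≤ y * Real.log y ^ 26 := le_mul_of_one_le_right (by linarith) hl26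
    have hceil : y * Real.log y ^ 26 ≤ (⌈y * Real.log y ^ 26⌉₊ : ℝ) := Nat.le_ceil _
    have hceil' : (⌈y * Real.log y ^ 26⌉₊ : ℝ) ≤ y ^ 2 := by
      have h1 : (⌈y * Real.log y ^ 26⌉₊ : ℝ) < y * Real.log y ^ 26 + 1 :=
        Nat.ceil_lt_add_one (by linarith)
      have hb : 2 ^ 26 ≤ Real.log y ^ 26 := pow_le_pow_left₀ (by norm_num) hl2 26
      have hsq : Real.log y ^ 26 * Real.log y ^ 26 ≤ y := by rw [← pow_add]; exact hl52
      have h2 : 2 * Real.log y ^ 26 ≤ y := by nlinarith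
      nlinarith
    obtain ⟨W, hZW, hwW, hT⟩ := htail q k ⌈y * Real.log y ^ 26⌉₊ Z y hk hkq hZ
      (by exact_mod_cast (show (2 : ℝ) ≤ (⌈y * Real.log y ^ 26⌉₊ : ℝ) by linarith)) hy hyq
      (by linarith)
      (by
        have := Real.log_le_log (by linarith) hceil'
        rwa [Real.log_pow, Nat.cast_ofNat] at this)
      (by
        have h1 : k * Real.log y ^ 26 ≤ y * Real.log y ^ 26 :=
          mul_le_mul_of_nonneg_right hky (by positivity)
        have h2 : (0 : ℝ) ≤ (1 + 2 * Real.log y₀ ^ 26) * (⌈y * Real.log y ^ 26⌉₊ : ℝ) := by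
          positivity
        linarith)
    refine ⟨W, hZW, (hS.trans (by omega) ?_ hwW hT).mono ?_⟩
    · exact_mod_cast ((Nat.floor_le (by linarith)).trans hyl).trans hceil
    · have he : Real.exp (C₁ * (Real.log (Real.log y) / Real.log y)) ≤
          Real.exp ((C₁ + C₂) * (Real.log (Real.log y) / Real.log y)) := by
        apply Real.exp_le_exp.2
        exact mul_le_mul_of_nonneg_right (by linarith) (by positivity)
      have := mul_le_mul_of_nonneg_right he (Real.sqrt_nonneg
        (Real.exp (2 * Real.eulerMascheroniConstant - 1) * k * Real.log y / y))
      linarith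
  · have hfl : (3 : ℕ) ≤ ⌊y⌋₊ := Nat.le_floor (by exact_mod_cast hy)
    have hfy : (⌊y⌋₊ : ℝ) ≤ y := Nat.floor_le (by linarith)
    have hyf : y / 2 ≤ (⌊y⌋₊ : ℝ) := by
      have := Nat.lt_floor_add_one y
      linarith
    have hkw : k * Real.log y ^ 26 ≤ (2 + 2 * Real.log y₀ ^ 26) * (⌊y⌋₊ : ℝ) := by
      have h0 : (0 : ℝ) ≤ Real.log y₀ ^ 26 * (⌊y⌋₊ : ℝ) := by positivity
      rcases lt_or_ge y y₀ with hlt | hge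
      · have h1 : Real.log y ^ 26 ≤ Real.log y₀ ^ 26 :=
          pow_le_pow_left₀ (by linarith) (Real.log_le_log (by linarith) hlt.le) 26
        have h2 : k * Real.log y ^ 26 ≤ 2 * (⌊y⌋₊ : ℝ) * Real.log y₀ ^ 26 :=
          mul_le_mul (by linarith) h1 (by positivity) (by positivity)
        have h3 : (0 : ℝ) ≤ (⌊y⌋₊ : ℝ) := by positivity
        linarith
      · have h1 : k * Real.log y ^ 26 ≤ y := not_lt.1 fun hlt => hcase ⟨hge, hlt⟩
        linarith
    obtain ⟨W, hZW, -, hT⟩ := htail q k ⌊y⌋₊ Z y hk hkq hZ (by omega) hy hyq hyf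
      (by
        have := Real.log_le_log (by linarith) hfy
        linarith) hkw
    refine ⟨W, hZW, hT.mono ?_⟩
    have h1 : 0 ≤ C₁ * (Real.log y ^ 12)⁻¹ := by positivity
    have h2 : 0 ≤ Real.exp ((C₁ + C₂) * (Real.log (Real.log y) / Real.log y)) *
        Real.sqrt (Real.exp (2 * Real.eulerMascheroniConstant - 1) * k * Real.log y / y) := by
      positivity
    linarith

/-- Separates the two terms in the `2 * k`-th power of a sum. -/
lemma pow_two_mul_add_le {C l A : ℝ} (hC : 0 < C) (hl : 1.02 ≤ l) (hA : 0 ≤ A) (k : ℕ) :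
    (Real.exp (C * (Real.log l / l)) * Real.sqrt A + C * (l ^ 12)⁻¹) ^ (2 * k) ≤
      Real.exp ((2 * (C + 1)) * k * Real.log l / l) * A ^ k +
        Real.exp (122 * C * k) / l ^ (19 * k) := by
  have hl0 : 0 < l := by linarith
  have hll : 0.019 ≤ Real.log l := by
    have h1 := Real.one_sub_inv_le_log_of_pos hl0
    have h2 : l⁻¹ ≤ (1.02 : ℝ)⁻¹ := inv_anti₀ (by norm_num) hl
    norm_num at h2 ⊢
    linarith
  have hu : 0 < Real.log l / l := div_pos (by linarith) hl0
  set u := Real.log l / l with hudef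
  set M := Real.exp (C * u) * Real.sqrt A with hM
  have hM0 : 0 ≤ M := by positivity
  have hX0 : 0 ≤ M + C * (l ^ 12)⁻¹ := by positivity
  rcases le_or_gt (C * (l ^ 12)⁻¹) (M * u) with hsmall | hbig
  · have hX : M + C * (l ^ 12)⁻¹ ≤ Real.exp ((C + 1) * u) * Real.sqrt A := by
      calc M + C * (l ^ 12)⁻¹ ≤ M * (u + 1) := by linarith
        _ ≤ M * Real.exp u := mul_le_mul_of_nonneg_left (Real.add_one_le_exp u) hM0
        _ = Real.exp ((C + 1) * u) * Real.sqrt A := by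
            rw [hM, add_mul, one_mul, Real.exp_add]; ring
    calc (M + C * (l ^ 12)⁻¹) ^ (2 * k)
        ≤ (Real.exp ((C + 1) * u) * Real.sqrt A) ^ (2 * k) := pow_le_pow_left₀ hX0 hX _
      _ = Real.exp ((2 * (C + 1)) * k * Real.log l / l) * A ^ k := by
          rw [mul_pow, exp_mul_natCast, pow_mul (Real.sqrt A), Real.sq_sqrt hA]
          congr 2
          rw [hudef]; push_cast; ring
      _ ≤ _ := le_add_of_nonneg_right (by positivity)
  · have hM' : M ≤ 60 * C * (l ^ 11)⁻¹ := by
      have h1 : M * Real.log l < C * (l ^ 11)⁻¹ := by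
        have := mul_lt_mul_of_pos_right hbig hl0
        calc M * Real.log l = M * u * l := by rw [hudef]; field_simp
          _ < C * (l ^ 12)⁻¹ * l := this
          _ = C * (l ^ 11)⁻¹ := by field_simp
      have h2 : M * 0.019 ≤ M * Real.log l := mul_le_mul_of_nonneg_left hll hM0
      have h3 : M * 0.019 ≤ C * (l ^ 11)⁻¹ := h2.trans h1.le
      norm_num at h3
      linarith
    have hl1 : 1 ≤ l := by norm_num at hl; linarith
    have hX : M + C * (l ^ 12)⁻¹ ≤ 61 * C * (l ^ 11)⁻¹ := by
      have : (l ^ 12)⁻¹ ≤ (l ^ 11)⁻¹ :=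
        inv_anti₀ (by positivity) (pow_le_pow_right₀ hl1 (by norm_num))
      have := mul_le_mul_of_nonneg_left this hC.le
      linarith
    have hC61 : 61 * C ≤ Real.exp (61 * C) := by linarith [Real.add_one_le_exp (61 * C)]
    calc (M + C * (l ^ 12)⁻¹) ^ (2 * k)
        ≤ (Real.exp (61 * C) * (l ^ 11)⁻¹) ^ (2 * k) :=
          pow_le_pow_left₀ hX0 (hX.trans (mul_le_mul_of_nonneg_right hC61 (by positivity))) _
      _ = Real.exp (122 * C * k) / l ^ (22 * k) := by
          rw [mul_pow, exp_mul_natCast, inv_pow, ← pow_mul, div_eq_mul_inv]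
          congr 2
          · push_cast; ring
          · congr 1; ring
      _ ≤ Real.exp (122 * C * k) / l ^ (19 * k) :=
          div_le_div_of_nonneg_left (by positivity) (by positivity)
            (pow_le_pow_right₀ hl1 (by omega))
      _ ≤ _ := le_add_of_nonneg_left (by positivity)

/-- Theorem 10: moments of `S_{y,z}`. -/
theorem moment_bound :
    ∃ C : ℝ, 0 < C ∧
      ∀ q k : ℕ, 3 ≤ k → (k : ℝ) ≤ Real.log q / (400 * Real.log (Real.log q)) →
        ∀ y z : ℝ, (k : ℝ) * Real.log k ≤ y → y ≤ z → z ≤ (q : ℝ) ^ ((11 : ℝ) / 21) →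
          (∑ χ : DirichletCharacter ℂ q, Syz χ y z ^ (2 * k)) / q.totient ≤
            Real.exp (C * k * Real.log (Real.log y) / Real.log y) *
                (Real.exp (2 * Real.eulerMascheroniConstant - 1) * k * Real.log y / y) ^ k +
              Real.exp (C * k) / Real.log y ^ (19 * k) := by
  obtain ⟨C, hC, h⟩ := exists_shellBound_total
  refine ⟨122 * (C + 1), by positivity, ?_⟩
  intro q k hk hkq y z hky hyz hzq
  have hk3 : (3 : ℝ) ≤ k := by exact_mod_cast hk
  have hlogk : 1.02 < Real.log k := one_lt_log_three.trans_le (Real.log_le_log (by norm_num) hk3)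
  have hkl : (k : ℝ) ≤ k * Real.log k :=
    le_mul_of_one_le_right (by linarith) (by norm_num at hlogk; linarith)
  have hy3 : 3 ≤ y := by linarith
  have hl : 1.02 ≤ Real.log y :=
    one_lt_log_three.le.trans (Real.log_le_log (by norm_num) hy3)
  have hl0 : 0 < Real.log y := by linarith
  have hll : 0 ≤ Real.log (Real.log y) := Real.log_nonneg (by norm_num at hl; linarith)
  have hq : q ≠ 0 := by
    rintro rfl
    rw [Nat.cast_zero, Real.zero_rpow (by norm_num)] at hzq
    linarith
  have hq1 : (1 : ℝ) ≤ q := by exact_mod_cast Nat.one_le_iff_ne_zero.2 hq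
  have hyq : y ≤ q := by
    have := Real.rpow_le_rpow_of_exponent_le hq1 (show (11 : ℝ) / 21 ≤ 1 by norm_num)
    rw [Real.rpow_one] at this
    linarith
  obtain ⟨W, hW, hS⟩ := h q k ⌊z⌋₊ y hk hkq ((Nat.floor_le (by linarith)).trans hzq) hy3
    (hkl.trans hky) (Real.log_le_log (by linarith) hyq)
  have hφ : (0 : ℝ) < q.totient := by exact_mod_cast Nat.totient_pos.2 (Nat.pos_of_ne_zero hq)
  rw [div_le_iff₀' hφ]
  refine (sum_Syz_pow_le (by linarith) hW hS).trans (mul_le_mul_of_nonneg_left ?_ hφ.le)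
  refine (pow_two_mul_add_le hC hl (by positivity) k).trans (add_le_add ?_ ?_)
  · refine mul_le_mul_of_nonneg_right (Real.exp_le_exp.2 ?_) (by positivity)
    simp only [mul_div_assoc]
    rw [mul_assoc, mul_assoc (122 * (C + 1))]
    exact mul_le_mul_of_nonneg_right (by linarith) (by positivity)
  · refine div_le_div_of_nonneg_right (Real.exp_le_exp.2 ?_) (by positivity)
    exact mul_le_mul_of_nonneg_right (by linarith) (by positivity)
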